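/- arXiv:1805.04480 — 2 statements merged into one kernel-verified Lean document; each statement's English description precedes it below -/
import Mathlib

section
/- Let a̲₁, ā₁, a̲₃, ā₃ be real numbers with 0 ≤ a̲₃ < 1 satisfying 0 ≤ a̲₃ ≤ ā₃ ≤ 1, a̲₃ + a̲₃·ā₁ + ā₁ = 0, 2a̲₁ + ā₃ ≤ −a̲₃(3 + a̲₁ + 2ā₃), and 2ā₃ + a̲₁ ≥ −ā₁(3 + ā₃ + 2a̲₁). Then there exist real numbers ξ₁, ξ₂ with {1, ξ₁, ξ₂} linearly independent over ℚ such that φ̲₁ = a̲₁, φ̄₁ = ā₁, φ̲₃ = a̲₃, φ̄₃ = ā₃, φ̲₂ = (a̲₃ − ā₃)/(2 − a̲₃ − ā₃·a̲₃), and φ̄₂ = (ā₁ − a̲₁)/(2 − ā₁ − ā₁·a̲₁). -/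
open Filter Pointwise

/-- The lattice `Λ = {(x, ξ₁x - y₁, ξ₂x - y₂) : x, y₁, y₂ ∈ ℤ} ⊆ ℝ³`. -/
def LatticeSet (ξ₁ ξ₂ : ℝ) : Set (Fin 3 → ℝ) :=
  {p | ∃ x y₁ y₂ : ℤ, p 0 = (x : ℝ) ∧ p 1 = ξ₁ * x - y₁ ∧ p 2 = ξ₂ * x - y₂}

/-- The box `K(q) = {(z₀,z₁,z₂) : |z₀| ≤ e^{2q}, |z₁| ≤ e^{-q}, |z₂| ≤ e^{-q}}`. -/
def Box (q : ℝ) : Set (Fin 3 → ℝ) :=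
  {z | |z 0| ≤ Real.exp (2 * q) ∧ |z 1| ≤ Real.exp (-q) ∧ |z 2| ≤ Real.exp (-q)}

/-- The `j`-th successive minimum `λ_j(q)` of `K(q)` with respect to `Λ`:
the infimum of all `λ > 0` such that `λ·K(q)` contains `j` linearly independent
points of `Λ`. -/
noncomputable def lambdaMin (ξ₁ ξ₂ : ℝ) (j : ℕ) (q : ℝ) : ℝ :=
  sInf {l : ℝ | 0 < l ∧ ∃ v : Fin j → (Fin 3 → ℝ), LinearIndependent ℝ v ∧
    ∀ i, v i ∈ LatticeSet ξ₁ ξ₂ ∧ v i ∈ l • Box q}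

/-- `L_j(q) = log λ_j(q)`. -/
noncomputable def Lmin (ξ₁ ξ₂ : ℝ) (j : ℕ) (q : ℝ) : ℝ :=
  Real.log (lambdaMin ξ₁ ξ₂ j q)

/-- `φ̲_j = liminf_{q → ∞} L_j(q)/q`. -/
noncomputable def phiLow (ξ₁ ξ₂ : ℝ) (j : ℕ) : ℝ :=
  liminf (fun q : ℝ => Lmin ξ₁ ξ₂ j q / q) atTop

/-- `φ̄_j = limsup_{q → ∞} L_j(q)/q`. -/
noncomputable def phiUp (ξ₁ ξ₂ : ℝ) (j : ℕ) : ℝ :=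
  limsup (fun q : ℝ => Lmin ξ₁ ξ₂ j q / q) atTop

theorem mem_smul_Box_iff {l q : ℝ} (hl : 0 < l) (z : Fin 3 → ℝ) :
    z ∈ l • Box q ↔ |z 0| ≤ l * Real.exp (2 * q) ∧ |z 1| ≤ l * Real.exp (-q) ∧
      |z 2| ≤ l * Real.exp (-q) := by
  rw [Set.mem_smul_set_iff_inv_smul_mem₀ hl.ne']
  simp only [Box, Set.mem_ofPred_eq, Pi.smul_apply, smul_eq_mul, abs_mul, abs_inv, abs_of_pos hl,
    inv_mul_le_iff₀ hl]

/-- The point of `Λ` with integer coordinates `p`. -/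
def latticeVec (ξ₁ ξ₂ : ℝ) (p : Fin 3 → ℤ) : Fin 3 → ℝ :=
  ![(p 0 : ℝ), ξ₁ * p 0 - p 1, ξ₂ * p 0 - p 2]

theorem mem_LatticeSet_iff {ξ₁ ξ₂ : ℝ} {z : Fin 3 → ℝ} :
    z ∈ LatticeSet ξ₁ ξ₂ ↔ ∃ p, z = latticeVec ξ₁ ξ₂ p := by
  constructor
  · rintro ⟨x, y₁, y₂, h0, h1, h2⟩
    refine ⟨![x, y₁, y₂], ?_⟩
    ext i
    fin_cases i <;> simp [latticeVec, *]
  · rintro ⟨p, rfl⟩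
    exact ⟨p 0, p 1, p 2, by simp [latticeVec]⟩

theorem det_latticeVec (ξ₁ ξ₂ : ℝ) (P : Fin 3 → Fin 3 → ℤ) :
    (Matrix.of fun i => latticeVec ξ₁ ξ₂ (P i)).det = ((Matrix.of P).det : ℤ) := by
  simp only [Matrix.det_fin_three, Matrix.of_apply, latticeVec]
  simp
  ring

theorem abs_det_le_of_mem_smul_Box {q : ℝ} {l : Fin 3 → ℝ} (hl : ∀ i, 0 < l i)
    {w : Fin 3 → Fin 3 → ℝ} (hw : ∀ i, w i ∈ l i • Box q) :
    |(Matrix.of w).det| ≤ 6 * (l 0 * l 1 * l 2) := by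
  have h := fun i => (mem_smul_Box_iff (hl i) (w i)).1 (hw i)
  have key : ∀ i j k : Fin 3, |w i 0 * w j 1 * w k 2| ≤ l i * l j * l k := by
    intro i j k
    have := mul_le_mul (mul_le_mul (h i).1 (h j).2.1 (abs_nonneg _)
      (mul_pos (hl i) (Real.exp_pos _)).le) (h k).2.2 (abs_nonneg _)
      (mul_pos (mul_pos (hl i) (Real.exp_pos _)) (mul_pos (hl j) (Real.exp_pos _))).le
    rw [abs_mul, abs_mul]
    refine this.trans (le_of_eq ?_)
    have e : Real.exp (2 * q) * Real.exp (-q) * Real.exp (-q) = 1 := by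
      rw [← Real.exp_add, ← Real.exp_add]; simp; ring
    linear_combination (l i * l j * l k) * e
  rw [Matrix.det_fin_three]
  simp only [Matrix.of_apply]
  have h1 := abs_le.1 (key 0 1 2)
  have h2 := abs_le.1 (key 0 2 1)
  have h3 := abs_le.1 (key 1 0 2)
  have h4 := abs_le.1 (key 2 0 1)
  have h5 := abs_le.1 (key 1 2 0)
  have h6 := abs_le.1 (key 2 1 0)
  rw [abs_le]
  constructor <;> linarith

/-- A family of `j + 1` independent vectors does not lie in the span of the first `j` rows of an
invertible `3 × 3` matrix. -/
theorem exists_det_updateRow_ne_zero {A : Matrix (Fin 3) (Fin 3) ℝ} (hA : A.det ≠ 0) (j : Fin 3)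
    {v : Fin (j + 1) → Fin 3 → ℝ} (hv : LinearIndependent ℝ v) :
    ∃ s, ∃ i, j ≤ i ∧ (A.updateRow i (v s)).det ≠ 0 := by
  by_contra! hcon
  have hmem : ∀ s, v s ∈ Submodule.span ℝ (Set.range fun i : Fin j => A (i.castLE (by omega))) := by
    intro s
    have hc := Matrix.mulVec_cramer A.transpose (v s)
    have hsum : v s = ∑ i, (A.det⁻¹ * (A.updateRow i (v s)).det) • A i := by
      ext t
      have := congrFun hc t
      simp only [Matrix.mulVec, dotProduct, Matrix.transpose_apply, Matrix.cramer_transpose_apply,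
        Matrix.det_transpose, Pi.smul_apply, smul_eq_mul] at this
      simp only [Finset.sum_apply, Pi.smul_apply, smul_eq_mul]
      rw [← mul_right_inj' hA, ← this, Finset.mul_sum]
      refine Finset.sum_congr rfl fun i _ => ?_
      field_simp
    rw [hsum]
    refine Submodule.sum_mem _ fun i _ => ?_
    by_cases hi : j ≤ i
    · simp [hcon s i hi]
    · refine Submodule.smul_mem _ _ (Submodule.subset_span ⟨⟨i, by omega⟩, ?_⟩)
      rfl
  have hspan : Set.range v ⊆
      Submodule.span ℝ (Set.range fun i : Fin j => A (i.castLE (by omega))) := by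
    rintro _ ⟨s, rfl⟩
    exact hmem s
  have h1 := linearIndependent_le_span' v hv _ hspan
  have h2 : Fintype.card (Set.range fun i : Fin j => A (i.castLE (by omega))) ≤ j := by
    refine (Fintype.card_range_le _).trans (by simp)
  rw [Cardinal.mk_fin, Nat.cast_le] at h1
  omega

/-- Three independent lattice points whose logarithmic sizes almost sum to zero determine all
three successive minima. -/
theorem abs_Lmin_sub_le {ξ₁ ξ₂ q η : ℝ} (hη : 0 ≤ η) {P : Fin 3 → Fin 3 → ℤ}
    (hP : (Matrix.of P).det ≠ 0) {ℓ : Fin 3 → ℝ} (hmono : Monotone ℓ)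
    (hsum : ℓ 0 + ℓ 1 + ℓ 2 = 0)
    (hmem : ∀ i, latticeVec ξ₁ ξ₂ (P i) ∈ Real.exp (ℓ i + η) • Box q) (j : Fin 3) :
    |Lmin ξ₁ ξ₂ (j + 1) q - ℓ j| ≤ 2 * η + Real.log 6 := by
  have hlog6 : 0 ≤ Real.log 6 := Real.log_nonneg (by norm_num)
  set A : Matrix (Fin 3) (Fin 3) ℝ := Matrix.of fun i => latticeVec ξ₁ ξ₂ (P i) with hAdef
  have hA : A.det ≠ 0 := by
    rw [hAdef, det_latticeVec]; exact_mod_cast hP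
  set S := {l : ℝ | 0 < l ∧ ∃ v : Fin (j + 1) → (Fin 3 → ℝ), LinearIndependent ℝ v ∧
    ∀ i, v i ∈ LatticeSet ξ₁ ξ₂ ∧ v i ∈ l • Box q} with hS
  have hin : Real.exp (ℓ j + η) ∈ S := by
    refine ⟨Real.exp_pos _, fun i => A (i.castLE (by omega)), ?_, fun i => ⟨?_, ?_⟩⟩
    · exact (Matrix.linearIndependent_rows_of_det_ne_zero hA).comp _ (Fin.castLE_injective _)
    · exact mem_LatticeSet_iff.2 ⟨_, rfl⟩
    · have h := (mem_smul_Box_iff (Real.exp_pos _) _).1 (hmem (i.castLE (by omega)))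
      have hle : Real.exp (ℓ (i.castLE (by omega)) + η) ≤ Real.exp (ℓ j + η) := by
        refine Real.exp_le_exp.2 (add_le_add_left (hmono ?_) _)
        rw [Fin.le_def]
        simp only [Fin.val_castLE]
        omega
      rw [mem_smul_Box_iff (Real.exp_pos _)]
      refine ⟨h.1.trans ?_, h.2.1.trans ?_, h.2.2.trans ?_⟩ <;> gcongr
  have hlow : ∀ l ∈ S, Real.exp (ℓ j - 2 * η - Real.log 6) ≤ l := by
    rintro l ⟨hl, v, hv, hvm⟩
    obtain ⟨s, i, hji, hdet⟩ := exists_det_updateRow_ne_zero hA j hv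
    obtain ⟨p, hp⟩ := mem_LatticeSet_iff.1 (hvm s).1
    have hupd : A.updateRow i (v s) =
        Matrix.of fun k => latticeVec ξ₁ ξ₂ (Function.update P i p k) := by
      ext k t
      by_cases hk : k = i
      · subst hk; simp [hp]
      · simp [Matrix.updateRow_ne hk, Function.update_of_ne hk, hAdef]
    have hone : 1 ≤ |(A.updateRow i (v s)).det| := by
      rw [hupd, det_latticeVec] at hdet ⊢
      have h0 : (Matrix.of (Function.update P i p)).det ≠ 0 := by exact_mod_cast hdet
      rw [← Int.cast_abs]
      exact_mod_cast Int.one_le_abs h0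
    have hbound := abs_det_le_of_mem_smul_Box (q := q)
      (l := Function.update (fun k => Real.exp (ℓ k + η)) i l)
      (w := Function.update (fun k => latticeVec ξ₁ ξ₂ (P k)) i (v s))
      (fun k => by
        by_cases hk : k = i
        · subst hk; simpa using hl
        · simpa [Function.update_of_ne hk] using Real.exp_pos _)
      (fun k => by
        by_cases hk : k = i
        · subst hk; simpa using (hvm s).2
        · simpa [Function.update_of_ne hk] using hmem k)
    have hprod : Function.update (fun k => Real.exp (ℓ k + η)) i l 0 *
        Function.update (fun k => Real.exp (ℓ k + η)) i l 1 *
        Function.update (fun k => Real.exp (ℓ k + η)) i l 2 = l * Real.exp (2 * η - ℓ i) := by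
      fin_cases i
      · simp only [Fin.zero_eta, Function.update_self]
        simp only [Function.update_apply]
        simp only [Fin.reduceEq, if_false]
        rw [mul_assoc, ← Real.exp_add]; congr 2; linarith
      · simp only [Fin.mk_one, Function.update_self]
        simp only [Function.update_apply]
        simp only [Fin.reduceEq, if_false]
        rw [mul_comm _ l, mul_assoc, ← Real.exp_add]; congr 2; linarith
      · simp only [Fin.reduceFinMk, Function.update_self]
        simp only [Function.update_apply]
        simp only [Fin.reduceEq, if_false]
        rw [mul_comm _ l, ← Real.exp_add]; congr 2; linarith
    rw [hprod] at hbound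
    have h1 : (1 : ℝ) ≤ 6 * (l * Real.exp (2 * η - ℓ i)) := hone.trans hbound
    have h2 : Real.exp (ℓ i - 2 * η - Real.log 6) ≤ l := by
      have e : Real.exp (ℓ i - 2 * η - Real.log 6) * (6 * Real.exp (2 * η - ℓ i)) = 1 := by
        have : (6 : ℝ) = Real.exp (Real.log 6) := (Real.exp_log (by norm_num)).symm
        nth_rewrite 2 [this]
        rw [← Real.exp_add, ← Real.exp_add, Real.exp_eq_one_iff]
        ring
      have hpos : 0 < 6 * Real.exp (2 * η - ℓ i) := by positivity
      refine le_of_mul_le_mul_right ?_ hpos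
      rw [e]; linarith
    refine le_trans (Real.exp_le_exp.2 ?_) h2
    linarith [hmono hji]
  have hbdd : BddBelow S := ⟨0, fun l hl => hl.1.le⟩
  have hup : lambdaMin ξ₁ ξ₂ (j + 1) q ≤ Real.exp (ℓ j + η) := csInf_le hbdd hin
  have hdown : Real.exp (ℓ j - 2 * η - Real.log 6) ≤ lambdaMin ξ₁ ξ₂ (j + 1) q :=
    le_csInf ⟨_, hin⟩ hlow
  have hpos := (Real.exp_pos _).trans_le hdown
  have h1 := Real.log_le_log hpos hup
  have h2 := Real.log_le_log (Real.exp_pos _) hdown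
  rw [Real.log_exp] at h1 h2
  unfold Lmin
  rw [abs_le]
  constructor <;> linarith

/-- Admissible transition of exponents: `a` belongs to the point constructed last, `b` to the point
about to be replaced by one of exponent `a'`, and `c` to the remaining one. -/
def IsStep (a b c a' b' c' : ℝ) : Prop :=
  b ≤ a ∧ b ≤ a' ∧ ((b' = c ∧ c' = a) ∨ (b' = a ∧ c' = c))

theorem IsStep.sum_le {a b c a' b' c' : ℝ} (h : IsStep a b c a' b' c') :
    a + b + c ≤ a' + b' + c' := by
  obtain ⟨_, h2, (⟨h3, h4⟩ | ⟨h3, h4⟩)⟩ := h <;> linarith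

theorem IsStep.add_eq {a b c a' b' c' : ℝ} (h : IsStep a b c a' b' c') :
    b' + c' = a + c := by
  obtain ⟨_, h2, (⟨h3, h4⟩ | ⟨h3, h4⟩)⟩ := h <;> linarith

open Classical in
/-- Replace the point `p 1` by `p 1 + ⌈exp (a - b)⌉ • p 0` and reorder. -/
noncomputable def nextTriple (a b c b' c' : ℝ) (p : Fin 3 → Fin 3 → ℤ) : Fin 3 → Fin 3 → ℤ :=
  if b' = c ∧ c' = a then ![p 1 + ⌈Real.exp (a - b)⌉ • p 0, p 2, p 0]
  else ![p 1 + ⌈Real.exp (a - b)⌉ • p 0, p 0, p 2]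

/-- The `i`-th minor of two integer points. -/
def minor (p p' : Fin 3 → ℤ) (i : Fin 3) : ℝ := p 0 * p' i - p i * p' 0

theorem minor_swap (p p' : Fin 3 → ℤ) (i : Fin 3) : |minor p' p i| = |minor p p' i| := by
  rw [← abs_neg]; unfold minor; congr 1; ring

/-- A basis whose heights and pairwise minors are governed by the exponents `a, b, c`. -/
structure Controlled (C E a b c : ℝ) (p : Fin 3 → Fin 3 → ℤ) : Prop where
  pos1 : 1 ≤ p 1 0
  pos2 : 1 ≤ p 2 0
  le1 : p 1 0 ≤ p 0 0
  le2 : p 2 0 ≤ p 0 0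
  lower : Real.exp (b + c) ≤ C * p 0 0
  upper0 : (p 0 0 : ℝ) ≤ E * Real.exp (b + c)
  upper2 : (p 2 0 : ℝ) ≤ E * Real.exp (a + b)
  minor01 : ∀ i, |minor (p 0) (p 1) i| ≤ E * Real.exp c
  minor02 : ∀ i, |minor (p 0) (p 2) i| ≤ E * Real.exp b
  minor12 : ∀ i, |minor (p 1) (p 2) i| ≤ E * Real.exp a
  det_ne : (Matrix.of p).det ≠ 0

theorem ceil_exp_bounds {x : ℝ} (hx : 0 ≤ x) :
    Real.exp x ≤ (⌈Real.exp x⌉ : ℝ) ∧ (⌈Real.exp x⌉ : ℝ) ≤ 2 * Real.exp x ∧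
      (1 : ℤ) ≤ ⌈Real.exp x⌉ := by
  have h1 : 1 ≤ Real.exp x := Real.one_le_exp hx
  refine ⟨Int.le_ceil _, ?_, ?_⟩
  · have := (Int.ceil_lt_add_one (Real.exp x)).le
    linarith
  · exact Int.one_le_ceil_iff.2 (by linarith)

theorem Controlled.next {C E a b c a' b' c' : ℝ} {p : Fin 3 → Fin 3 → ℤ} (hE : 0 ≤ E)
    (h : Controlled C E a b c p) (hs : IsStep a b c a' b' c') :
    Controlled C (3 * E) a' b' c' (nextTriple a b c b' c' p) ∧
      ∀ i, |minor (p 0) (nextTriple a b c b' c' p 0) i| ≤ E * Real.exp c := by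
  obtain ⟨hba, hba', htype⟩ := hs
  obtain ⟨hβ1, hβ2, hβ3⟩ := ceil_exp_bounds (sub_nonneg.2 hba)
  set β := ⌈Real.exp (a - b)⌉ with hβ
  have hpos0 : (1 : ℤ) ≤ p 0 0 := h.pos1.trans h.le1
  have hpos0' : (1 : ℝ) ≤ p 0 0 := by exact_mod_cast hpos0
  have hle1 : (p 1 0 : ℝ) ≤ p 0 0 := by exact_mod_cast h.le1
  have hpos1 : (1 : ℝ) ≤ p 1 0 := by exact_mod_cast h.pos1
  have hnew : p 0 0 ≤ (p 1 + β • p 0) 0 := by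
    simp only [Pi.add_apply, Pi.smul_apply, smul_eq_mul]
    nlinarith [h.pos1]
  have hone : 1 ≤ Real.exp (a - b) := Real.one_le_exp (by linarith)
  have hcast : ∀ i, (((p 1 + β • p 0) i : ℤ) : ℝ) = p 1 i + β * p 0 i := by
    intro i; simp
  have e1 : Real.exp (a - b) * Real.exp (b + c) = Real.exp (a + c) := by
    rw [← Real.exp_add]; congr 1; ring
  have e2 : Real.exp (a - b) * Real.exp b = Real.exp a := by
    rw [← Real.exp_add]; congr 1; ring
  have hlow : Real.exp (a + c) ≤ C * ((p 1 + β • p 0) 0 : ℤ) := by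
    rw [hcast]
    have hC : 0 < C := by
      have := (Real.exp_pos (b + c)).trans_le h.lower
      by_contra! hC
      nlinarith
    calc Real.exp (a + c) = Real.exp (a - b) * Real.exp (b + c) := e1.symm
      _ ≤ Real.exp (a - b) * (C * p 0 0) := by gcongr; exact h.lower
      _ ≤ β * (C * p 0 0) := by gcongr
      _ ≤ C * (p 1 0 + β * p 0 0) := by nlinarith
  have hup : (((p 1 + β • p 0) 0 : ℤ) : ℝ) ≤ 3 * E * Real.exp (a + c) := by
    rw [hcast]
    calc (p 1 0 : ℝ) + β * p 0 0 ≤ p 0 0 + 2 * Real.exp (a - b) * p 0 0 := by gcongr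
      _ ≤ 3 * (Real.exp (a - b) * p 0 0) := by nlinarith
      _ ≤ 3 * (Real.exp (a - b) * (E * Real.exp (b + c))) := by gcongr; exact h.upper0
      _ = 3 * E * Real.exp (a + c) := by rw [← e1]; ring
  have hm0 : ∀ i, |minor (p 0) (p 1 + β • p 0) i| ≤ E * Real.exp c := by
    intro i
    have : minor (p 0) (p 1 + β • p 0) i = minor (p 0) (p 1) i := by
      unfold minor; rw [hcast, hcast]; ring
    rw [this]; exact h.minor01 i
  have hm2 : ∀ i, |minor (p 1 + β • p 0) (p 2) i| ≤ 3 * E * Real.exp a := by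
    intro i
    have : minor (p 1 + β • p 0) (p 2) i = minor (p 1) (p 2) i + β * minor (p 0) (p 2) i := by
      unfold minor; rw [hcast, hcast]; ring
    rw [this]
    have hβ0 : (0 : ℝ) ≤ β := by linarith
    calc _ ≤ |minor (p 1) (p 2) i| + |β * minor (p 0) (p 2) i| := abs_add_le _ _
      _ = |minor (p 1) (p 2) i| + β * |minor (p 0) (p 2) i| := by
        rw [abs_mul, abs_of_nonneg hβ0]
      _ ≤ E * Real.exp a + (2 * Real.exp (a - b)) * (E * Real.exp b) := by
        gcongr
        · exact h.minor12 i
        · exact h.minor02 i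
      _ = 3 * E * Real.exp a := by rw [← e2]; ring
  have hwiden : ∀ {x y z : ℝ}, x ≤ E * Real.exp y → y ≤ z → x ≤ 3 * E * Real.exp z := by
    intro x y z hx hyz
    have : E * Real.exp y ≤ E * Real.exp z := by gcongr
    have : 0 ≤ E * Real.exp z := by positivity
    linarith
  have hdet : ∀ u : Fin 3 → ℤ, (Matrix.of ![u, p 2, p 0]).det = -(Matrix.of ![u, p 0, p 2]).det := by
    intro u
    simp [Matrix.det_fin_three]; ring
  have hdet' : (Matrix.of ![p 1 + β • p 0, p 2, p 0]).det = (Matrix.of p).det := by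
    simp [Matrix.det_fin_three]; ring
  unfold nextTriple
  rw [← hβ]
  split_ifs with htA
  · obtain ⟨rfl, rfl⟩ := htA
    refine ⟨⟨?_, ?_, ?_, ?_, ?_, ?_, ?_, ?_, ?_, ?_, ?_⟩, hm0⟩
    · exact h.pos2
    · exact hpos0
    · exact h.le2.trans hnew
    · exact hnew
    · show Real.exp (_ + _) ≤ C * (((p 1 + β • p 0) 0 : ℤ) : ℝ)
      rw [add_comm b' c']; exact hlow
    · show (((p 1 + β • p 0) 0 : ℤ) : ℝ) ≤ _
      rw [add_comm b' c']; exact hup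
    · exact hwiden h.upper0 (by linarith)
    · exact hm2
    · intro i
      show |minor (p 1 + β • p 0) (p 0) i| ≤ _
      rw [minor_swap]; exact hwiden (hm0 i) le_rfl
    · intro i
      show |minor (p 2) (p 0) i| ≤ _
      rw [minor_swap]; exact hwiden (h.minor02 i) hba'
    · rw [hdet']; exact h.det_ne
  · obtain ⟨rfl, rfl⟩ := htype.resolve_left htA
    refine ⟨⟨?_, ?_, ?_, ?_, ?_, ?_, ?_, ?_, ?_, ?_, ?_⟩, hm0⟩
    · exact hpos0
    · exact h.pos2
    · exact hnew
    · exact h.le2.trans hnew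
    · exact hlow
    · exact hup
    · exact hwiden h.upper2 (by linarith)
    · intro i
      show |minor (p 1 + β • p 0) (p 0) i| ≤ _
      rw [minor_swap]; exact hwiden (hm0 i) le_rfl
    · exact hm2
    · intro i
      exact hwiden (h.minor02 i) hba'
    · rw [← neg_ne_zero, ← hdet, hdet']; exact h.det_ne

theorem nextTriple_zero (a b c b' c' : ℝ) (p : Fin 3 → Fin 3 → ℤ) :
    nextTriple a b c b' c' p 0 = p 1 + ⌈Real.exp (a - b)⌉ • p 0 := by
  unfold nextTriple; split_ifs <;> rfl

theorem det_nextTriple_zero_ne (a b c b' c' : ℝ) {p : Fin 3 → Fin 3 → ℤ}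
    (hp : (Matrix.of p).det ≠ 0) :
    (Matrix.of ![nextTriple a b c b' c' p 0, p 0, p 2]).det ≠ 0 := by
  have : (Matrix.of ![nextTriple a b c b' c' p 0, p 0, p 2]).det = -(Matrix.of p).det := by
    rw [nextTriple_zero]
    simp [Matrix.det_fin_three]; ring
  rw [this]; exact neg_ne_zero.2 hp

/-- The sequence of bases generated by a sequence of exponents. -/
noncomputable def triples (a b c : ℕ → ℝ) : ℕ → Fin 3 → Fin 3 → ℤ
  | 0 => ![![1, 0, 0], ![1, 1, 0], ![1, 0, 1]]
  | n + 1 => nextTriple (a n) (b n) (c n) (b (n + 1)) (c (n + 1)) (triples a b c n)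

section Realization

variable {a b c : ℕ → ℝ} (h0 : 0 ≤ a 0 ∧ 0 ≤ b 0 ∧ 0 ≤ c 0)
  (hstep : ∀ n, IsStep (a n) (b n) (c n) (a (n + 1)) (b (n + 1)) (c (n + 1)))

include h0 hstep in
theorem controlled_triples (n : ℕ) :
    Controlled (Real.exp (b 0 + c 0)) (3 ^ n) (a n) (b n) (c n) (triples a b c n) := by
  induction n with
  | zero =>
    have hge : ∀ {x : ℝ}, 0 ≤ x → (1 : ℝ) ≤ 3 ^ 0 * Real.exp x := fun hx => by
      simpa using hx
    obtain ⟨ha, hb, hc⟩ := h0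
    refine ⟨?_, ?_, ?_, ?_, ?_, ?_, ?_, ?_, ?_, ?_, ?_⟩
    · simp [triples]
    · simp [triples]
    · simp [triples]
    · simp [triples]
    · simp [triples]
    · simpa [triples] using add_nonneg hb hc
    · simpa [triples] using add_nonneg ha hb
    · intro i
      refine le_trans ?_ (hge hc)
      fin_cases i <;> simp [triples, minor]
    · intro i
      refine le_trans ?_ (hge hb)
      fin_cases i <;> simp [triples, minor]
    · intro i
      refine le_trans ?_ (hge ha)
      fin_cases i <;> simp [triples, minor]
    · simp [triples, Matrix.det_fin_three]
  | succ n ih =>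
    rw [pow_succ, mul_comm]
    exact (ih.next (by positivity) (hstep n)).1

include hstep in
theorem monotone_sum : Monotone fun n => a n + b n + c n :=
  monotone_nat_of_le_succ fun n => (hstep n).sum_le

include h0 hstep in
theorem dist_direction_succ_le (i : Fin 3) (n : ℕ) :
    dist ((triples a b c n 0 i : ℝ) / triples a b c n 0 0)
      ((triples a b c (n + 1) 0 i : ℝ) / triples a b c (n + 1) 0 0) ≤
      Real.exp (b 0 + c 0) ^ 2 * (3 ^ n * Real.exp (-(a n + b n + c n))) := by
  have hn := controlled_triples h0 hstep n
  have hn' := controlled_triples h0 hstep (n + 1)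
  have hm := (hn.next (by positivity) (hstep n)).2 i
  change |minor (triples a b c n 0) (triples a b c (n + 1) 0) i| ≤ _ at hm
  set C := Real.exp (b 0 + c 0)
  have hp : (1 : ℝ) ≤ triples a b c n 0 0 := by exact_mod_cast hn.pos1.trans hn.le1
  have hp' : (1 : ℝ) ≤ triples a b c (n + 1) 0 0 := by exact_mod_cast hn'.pos1.trans hn'.le1
  set h : ℝ := ((triples a b c n 0 0 : ℤ) : ℝ)
  set h' : ℝ := ((triples a b c (n + 1) 0 0 : ℤ) : ℝ)
  have hh : 0 < h := by linarith
  have hh' : 0 < h' := by linarith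
  have hl := hn.lower
  have hl' := hn'.lower
  rw [(hstep n).add_eq] at hl'
  have e : (triples a b c n 0 i : ℝ) / h - (triples a b c (n + 1) 0 i : ℝ) / h' =
      -minor (triples a b c n 0) (triples a b c (n + 1) 0) i / (h * h') := by
    unfold minor
    field_simp
    ring
  rw [Real.dist_eq, e, abs_div, abs_neg, abs_of_pos (mul_pos hh hh'), div_le_iff₀ (mul_pos hh hh')]
  refine hm.trans ?_
  have key : Real.exp (b n + c n) * Real.exp (a n + c n) ≤ (C * h) * (C * h') :=
    mul_le_mul hl hl' (Real.exp_pos _).le (by positivity)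
  have e2 : Real.exp (c n) =
      Real.exp (-(a n + b n + c n)) * (Real.exp (b n + c n) * Real.exp (a n + c n)) := by
    rw [← Real.exp_add, ← Real.exp_add]; congr 1; ring
  rw [e2]
  calc 3 ^ n * (Real.exp (-(a n + b n + c n)) * (Real.exp (b n + c n) * Real.exp (a n + c n)))
      ≤ 3 ^ n * (Real.exp (-(a n + b n + c n)) * ((C * h) * (C * h'))) := by gcongr
    _ = _ := by ring

theorem six_pow_le_exp (k : ℕ) : (6 : ℝ) ^ k ≤ Real.exp (2 * k) := by
  have h : (6 : ℝ) ≤ Real.exp 2 := by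
    have := Real.exp_one_gt_d9
    have e : Real.exp 2 = Real.exp 1 * Real.exp 1 := by rw [← Real.exp_add]; norm_num
    rw [e]; nlinarith
  calc (6 : ℝ) ^ k ≤ Real.exp 2 ^ k := by gcongr
    _ = Real.exp (2 * k) := by rw [← Real.exp_nat_mul]; ring_nf

variable (hgrow : ∀ ε > 0, ∃ C, ∀ n : ℕ, (n : ℝ) ≤ ε * (a n + b n + c n) + C)

include hgrow in
theorem three_pow_le {ε : ℝ} (hε : 0 < ε) :
    ∃ C, ∀ n : ℕ, (3 : ℝ) ^ n ≤ Real.exp (2 * ε * (a n + b n + c n) + C) / 2 ^ n := by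
  obtain ⟨C, hC⟩ := hgrow ε hε
  refine ⟨2 * C, fun n => ?_⟩
  rw [le_div_iff₀ (by positivity), ← mul_pow]
  norm_num
  refine (six_pow_le_exp n).trans (Real.exp_le_exp.2 ?_)
  linarith [hC n]

include h0 hstep hgrow in
theorem exists_limit_direction (i : Fin 3) :
    ∃ ξ : ℝ, ∀ ε > 0, ε ≤ 1 / 2 → ∃ C, ∀ n,
      |ξ * triples a b c n 0 0 - triples a b c n 0 i| ≤
        Real.exp (-a n + 4 * ε * (a n + b n + c n) + C) := by
  set θ : ℕ → ℝ := fun n => (triples a b c n 0 i : ℝ) / triples a b c n 0 0 with hθ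
  set D := Real.exp (b 0 + c 0) ^ 2 with hD
  have hmono := monotone_sum hstep
  have key : ∀ ε > 0, ε ≤ 1 / 2 → ∃ C, ∀ n m, dist (θ (n + m)) (θ (n + m + 1)) ≤
      D * Real.exp (-(1 - 2 * ε) * (a n + b n + c n) + C) / 2 ^ m := by
    intro ε hε hε2
    obtain ⟨C, hC⟩ := three_pow_le hgrow hε
    refine ⟨C, fun n m => (dist_direction_succ_le h0 hstep i (n + m)).trans ?_⟩
    rw [mul_div_assoc]
    refine mul_le_mul_of_nonneg_left ?_ (by positivity)
    have h1 : a n + b n + c n ≤ a (n + m) + b (n + m) + c (n + m) := hmono (Nat.le_add_right n m)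
    set S := a (n + m) + b (n + m) + c (n + m)
    calc (3 : ℝ) ^ (n + m) * Real.exp (-S)
        ≤ Real.exp (2 * ε * S + C) / 2 ^ (n + m) * Real.exp (-S) := by
          gcongr; exact hC (n + m)
      _ = Real.exp (-(1 - 2 * ε) * S + C) / 2 ^ (n + m) := by
          rw [div_mul_eq_mul_div, ← Real.exp_add]; congr 2; ring
      _ ≤ Real.exp (-(1 - 2 * ε) * (a n + b n + c n) + C) / 2 ^ m := by
          gcongr ?_ / ?_
          · exact Real.exp_le_exp.2 (by nlinarith)
          · exact pow_le_pow_right₀ (by norm_num) (Nat.le_add_left m n)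
  obtain ⟨ξ, hξ⟩ : ∃ ξ, Tendsto θ atTop (nhds ξ) := by
    obtain ⟨C, hC⟩ := key (1 / 2) (by norm_num) le_rfl
    refine cauchySeq_tendsto_of_complete (cauchySeq_of_le_geometric_two
      (C := 2 * (D * Real.exp (-(1 - 2 * (1 / 2)) * (a 0 + b 0 + c 0) + C))) fun m => ?_)
    have := hC 0 m
    rw [zero_add] at this
    refine this.trans (le_of_eq ?_)
    ring
  refine ⟨ξ, fun ε hε hε2 => ?_⟩
  obtain ⟨C, hC⟩ := key ε hε hε2
  obtain ⟨C', hC'⟩ := three_pow_le hgrow hε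
  refine ⟨Real.log (2 * D) + C + C', fun n => ?_⟩
  have hn := controlled_triples h0 hstep n
  have hp : (1 : ℝ) ≤ triples a b c n 0 0 := by exact_mod_cast hn.pos1.trans hn.le1
  have hlim : Tendsto (fun m => θ (n + m)) atTop (nhds ξ) := by
    have := (tendsto_add_atTop_iff_nat n).2 hξ
    simpa [add_comm] using this
  have hd : dist (θ n) ξ ≤ 2 * (D * Real.exp (-(1 - 2 * ε) * (a n + b n + c n) + C)) := by
    have := dist_le_of_le_geometric_two_of_tendsto₀ (f := fun m => θ (n + m))
      (C := 2 * (D * Real.exp (-(1 - 2 * ε) * (a n + b n + c n) + C))) (fun m => by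
        refine (hC n m).trans (le_of_eq ?_)
        ring) hlim
    simpa using this
  have hheight : (triples a b c n 0 0 : ℝ) ≤
      Real.exp (2 * ε * (a n + b n + c n) + C') * Real.exp (b n + c n) := by
    refine hn.upper0.trans ?_
    gcongr
    refine (hC' n).trans (div_le_self (Real.exp_pos _).le (one_le_pow₀ (by norm_num)))
  have e : ξ * triples a b c n 0 0 - triples a b c n 0 i =
      -((θ n - ξ) * triples a b c n 0 0) := by
    simp only [hθ]; field_simp; ring
  rw [e, abs_neg, abs_mul, ← Real.dist_eq, abs_of_pos (by linarith : (0 : ℝ) < triples a b c n 0 0)]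
  have hDpos : 0 < 2 * D := by positivity
  calc _ ≤ 2 * (D * Real.exp (-(1 - 2 * ε) * (a n + b n + c n) + C)) *
        (Real.exp (2 * ε * (a n + b n + c n) + C') * Real.exp (b n + c n)) := by gcongr
    _ = Real.exp (Real.log (2 * D)) * Real.exp (-(1 - 2 * ε) * (a n + b n + c n) + C) *
        (Real.exp (2 * ε * (a n + b n + c n) + C') * Real.exp (b n + c n)) := by
        rw [Real.exp_log hDpos]; ring
    _ = _ := by
        rw [← Real.exp_add, ← Real.exp_add, ← Real.exp_add]; congr 1; ring

end Realization

section Realization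

variable {a b c : ℕ → ℝ} (h0 : 0 ≤ a 0 ∧ 0 ≤ b 0 ∧ 0 ≤ c 0)
  (hstep : ∀ n, IsStep (a n) (b n) (c n) (a (n + 1)) (b (n + 1)) (c (n + 1)))
  (hgrow : ∀ ε > 0, ∃ C, ∀ n : ℕ, (n : ℝ) ≤ ε * (a n + b n + c n) + C)

include h0 hstep in
theorem sum_nonneg_of_isStep (n : ℕ) : 0 ≤ a n + b n + c n :=
  (add_nonneg (add_nonneg h0.1 h0.2.1) h0.2.2).trans (monotone_sum hstep (Nat.zero_le n))

include h0 hstep hgrow in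
theorem exists_direction_of_all (i : Fin 3) :
    ∃ ξ : ℝ, ∀ ε > 0, ε ≤ 1 / 2 → ∃ C, ∀ n j,
      |ξ * triples a b c n j 0 - triples a b c n j i| ≤
        Real.exp (-(![a n, b n, c n] j) + 4 * ε * (a n + b n + c n) + C) := by
  obtain ⟨ξ, hξ⟩ := exists_limit_direction h0 hstep hgrow i
  refine ⟨ξ, fun ε hε hε2 => ?_⟩
  obtain ⟨C, hC⟩ := hξ ε hε hε2
  have hS0 := sum_nonneg_of_isStep h0 hstep 0
  set C' := max C (Real.log (1 + |ξ|) + b 0 + c 0) with hC'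
  have hCC' : C ≤ C' := le_max_left _ _
  have hzero : ∀ n, |ξ * triples a b c n 0 0 - triples a b c n 0 i| ≤
      Real.exp (-a n + 4 * ε * (a n + b n + c n) + C') := fun n =>
    (hC n).trans (Real.exp_le_exp.2 (by linarith))
  have hrest : ∀ n, |ξ * triples a b c n 1 0 - triples a b c n 1 i| ≤
      Real.exp (-b n + 4 * ε * (a n + b n + c n) + C') ∧
      |ξ * triples a b c n 2 0 - triples a b c n 2 i| ≤
      Real.exp (-c n + 4 * ε * (a n + b n + c n) + C') := by
    intro n
    induction n with
    | zero =>
      obtain ⟨ha, hb, hc⟩ := h0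
      have hpos : 0 < 1 + |ξ| := by positivity
      have hC2 : Real.log (1 + |ξ|) + b 0 + c 0 ≤ C' := le_max_right _ _
      have h4 : 0 ≤ 4 * ε * (a 0 + b 0 + c 0) := by positivity
      have hone : ∀ x : ℝ, |x| ≤ 1 → |ξ - x| ≤ 1 + |ξ| := fun x hx => by
        have := abs_sub ξ x
        linarith
      have hexp : ∀ x, Real.log (1 + |ξ|) ≤ x → 1 + |ξ| ≤ Real.exp x := fun x hx => by
        rwa [← Real.log_le_iff_le_exp hpos]
      constructor
      · refine le_trans ?_ (hexp _ (by linarith))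
        fin_cases i <;> simp only [triples] <;> simpa using hone _ (by norm_num)
      · refine le_trans ?_ (hexp _ (by linarith))
        fin_cases i <;> simp only [triples] <;> simpa using hone _ (by norm_num)
    | succ n ih =>
      have hle : 4 * ε * (a n + b n + c n) ≤ 4 * ε * (a (n + 1) + b (n + 1) + c (n + 1)) := by
        have := (hstep n).sum_le
        gcongr
      have hw : ∀ {x y z : ℝ}, x ≤ Real.exp (-y + 4 * ε * (a n + b n + c n) + C') → z = y →
          x ≤ Real.exp (-z + 4 * ε * (a (n + 1) + b (n + 1) + c (n + 1)) + C') := by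
        rintro x y z hx rfl
        exact hx.trans (Real.exp_le_exp.2 (by linarith))
      simp only [triples, nextTriple]
      split_ifs with h
      · exact ⟨hw ih.2 h.1, hw (hzero n) h.2⟩
      · have h' := (hstep n).2.2.resolve_left h
        exact ⟨hw (hzero n) h'.1, hw ih.2 h'.2⟩
  refine ⟨C', fun n j => ?_⟩
  fin_cases j
  · exact hzero n
  · exact (hrest n).1
  · exact (hrest n).2

include hgrow in
theorem tendsto_sum_atTop : Tendsto (fun n => a n + b n + c n) atTop atTop := by
  obtain ⟨C, hC⟩ := hgrow 1 one_pos
  refine tendsto_atTop_mono (f := fun n : ℕ => (n : ℝ) - C) (fun n => ?_)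
    (tendsto_atTop_add_const_right _ (-C) tendsto_natCast_atTop_atTop)
  linarith [hC n]

theorem linearIndependent_of_forall_int {ξ₁ ξ₂ : ℝ}
    (h : ∀ g : Fin 3 → ℤ, (g 0 : ℝ) + g 1 * ξ₁ + g 2 * ξ₂ = 0 → g = 0) :
    LinearIndependent ℚ ![(1 : ℝ), ξ₁, ξ₂] := by
  rw [← LinearIndependent.iff_fractionRing ℤ ℚ, Fintype.linearIndependent_iff]
  intro g hg i
  rw [h g ?_]
  · rfl
  · simpa [Fin.sum_univ_three] using hg

/-- A sequence of admissible exponents is realized by the successive minima of some lattice. -/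
theorem exists_realization (h0 : 0 ≤ a 0 ∧ 0 ≤ b 0 ∧ 0 ≤ c 0)
    (hstep : ∀ n, IsStep (a n) (b n) (c n) (a (n + 1)) (b (n + 1)) (c (n + 1)))
    (hgrow : ∀ ε > 0, ∃ C, ∀ n : ℕ, (n : ℝ) ≤ ε * (a n + b n + c n) + C)
    (hbal : ∃ κ > 0, ∃ᶠ n in atTop, ∀ j : Fin 3, κ * (a n + b n + c n) ≤ ![a n, b n, c n] j) :
    ∃ ξ₁ ξ₂ : ℝ, LinearIndependent ℚ ![(1 : ℝ), ξ₁, ξ₂] ∧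
      ∀ ε > 0, ∃ C ≥ 0, ∀ n q, a n + b n + c n ≤ 3 * q →
        3 * q ≤ a (n + 1) + b (n + 1) + c (n + 1) → ∀ i,
        latticeVec ξ₁ ξ₂
          (![triples a b c (n + 1) 0, triples a b c n 0, triples a b c n 2] i) ∈
          Real.exp (![a n + c n - 2 * q, q - a n, q - c n] i + (ε * q + C)) • Box q := by
  obtain ⟨ξ₁, h₁⟩ := exists_direction_of_all h0 hstep hgrow 1
  obtain ⟨ξ₂, h₂⟩ := exists_direction_of_all h0 hstep hgrow 2
  have hS := sum_nonneg_of_isStep h0 hstep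
  refine ⟨ξ₁, ξ₂, linearIndependent_of_forall_int fun g hg => ?_, fun ε hε => ?_⟩
  · obtain ⟨κ, hκ, hfreq⟩ := hbal
    set ε := min (κ / 8) (1 / 2)
    have hε : 0 < ε := lt_min (by positivity) (by norm_num)
    have hεκ : ε ≤ κ / 8 := min_le_left _ _
    obtain ⟨C₁, hC₁⟩ := h₁ ε hε (min_le_right _ _)
    obtain ⟨C₂, hC₂⟩ := h₂ ε hε (min_le_right _ _)
    have hlim : Tendsto (fun n => |(g 1 : ℝ)| * Real.exp (-(κ / 2 * (a n + b n + c n)) + C₁) +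
        |(g 2 : ℝ)| * Real.exp (-(κ / 2 * (a n + b n + c n)) + C₂)) atTop (nhds 0) := by
      have hE : ∀ C, Tendsto (fun n => Real.exp (-(κ / 2 * (a n + b n + c n)) + C)) atTop
          (nhds 0) := fun C => Real.tendsto_exp_atBot.comp <|
        tendsto_atBot_add_const_right _ _ <| tendsto_neg_atTop_atBot.comp <|
          (tendsto_sum_atTop hgrow).const_mul_atTop (by positivity)
      simpa using ((hE C₁).const_mul |(g 1 : ℝ)|).add ((hE C₂).const_mul |(g 2 : ℝ)|)
    obtain ⟨n, hn, hlt⟩ := (hfreq.and_eventually (hlim.eventually_lt_const one_pos)).exists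
    refine Matrix.eq_zero_of_mulVec_eq_zero (controlled_triples h0 hstep n).det_ne ?_
    ext j
    set p := triples a b c n j with hp
    have hval : ((Matrix.of (triples a b c n)).mulVec g j : ℝ) =
        -(g 1 * (ξ₁ * p 0 - p 1) + g 2 * (ξ₂ * p 0 - p 2)) := by
      have : (g 0 : ℝ) = -(g 1 * ξ₁ + g 2 * ξ₂) := by linarith
      simp only [Matrix.mulVec, dotProduct, Fin.sum_univ_three, Matrix.of_apply, ← hp]
      push_cast
      rw [this]; ring
    have hb : ∀ C, Real.exp (-(![a n, b n, c n] j) + 4 * ε * (a n + b n + c n) + C) ≤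
        Real.exp (-(κ / 2 * (a n + b n + c n)) + C) := fun C => by
      refine Real.exp_le_exp.2 ?_
      have := hn j
      have h3 := mul_le_mul_of_nonneg_right hεκ (hS n)
      linarith
    have hlt1 : |((Matrix.of (triples a b c n)).mulVec g j : ℝ)| < 1 := by
      rw [hval, abs_neg]
      refine ((abs_add_le _ _).trans ?_).trans_lt hlt
      rw [abs_mul, abs_mul]
      gcongr
      · exact (hC₁ n j).trans (hb C₁)
      · exact (hC₂ n j).trans (hb C₂)
    have : |(Matrix.of (triples a b c n)).mulVec g j| < 1 := by exact_mod_cast hlt1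
    simpa using Int.abs_lt_one_iff.1 this
  · set δ := min (ε / 12) (1 / 4)
    have hδ : 0 < δ := lt_min (by positivity) (by norm_num)
    have hδε : δ ≤ ε / 12 := min_le_left _ _
    have hδ4 : δ ≤ 1 / 4 := min_le_right _ _
    obtain ⟨C₁, hC₁⟩ := h₁ δ hδ (by linarith)
    obtain ⟨C₂, hC₂⟩ := h₂ δ hδ (by linarith)
    obtain ⟨C₃, hC₃⟩ := three_pow_le hgrow hδ
    set C := |C₁| + |C₂| + |C₃| + Real.log 3
    have hlog3 : 0 ≤ Real.log 3 := Real.log_nonneg (by norm_num)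
    have hCC₁ : C₁ ≤ C := by
      linarith [le_abs_self C₁, abs_nonneg C₂, abs_nonneg C₃]
    have hCC₂ : C₂ ≤ C := by
      linarith [le_abs_self C₂, abs_nonneg C₁, abs_nonneg C₃]
    have hCC₃ : C₃ + Real.log 3 ≤ C := by
      linarith [le_abs_self C₃, abs_nonneg C₁, abs_nonneg C₂]
    refine ⟨C, by positivity, fun n q hq hq' => ?_⟩
    have hq0 : 0 ≤ q := by linarith [hS n]
    have hεq : 0 ≤ ε * q := by positivity
    have hSq : δ * (a n + b n + c n) ≤ ε / 12 * (3 * q) :=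
      mul_le_mul hδε hq (hS n) (by positivity)
    have hn := controlled_triples h0 hstep n
    have hn' := controlled_triples h0 hstep (n + 1)
    have hadd := (hstep n).add_eq
    have h3n : (3 : ℝ) ^ n ≤ Real.exp (ε * q + C₃) := by
      refine ((hC₃ n).trans (div_le_self (Real.exp_pos _).le
        (one_le_pow₀ (by norm_num)))).trans (Real.exp_le_exp.2 (by linarith))
    have hpos : ∀ {x : ℤ}, 1 ≤ x → |(x : ℝ)| = x := fun hx =>
      abs_of_nonneg (by exact_mod_cast zero_le_one.trans hx)
    have hmem : ∀ (p : Fin 3 → ℤ) (ℓ : ℝ), 1 ≤ p 0 →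
        (p 0 : ℝ) ≤ Real.exp (ℓ + (ε * q + C) + 2 * q) →
        |ξ₁ * p 0 - p 1| ≤ Real.exp (ℓ + (ε * q + C) + -q) →
        |ξ₂ * p 0 - p 2| ≤ Real.exp (ℓ + (ε * q + C) + -q) →
        latticeVec ξ₁ ξ₂ p ∈ Real.exp (ℓ + (ε * q + C)) • Box q := by
      intro p ℓ h1 h2 h3 h4
      rw [mem_smul_Box_iff (Real.exp_pos _), ← Real.exp_add, ← Real.exp_add]
      refine ⟨?_, h3, h4⟩
      simpa [latticeVec, hpos h1] using h2
    have hheight : ∀ {x y : ℝ}, x ≤ 3 ^ n * Real.exp y →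
        x ≤ Real.exp (y + (ε * q + C)) := by
      intro x y hx
      refine hx.trans ?_
      calc (3 : ℝ) ^ n * Real.exp y ≤ Real.exp (ε * q + C₃) * Real.exp y := by gcongr
        _ ≤ _ := by rw [← Real.exp_add]; exact Real.exp_le_exp.2 (by linarith)
    have hnew : -a (n + 1) + 4 * δ * (a (n + 1) + b (n + 1) + c (n + 1)) ≤
        a n + c n - 3 * q + ε * q := by
      have h1 := mul_le_mul_of_nonneg_left hq' (by linarith : 0 ≤ 1 - 4 * δ)
      have h2 := mul_le_mul_of_nonneg_right hδε hq0
      linarith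
    intro i
    fin_cases i
    · refine hmem _ _ (hn'.pos1.trans hn'.le1) ?_ ?_ ?_
      · have h := hn'.upper0
        rw [pow_succ, hadd] at h
        refine h.trans ?_
        calc (3 : ℝ) ^ n * 3 * Real.exp (a n + c n)
            ≤ Real.exp (ε * q + C₃) * Real.exp (Real.log 3) * Real.exp (a n + c n) := by
              rw [Real.exp_log (by norm_num)]; gcongr
          _ ≤ _ := by
              rw [← Real.exp_add, ← Real.exp_add]
              exact Real.exp_le_exp.2 (by simp only [Matrix.cons_val_zero, Fin.zero_eta]; linarith)
      · refine (hC₁ (n + 1) 0).trans (Real.exp_le_exp.2 ?_)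
        simp only [Matrix.cons_val_zero, Fin.zero_eta]; linarith
      · refine (hC₂ (n + 1) 0).trans (Real.exp_le_exp.2 ?_)
        simp only [Matrix.cons_val_zero, Fin.zero_eta]; linarith
    · refine hmem _ _ (hn.pos1.trans hn.le1) ?_ ?_ ?_
      · refine (hheight hn.upper0).trans (Real.exp_le_exp.2 ?_)
        simp only [Matrix.cons_val_one, Matrix.cons_val_zero, Fin.mk_one]; linarith
      · refine (hC₁ n 0).trans (Real.exp_le_exp.2 ?_)
        simp only [Matrix.cons_val_one, Matrix.cons_val_zero, Fin.mk_one]; linarith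
      · refine (hC₂ n 0).trans (Real.exp_le_exp.2 ?_)
        simp only [Matrix.cons_val_one, Matrix.cons_val_zero, Fin.mk_one]; linarith
    · refine hmem _ _ hn.pos2 ?_ ?_ ?_
      · refine (hheight hn.upper2).trans (Real.exp_le_exp.2 ?_)
        simp only [Matrix.cons_val, Fin.reduceFinMk]; linarith
      · refine (hC₁ n 2).trans (Real.exp_le_exp.2 ?_)
        simp only [Matrix.cons_val, Fin.reduceFinMk]; linarith
      · refine (hC₂ n 2).trans (Real.exp_le_exp.2 ?_)
        simp only [Matrix.cons_val, Fin.reduceFinMk]; linarith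

end Realization

theorem abs_Lmin_sub_le_of_sum_eq_zero {ξ₁ ξ₂ q η : ℝ} (hη : 0 ≤ η) {P : Fin 3 → Fin 3 → ℤ}
    (hP : (Matrix.of P).det ≠ 0) {x : Fin 3 → ℝ} (hsum : x 0 + x 1 + x 2 = 0)
    (hmem : ∀ i, latticeVec ξ₁ ξ₂ (P i) ∈ Real.exp (x i + η) • Box q) :
    |Lmin ξ₁ ξ₂ 1 q - min (x 0) (min (x 1) (x 2))| ≤ 2 * η + Real.log 6 ∧
    |Lmin ξ₁ ξ₂ 2 q - (-min (x 0) (min (x 1) (x 2)) - max (x 0) (max (x 1) (x 2)))| ≤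
      2 * η + Real.log 6 ∧
    |Lmin ξ₁ ξ₂ 3 q - max (x 0) (max (x 1) (x 2))| ≤ 2 * η + Real.log 6 := by
  set σ := Tuple.sort x
  have hmono : Monotone (x ∘ σ) := Tuple.monotone_sort x
  have hdet : (Matrix.of (P ∘ σ)).det ≠ 0 := by
    have h := Matrix.det_permute σ (Matrix.of P)
    have e : Matrix.of (P ∘ σ) = (Matrix.of P).submatrix σ id := rfl
    rw [e, h]
    exact mul_ne_zero (by simp) hP
  have hsum' : (x ∘ σ) 0 + (x ∘ σ) 1 + (x ∘ σ) 2 = 0 := by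
    rw [← Fin.sum_univ_three (x ∘ σ)]
    simp only [Function.comp_apply]
    rw [Equiv.sum_comp σ x, Fin.sum_univ_three, hsum]
  have key := abs_Lmin_sub_le hη hdet hmono hsum' fun i => hmem (σ i)
  have hval : ∀ i, x i = (x ∘ σ) (σ.symm i) := fun i => by simp
  have hmin : (x ∘ σ) 0 = min (x 0) (min (x 1) (x 2)) := by
    have h1 : ∀ i, (x ∘ σ) 0 ≤ x i := fun i => by
      rw [hval i]; exact hmono (Fin.zero_le _)
    have h2 : ∀ i, min (x 0) (min (x 1) (x 2)) ≤ x i := fun i => by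
      fin_cases i <;> simp
    exact le_antisymm (le_min (h1 0) (le_min (h1 1) (h1 2))) (h2 _)
  have hmax : (x ∘ σ) 2 = max (x 0) (max (x 1) (x 2)) := by
    have h1 : ∀ i, x i ≤ (x ∘ σ) 2 := fun i => by
      rw [hval i]; exact hmono (Fin.le_last _)
    have h2 : ∀ i, x i ≤ max (x 0) (max (x 1) (x 2)) := fun i => by
      fin_cases i <;> simp
    exact le_antisymm (h2 _) (max_le (h1 0) (max_le (h1 1) (h1 2)))
  have hmid : (x ∘ σ) 1 = -min (x 0) (min (x 1) (x 2)) - max (x 0) (max (x 1) (x 2)) := by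
    rw [← hmin, ← hmax]; linarith
  rw [← hmid, ← hmin, ← hmax]
  exact ⟨key 0, key 1, key 2⟩

/-- The successive minima follow the piecewise linear functions attached to the exponents. -/
theorem exists_Lmin_approx {a b c : ℕ → ℝ} (h0 : 0 ≤ a 0 ∧ 0 ≤ b 0 ∧ 0 ≤ c 0)
    (hstep : ∀ n, IsStep (a n) (b n) (c n) (a (n + 1)) (b (n + 1)) (c (n + 1)))
    (hgrow : ∀ ε > 0, ∃ C, ∀ n : ℕ, (n : ℝ) ≤ ε * (a n + b n + c n) + C)
    (hbal : ∃ κ > 0, ∃ᶠ n in atTop, ∀ j : Fin 3, κ * (a n + b n + c n) ≤ ![a n, b n, c n] j) :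
    ∃ ξ₁ ξ₂ : ℝ, LinearIndependent ℚ ![(1 : ℝ), ξ₁, ξ₂] ∧
      ∀ ε > 0, ∃ C, ∀ n q, a n + b n + c n ≤ 3 * q →
        3 * q ≤ a (n + 1) + b (n + 1) + c (n + 1) →
        |Lmin ξ₁ ξ₂ 1 q - min (a n + c n - 2 * q) (q - max (a n) (c n))| ≤ ε * q + C ∧
        |Lmin ξ₁ ξ₂ 2 q - (-min (a n + c n - 2 * q) (q - max (a n) (c n)) -
          max (a n + c n - 2 * q) (q - min (a n) (c n)))| ≤ ε * q + C ∧
        |Lmin ξ₁ ξ₂ 3 q - max (a n + c n - 2 * q) (q - min (a n) (c n))| ≤ ε * q + C := by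
  obtain ⟨ξ₁, ξ₂, hli, h⟩ := exists_realization h0 hstep hgrow hbal
  refine ⟨ξ₁, ξ₂, hli, fun ε hε => ?_⟩
  obtain ⟨C, hC0, hC⟩ := h (ε / 2) (by positivity)
  refine ⟨2 * C + Real.log 6, fun n q hq hq' => ?_⟩
  have hq0 : 0 ≤ q := by linarith [sum_nonneg_of_isStep h0 hstep n]
  have key := abs_Lmin_sub_le_of_sum_eq_zero (η := ε / 2 * q + C) (by positivity)
    (det_nextTriple_zero_ne (a n) (b n) (c n) (b (n + 1)) (c (n + 1))
      (controlled_triples h0 hstep n).det_ne)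
    (x := ![a n + c n - 2 * q, q - a n, q - c n])
    (by simp only [Matrix.cons_val]; ring) (hC n q hq hq')
  simp only [Matrix.cons_val, min_sub_sub_left, max_sub_sub_left] at key
  rwa [show ε * q + (2 * C + Real.log 6) = 2 * (ε / 2 * q + C) + Real.log 6 by ring]

/-- Inequalities between the exponents around one transition: `M` and `m` are the larger and the
smaller exponent that are kept, `b` is the exponent that is replaced by `d`. -/
structure StepBound (r U V t M m b d : ℝ) : Prop where
  pos_m : 0 < m
  le : m ≤ M
  pos_b : 0 < b
  ratio : r * m ≤ M
  low1 : (1 + r) * M ≤ t * (r * V) * (m + b)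
  low1' : (1 + r) * d ≤ t * (r * V) * (M + m)
  up3 : M + m ≤ t * (U * (1 + r)) * b
  up3' : M + d ≤ t * (U * (1 + r)) * m
  low2 : m ≤ t * U * b
  low2' : M ≤ U * m ∨ (1 + U) * d ≤ t * U * (M + m)
  up2 : d ≤ t * V * M
  up2' : M ≤ V * m ∨ M + m ≤ t * (V + 1) * b

theorem StepBound.smul {r U V t M m b d s : ℝ} (hs : 0 < s) (h : StepBound r U V t M m b d) :
    StepBound r U V t (s * M) (s * m) (s * b) (s * d) := by
  have key : ∀ {x y : ℝ}, x ≤ y → s * x ≤ s * y := fun h => mul_le_mul_of_nonneg_left h hs.le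
  refine ⟨mul_pos hs h.pos_m, key h.le, mul_pos hs h.pos_b, ?_, ?_, ?_, ?_, ?_, ?_, ?_, ?_, ?_⟩
  · linarith [key h.ratio]
  · linarith [key h.low1]
  · linarith [key h.low1']
  · linarith [key h.up3]
  · linarith [key h.up3']
  · linarith [key h.low2]
  · exact h.low2'.imp (fun h => by linarith [key h]) (fun h => by linarith [key h])
  · linarith [key h.up2]
  · exact h.up2'.imp (fun h => by linarith [key h]) (fun h => by linarith [key h])

theorem three_div_mul_le {x q κ : ℝ} (hκ : 0 < κ) (h : 3 * q ≤ κ * x) : 3 / κ * q ≤ x := by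
  rw [div_mul_eq_mul_div, div_le_iff₀ hκ]; linarith

theorem le_three_sub_mul {x q S κ : ℝ} (hκ : 1 ≤ κ) (hS : S ≤ 3 * q) (h : S ≤ κ * (S - x)) :
    x ≤ (3 - 3 / κ) * q := by
  have h1 : 1 / κ ≤ 1 := (div_le_one (by linarith)).2 hκ
  have h2 : 1 / κ * S ≤ S - x := by
    rw [div_mul_eq_mul_div, div_le_iff₀ (by linarith)]; linarith
  have h3 : (1 - 1 / κ) * S ≤ (1 - 1 / κ) * (3 * q) :=
    mul_le_mul_of_nonneg_left hS (by linarith)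
  have h4 : 3 / κ = 3 * (1 / κ) := by ring
  rw [h4]; linarith

section

variable {r U V t M m b d q : ℝ}

theorem StepBound.bounds_one (h : StepBound r U V t M m b d) (hr : 1 ≤ r) (hV : 1 ≤ V)
    (ht : 1 ≤ t) (hq : M + m + b ≤ 3 * q) (hq' : 3 * q ≤ M + m + d) :
    (-2 + 3 / (t * (1 + r * V / (1 + r)))) * q ≤ min (M + m - 2 * q) (q - M) ∧
      min (M + m - 2 * q) (q - M) ≤ (1 - r) / (1 + 2 * r) * q := by
  have hm := h.pos_m; have hb := h.pos_b; have hM := hm.trans_le h.le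
  constructor
  · set κ := t * (1 + r * V / (1 + r)) with hκ
    have hκ1 : 1 ≤ κ := one_le_mul_of_one_le_of_one_le ht (le_add_of_nonneg_right (by positivity))
    have hκr : κ * (1 + r) = t * (1 + r) + t * (r * V) := by rw [hκ]; field_simp
    refine le_min ?_ ?_
    · have := three_div_mul_le (x := M + m) (q := q) (κ := κ) (by linarith) (by
        refine le_of_mul_le_mul_right (a := 1 + r) ?_ (by linarith)
        rw [mul_right_comm κ, hκr]
        have h1 := mul_le_mul_of_nonneg_right hq' (by linarith : 0 ≤ 1 + r)
        have h2 := mul_le_mul_of_nonneg_right ht (by positivity : 0 ≤ (1 + r) * (M + m))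
        linarith [h.low1'])
      linarith
    · have := le_three_sub_mul (x := M) (q := q) (κ := κ) hκ1 hq (by
        refine le_of_mul_le_mul_right (a := 1 + r) ?_ (by linarith)
        rw [mul_right_comm, hκr]
        have h2 := mul_le_mul_of_nonneg_right ht (by positivity : 0 ≤ (1 + r) * (m + b))
        linarith [h.low1])
      linarith
  · have h1 := min_le_left (M + m - 2 * q) (q - M)
    have h2 := min_le_right (M + m - 2 * q) (q - M)
    rw [div_mul_eq_mul_div, le_div_iff₀ (by linarith)]
    have h3 := mul_le_mul_of_nonneg_left h1 (by linarith : 0 ≤ r)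
    have h4 := mul_le_mul_of_nonneg_left h2 (by linarith : 0 ≤ 1 + r)
    linarith [h.ratio]

theorem StepBound.bounds_three (h : StepBound r U V t M m b d) (hr : 1 ≤ r) (hU : 1 ≤ U)
    (ht : 1 ≤ t) (hq : M + m + b ≤ 3 * q) (hq' : 3 * q ≤ M + m + d) :
    (r - 1) / (r + 2) * q ≤ max (M + m - 2 * q) (q - m) ∧
      max (M + m - 2 * q) (q - m) ≤ (1 - 3 / (t * (1 + U * (1 + r)))) * q := by
  have hm := h.pos_m; have hb := h.pos_b; have hM := hm.trans_le h.le
  constructor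
  · have h1 := le_max_left (M + m - 2 * q) (q - m)
    have h2 := le_max_right (M + m - 2 * q) (q - m)
    rw [div_mul_eq_mul_div, div_le_iff₀ (by linarith)]
    have h4 := mul_le_mul_of_nonneg_left h2 (by linarith : 0 ≤ 1 + r)
    linarith [h.ratio]
  · set κ := t * (1 + U * (1 + r)) with hκ
    have hκ1 : 1 ≤ κ := one_le_mul_of_one_le_of_one_le ht (le_add_of_nonneg_right (by positivity))
    refine max_le ?_ ?_
    · have := le_three_sub_mul (x := M + m) (q := q) (κ := κ) hκ1 hq (by
        have h2 := mul_le_mul_of_nonneg_right ht hb.le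
        rw [hκ]
        linarith [h.up3])
      linarith
    · have := three_div_mul_le (x := m) (q := q) (κ := κ) (by linarith) (by
        have h2 := mul_le_mul_of_nonneg_right ht hm.le
        rw [hκ]
        linarith [h.up3'])
      linarith

theorem StepBound.bounds_two (h : StepBound r U V t M m b d) (hU : 1 ≤ U)
    (hV : 1 ≤ V) (ht : 1 ≤ t) (hq : M + m + b ≤ 3 * q) (hq' : 3 * q ≤ M + m + d) :
    (-2 + 3 / (t * ((1 + 2 * U) / (1 + U)))) * q ≤
        -min (M + m - 2 * q) (q - M) - max (M + m - 2 * q) (q - m) ∧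
      -min (M + m - 2 * q) (q - M) - max (M + m - 2 * q) (q - m) ≤
        (1 - 3 / (t * (V + 2))) * q := by
  have hm := h.pos_m; have hb := h.pos_b; have hM := hm.trans_le h.le; have hle := h.le
  have hq0 : 0 ≤ q := by linarith
  constructor
  · set κ := t * ((1 + 2 * U) / (1 + U)) with hκ
    have hκ0 : 1 ≤ (1 + 2 * U) / (1 + U) := (one_le_div (by linarith)).2 (by linarith)
    have hκ1 : 1 ≤ κ := one_le_mul_of_one_le_of_one_le ht hκ0
    have hκU : κ * (1 + U) = t * (1 + 2 * U) := by rw [hκ]; field_simp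
    have hA : (-2 + 3 / κ) * q ≤ q - m := by
      have := le_three_sub_mul (x := m) (q := q) (κ := κ) hκ1 hq (by
        refine le_of_mul_le_mul_right (a := 1 + U) ?_ (by linarith)
        rw [mul_right_comm, hκU]
        have h2 := mul_le_mul_of_nonneg_right ht
          (by positivity : 0 ≤ (1 + U) * (M + b) + U * M)
        have h3 := mul_le_mul_of_nonneg_left hle (by linarith : 0 ≤ U)
        linarith [h.low2])
      linarith
    have hB : (-2 + 3 / κ) * q ≤ max (M + m - 2 * q) (q - M) := by
      rcases h.low2' with h2 | h2
      · have hk : 3 / κ ≤ 3 / ((1 + 2 * U) / (1 + U)) :=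
          div_le_div_of_nonneg_left (by norm_num) (by linarith)
            (le_mul_of_one_le_left (by linarith) ht)
        refine (mul_le_mul_of_nonneg_right (add_le_add_right hk (-2)) hq0).trans ?_
        have e : -2 + 3 / ((1 + 2 * U) / (1 + U)) = (1 - U) / (1 + 2 * U) := by
          field_simp; ring
        rw [e, div_mul_eq_mul_div, div_le_iff₀ (by linarith)]
        have h3 := mul_le_mul_of_nonneg_left (le_max_left (M + m - 2 * q) (q - M))
          (by linarith : 0 ≤ U)
        have h4 := mul_le_mul_of_nonneg_left (le_max_right (M + m - 2 * q) (q - M))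
          (by linarith : 0 ≤ 1 + U)
        linarith
      · refine le_trans ?_ (le_max_left _ _)
        have := three_div_mul_le (x := M + m) (q := q) (κ := κ) (by linarith) (by
          refine le_of_mul_le_mul_right (a := 1 + U) ?_ (by linarith)
          rw [mul_right_comm κ, hκU]
          have h5 := mul_le_mul_of_nonneg_right hq' (by linarith : 0 ≤ 1 + U)
          have h6 := mul_le_mul_of_nonneg_right ht (by positivity : 0 ≤ (1 + U) * (M + m))
          linarith)
        linarith
    rcases le_total (M + m - 2 * q) (q - M) with h1 | h1 <;>
    rcases le_total (M + m - 2 * q) (q - m) with h2 | h2 <;>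
    simp only [min_eq_left, min_eq_right, max_eq_left, max_eq_right, h1, h2] at hB ⊢ <;>
    linarith
  · set κ := t * (V + 2) with hκ
    have hκ1 : 1 ≤ κ := one_le_mul_of_one_le_of_one_le ht (by linarith)
    have hA : q - M ≤ (1 - 3 / κ) * q := by
      have := three_div_mul_le (x := M) (q := q) (κ := κ) (by linarith) (by
        have h2 := mul_le_mul_of_nonneg_right ht hM.le
        rw [hκ]
        linarith [h.up2])
      linarith
    have hB : min (M + m - 2 * q) (q - m) ≤ (1 - 3 / κ) * q := by
      rcases h.up2' with h2 | h2
      · have hk : 3 / κ ≤ 3 / (V + 2) :=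
          div_le_div_of_nonneg_left (by norm_num) (by linarith)
            (le_mul_of_one_le_left (by linarith) ht)
        refine le_trans ?_ (mul_le_mul_of_nonneg_right (sub_le_sub_left hk 1) hq0)
        have e : 1 - 3 / (V + 2) = (V - 1) / (V + 2) := by
          field_simp; ring
        rw [e, div_mul_eq_mul_div, le_div_iff₀ (by linarith)]
        have h3 := min_le_left (M + m - 2 * q) (q - m)
        have h4 := mul_le_mul_of_nonneg_left (min_le_right (M + m - 2 * q) (q - m))
          (by linarith : 0 ≤ 1 + V)
        linarith
      · refine (min_le_left _ _).trans ?_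
        have := le_three_sub_mul (x := M + m) (q := q) (κ := κ) hκ1 hq (by
          have h5 := mul_le_mul_of_nonneg_right ht hb.le
          rw [hκ]
          linarith)
        linarith
    rcases le_total (M + m - 2 * q) (q - M) with h1 | h1 <;>
    rcases le_total (M + m - 2 * q) (q - m) with h2 | h2 <;>
    simp only [min_eq_left, min_eq_right, max_eq_left, max_eq_right, h1, h2] at hB ⊢ <;>
    linarith

end

/-- An admissible transition of exponents subject to the inequalities `StepBound`. -/
def GoodStep (r U V t : ℝ) (s s' : ℝ × ℝ × ℝ) : Prop :=
  IsStep s.1 s.2.1 s.2.2 s'.1 s'.2.1 s'.2.2 ∧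
    StepBound r U V t (max s.1 s.2.2) (min s.1 s.2.2) s.2.1 s'.1

theorem IsStep.smul {a b c a' b' c' s : ℝ} (hs : 0 ≤ s) (h : IsStep a b c a' b' c') :
    IsStep (s * a) (s * b) (s * c) (s * a') (s * b') (s * c') := by
  obtain ⟨h1, h2, h3⟩ := h
  refine ⟨mul_le_mul_of_nonneg_left h1 hs, mul_le_mul_of_nonneg_left h2 hs, ?_⟩
  rcases h3 with ⟨rfl, rfl⟩ | ⟨rfl, rfl⟩ <;> simp

theorem GoodStep.smul {r U V t s : ℝ} {x y : ℝ × ℝ × ℝ} (hs : 0 < s) (h : GoodStep r U V t x y) :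
    GoodStep r U V t (s • x) (s • y) := by
  refine ⟨h.1.smul hs.le, ?_⟩
  have := h.2.smul hs
  rw [mul_max_of_nonneg _ _ hs.le, mul_min_of_nonneg _ _ hs.le] at this
  exact this

theorem GoodStep.of_left {r U V t a b c a' b' c' : ℝ} (hs : IsStep a b c a' b' c')
    (h : StepBound r U V t a c b a') : GoodStep r U V t (a, b, c) (a', b', c') := by
  refine ⟨hs, ?_⟩
  rwa [max_eq_left h.le, min_eq_right h.le]

theorem GoodStep.of_right {r U V t a b c a' b' c' : ℝ} (hs : IsStep a b c a' b' c')
    (h : StepBound r U V t c a b a') : GoodStep r U V t (a, b, c) (a', b', c') := by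
  refine ⟨hs, ?_⟩
  rwa [max_eq_right h.le, min_eq_left h.le]

/-- Relations between the parameters of a cycle of transitions. -/
structure CycleParams (r U V t : ℝ) : Prop where
  one_le : 1 ≤ r
  le_U : r ≤ U
  le_V : r ≤ V
  mul_V_le : r * V + r ≤ U * (1 + r)
  mul_U_le : U * (1 + r) ≤ V * (1 + U)
  one_le_t : 1 ≤ t

section

variable {r U V t : ℝ} (h : CycleParams r U V t)

theorem mul_le_mul_t {x y t : ℝ} (ht : 1 ≤ t) (hy : 0 ≤ y) (h : x ≤ y) : x ≤ t * y :=
  h.trans (le_mul_of_one_le_left hy ht)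

include h in
theorem goodStep_start : GoodStep r U V t (1, 1, r) (r * V, 1, r) := by
  obtain ⟨hr, hU, hV, h2, h1, ht⟩ := h
  have hV1 : 1 ≤ V := hr.trans hV
  have hU1 : 1 ≤ U := hr.trans hU
  have hrV : 1 ≤ r * V := one_le_mul_of_one_le_of_one_le hr hV1
  refine .of_right ⟨le_rfl, hrV, Or.inr ⟨rfl, rfl⟩⟩
    ⟨one_pos, hr, one_pos, by linarith, ?_, ?_, ?_, ?_, ?_, Or.inl (by linarith), ?_,
      Or.inl (by linarith)⟩ <;> simp only [mul_assoc] <;>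
    refine mul_le_mul_t ht (by positivity) ?_
  · nlinarith
  · linarith
  · nlinarith
  · linarith
  · linarith
  · linarith

include h in
theorem goodStep_two {y : ℝ} (hy : r ≤ y) (hyV : y ≤ V) (hyt : y ≤ t * r) :
    GoodStep r U V t (r * V, 1, r) (y, r, r * V) := by
  obtain ⟨hr, hU, hV, h2, h1, ht⟩ := h
  have hV1 : 1 ≤ V := hr.trans hV
  have hU1 : 1 ≤ U := hr.trans hU
  have hrV : 1 ≤ r * V := one_le_mul_of_one_le_of_one_le hr hV1
  have hUV : 1 ≤ U * V := one_le_mul_of_one_le_of_one_le hU1 hV1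
  refine .of_left ⟨hrV, hr.trans hy, Or.inl ⟨rfl, rfl⟩⟩
    ⟨by linarith, by nlinarith, one_pos, by nlinarith, ?_, ?_, ?_, ?_, ?_, Or.inr ?_, ?_,
      Or.inl (by linarith)⟩
  · simp only [mul_assoc]; refine mul_le_mul_t ht (by positivity) ?_
    linarith
  · simp only [mul_assoc]; refine mul_le_mul_t ht (by positivity) ?_
    calc (1 + r) * y ≤ (1 + r) * V := by gcongr
      _ ≤ r * (V * (r * V + r)) := by
        have : 1 + r ≤ r * (r * V + r) := by nlinarith
        nlinarith
  · simp only [mul_assoc]; refine mul_le_mul_t ht (by positivity) ?_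
    linarith
  · calc r * V + y ≤ t * (r * V) + t * r := by
          have := mul_le_mul_t ht (by positivity) (le_refl (r * V)); linarith
      _ ≤ t * (U * (1 + r)) := by nlinarith
      _ ≤ t * (U * (1 + r)) * r := le_mul_of_one_le_right (by positivity) hr
  · simp only [mul_assoc]; refine mul_le_mul_t ht (by positivity) ?_
    linarith
  · calc (1 + U) * y ≤ (1 + U) * (t * r) := by gcongr
      _ ≤ t * U * (r * V + r) := by
        have : 0 ≤ t * r * (U * V - 1) :=
          mul_nonneg (by positivity) (by linarith)
        linarith
  · simp only [mul_assoc]; refine mul_le_mul_t ht (by positivity) ?_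
    nlinarith

include h in
theorem goodStep_glide_V {y y' y'' : ℝ} (hy : r ≤ y) (hyy' : y ≤ y') (hyy'' : y' ≤ y'')
    (hyV : y'' ≤ V) (hyt : y' ≤ t * y) (hyt' : y'' ≤ t * y') :
    GoodStep r U V t (y', y, r * V) (y'', y', r * V) := by
  obtain ⟨hr, hU, hV, h2, h1, ht⟩ := h
  have hV1 : 1 ≤ V := hr.trans hV
  have hU1 : 1 ≤ U := hr.trans hU
  have hrV : 1 ≤ r * V := one_le_mul_of_one_le_of_one_le hr hV1
  have hUV : 1 ≤ U * V := one_le_mul_of_one_le_of_one_le hU1 hV1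
  have hy1 : 1 ≤ y := hr.trans hy
  have hy0 : 0 < y := by linarith
  have hy0' : 0 < y' := by linarith
  have hy0'' : 0 < y'' := by linarith
  have key : ∀ z, 1 ≤ z → r * V + z ≤ U * (1 + r) * z := fun z hz => by
    have : r * V ≤ (U * (1 + r) - r) * z := by nlinarith
    nlinarith
  refine .of_right ⟨hyy', by linarith, Or.inr ⟨rfl, rfl⟩⟩
    ⟨by linarith, by nlinarith, by linarith, by nlinarith, ?_, ?_, ?_, ?_, ?_, Or.inr ?_, ?_,
      Or.inl ?_⟩
  · simp only [mul_assoc]; refine mul_le_mul_t ht (by positivity) ?_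
    have : 1 + r ≤ y' + y := by linarith
    have := mul_le_mul_of_nonneg_right this (by positivity : 0 ≤ r * V)
    linarith
  · simp only [mul_assoc]; refine mul_le_mul_t ht (by positivity) ?_
    calc (1 + r) * y'' ≤ (1 + r) * V := by gcongr
      _ ≤ r * (V * (r * V + y')) := by
        have h3 : 1 + r ≤ r * V + y' := by nlinarith
        have h4 : (1 : ℝ) * (1 + r) ≤ r * (r * V + y') := mul_le_mul hr h3 (by linarith) (by linarith)
        nlinarith
  · calc r * V + y' ≤ t * (r * V) + t * y := by
          have := mul_le_mul_t ht (by positivity) (le_refl (r * V)); linarith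
      _ = t * (r * V + y) := by ring
      _ ≤ t * (U * (1 + r) * y) := by gcongr; exact key y hy1
      _ = _ := by ring
  · calc r * V + y'' ≤ t * (r * V) + t * y' := by
          have := mul_le_mul_t ht (by positivity) (le_refl (r * V)); linarith
      _ = t * (r * V + y') := by ring
      _ ≤ t * (U * (1 + r) * y') := by gcongr; exact key y' (by linarith)
      _ = _ := by ring
  · calc y' ≤ t * y := hyt
      _ ≤ t * U * y := by gcongr; exact le_mul_of_one_le_right (by linarith) hU1
  · calc (1 + U) * y'' ≤ (1 + U) * (t * y') := by gcongr
      _ = t * (y' + U * y') := by ring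
      _ ≤ t * (U * (r * V) + U * y') := by
        gcongr
        calc y' ≤ V := by linarith
          _ ≤ U * (r * V) := by nlinarith
      _ = t * U * (r * V + y') := by ring
  · simp only [mul_assoc]; refine mul_le_mul_t ht (by positivity) ?_
    calc y'' ≤ V := hyV
      _ ≤ V * (r * V) := by nlinarith
  · rw [mul_comm]; gcongr; linarith

include h in
theorem goodStep_turn : GoodStep r U V t (V, V, r * V) (V * r, V * r, V * 1) := by
  obtain ⟨hr, hU, hV, h2, h1, ht⟩ := h
  have hV1 : 1 ≤ V := hr.trans hV
  have hU1 : 1 ≤ U := hr.trans hU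
  have hrV : 1 ≤ r * V := one_le_mul_of_one_le_of_one_le hr hV1
  have hVr : V ≤ r * V := le_mul_of_one_le_left (by linarith) hr
  have hVV : 1 ≤ V * V := one_le_mul_of_one_le_of_one_le hV1 hV1
  refine .of_right ⟨le_rfl, by linarith, Or.inl ⟨by ring, by ring⟩⟩
    ⟨by linarith, hVr, by linarith, le_rfl, ?_, ?_, ?_, ?_, ?_, Or.inl (by nlinarith), ?_,
      Or.inl (by nlinarith)⟩ <;> simp only [mul_assoc] <;>
    refine mul_le_mul_t ht (by positivity) ?_
  · have : 1 + r ≤ V + V := by linarith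
    nlinarith [mul_le_mul_of_nonneg_right this (by positivity : 0 ≤ r * V)]
  · have : 1 + r ≤ r * V + V := by nlinarith
    nlinarith [mul_le_mul_of_nonneg_right this (by positivity : 0 ≤ r * V)]
  · nlinarith
  · have : 2 * r ≤ U * (1 + r) := by nlinarith
    nlinarith
  · nlinarith
  · have : 1 ≤ r * V := hrV
    nlinarith

include h in
theorem CycleParams.mul_le {z : ℝ} (hz : 0 ≤ z) (hzU : z ≤ U) :
    (1 + r) * z ≤ r * V * (1 + z) := by
  obtain ⟨hr, hU, hV, h2, h1, ht⟩ := h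
  have hU0 : 0 < U := by linarith
  have hV0 : 0 < V := by linarith
  refine le_of_mul_le_mul_left (a := U) ?_ hU0
  calc U * ((1 + r) * z) = U * (1 + r) * z := by ring
    _ ≤ V * (1 + U) * z := by gcongr
    _ = V * ((1 + U) * z) := by ring
    _ ≤ V * (U * (1 + z)) :=
      mul_le_mul_of_nonneg_left (by linarith : (1 + U) * z ≤ U * (1 + z)) hV0.le
    _ ≤ r * (V * (U * (1 + z))) := le_mul_of_one_le_left (by positivity) hr
    _ = _ := by ring

include h in
theorem goodStep_glide_U {z z' z'' : ℝ} (hz : r ≤ z) (hzz' : z ≤ z') (hzz'' : z' ≤ z'')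
    (hzU : z'' ≤ U) (hzt : z' ≤ t * z) (hzt' : z'' ≤ t * z') :
    GoodStep r U V t (z', z, 1) (z'', z', 1) := by
  have key := fun z => h.mul_le (z := z)
  obtain ⟨hr, hU, hV, h2, h1, ht⟩ := h
  have hV1 : 1 ≤ V := hr.trans hV
  have hU1 : 1 ≤ U := hr.trans hU
  have hz1 : 1 ≤ z := hr.trans hz
  have hz0 : 0 < z := by linarith
  have hz1' : 1 ≤ z' := hz1.trans hzz'
  have hz0' : 0 < z' := by linarith
  have hz0'' : 0 < z'' := by linarith
  have h2U : 2 * U ≤ U * (1 + r) := by nlinarith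
  refine .of_left ⟨hzz', by linarith, Or.inr ⟨rfl, rfl⟩⟩
    ⟨by linarith, by linarith, by linarith, by linarith, ?_, ?_, ?_, ?_, ?_, Or.inl ?_, ?_,
      Or.inr ?_⟩
  · calc (1 + r) * z' ≤ (1 + r) * (t * z) := by gcongr
      _ = t * ((1 + r) * z) := by ring
      _ ≤ t * (r * V * (1 + z)) := 
        mul_le_mul_of_nonneg_left (key z (by linarith) (by linarith)) (by linarith)
      _ = _ := by ring
  · calc (1 + r) * z'' ≤ (1 + r) * (t * z') := by gcongr
      _ = t * ((1 + r) * z') := by ring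
      _ ≤ t * (r * V * (1 + z')) := 
        mul_le_mul_of_nonneg_left (key z' (by linarith) (by linarith)) (by linarith)
      _ = _ := by ring
  · rw [mul_assoc]; refine mul_le_mul_t ht (by positivity) ?_
    nlinarith
  · rw [mul_assoc]; refine mul_le_mul_t ht (by positivity) ?_
    linarith
  · rw [mul_assoc]; refine mul_le_mul_t ht (by positivity) ?_
    nlinarith
  · linarith
  · calc z'' ≤ t * z' := hzt'
      _ ≤ t * V * z' := by gcongr; exact le_mul_of_one_le_right (by linarith) hV1
  · calc z' + 1 ≤ t * z + t * (V * z) := by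
          have := mul_le_mul_t ht (by positivity) (one_le_mul_of_one_le_of_one_le hV1 hz1)
          linarith
      _ = _ := by ring

include h in
theorem goodStep_penultimate {z : ℝ} (hz : r ≤ z) (hzU : z ≤ U) (hzt : U ≤ t * z) :
    GoodStep r U V t (U, z, 1) (r * U, 1, U) := by
  have key := fun z => h.mul_le (z := z)
  obtain ⟨hr, hU, hV, h2, h1, ht⟩ := h
  have hV1 : 1 ≤ V := hr.trans hV
  have hU1 : 1 ≤ U := hr.trans hU
  have hz1 : 1 ≤ z := hr.trans hz
  have hz0 : 0 < z := by linarith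
  have h2U : 2 * U ≤ U * (1 + r) := by nlinarith
  refine .of_left ⟨hzU, by nlinarith, Or.inl ⟨rfl, rfl⟩⟩
    ⟨by linarith, by linarith, by linarith, by linarith, ?_, ?_, ?_, ?_, ?_, Or.inl ?_, ?_,
      Or.inr ?_⟩
  · calc (1 + r) * U ≤ (1 + r) * (t * z) := by gcongr
      _ = t * ((1 + r) * z) := by ring
      _ ≤ t * (r * V * (1 + z)) := 
        mul_le_mul_of_nonneg_left (key z (by linarith) (by linarith)) (by linarith)
      _ = _ := by ring
  · rw [mul_assoc]; refine mul_le_mul_t ht (by positivity) ?_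
    nlinarith
  · rw [mul_assoc]; refine mul_le_mul_t ht (by positivity) ?_
    nlinarith
  · rw [mul_assoc]; refine mul_le_mul_t ht (by positivity) ?_
    linarith
  · rw [mul_assoc]; refine mul_le_mul_t ht (by positivity) ?_
    nlinarith
  · linarith
  · rw [mul_assoc]; refine mul_le_mul_t ht (by positivity) ?_
    nlinarith
  · calc U + 1 ≤ t * z + t * (V * z) := by
          have := mul_le_mul_t ht (by positivity) (one_le_mul_of_one_le_of_one_le hV1 hz1)
          linarith
      _ = _ := by ring

include h in
theorem goodStep_last : GoodStep r U V t (r * U, 1, U) (U, U, r * U) := by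
  obtain ⟨hr, hU, hV, h2, h1, ht⟩ := h
  have hV1 : 1 ≤ V := hr.trans hV
  have hU1 : 1 ≤ U := hr.trans hU
  have hrU : 1 ≤ r * U := one_le_mul_of_one_le_of_one_le hr hU1
  have hrV : 1 ≤ r * V := one_le_mul_of_one_le_of_one_le hr hV1
  have hUr : U ≤ r * U := le_mul_of_one_le_left (by linarith) hr
  refine .of_left ⟨hrU, hU1, Or.inl ⟨rfl, rfl⟩⟩
    ⟨by linarith, hUr, one_pos, le_rfl, ?_, ?_, ?_, ?_, ?_, Or.inl (by nlinarith), ?_,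
      Or.inl (by nlinarith)⟩ <;> simp only [mul_assoc] <;>
    refine mul_le_mul_t ht (by positivity) ?_
  · nlinarith
  · have : 0 ≤ (r * V - 1) * ((1 + r) * U) := mul_nonneg (by linarith) (by positivity)
    linarith
  · linarith
  · nlinarith
  · linarith
  · nlinarith

end

/-- Geometric growth from `r` to `X`, by factors at most `t`. -/
noncomputable def glide (r X t : ℝ) (i : ℕ) : ℝ := min X (r * t ^ i)

theorem glide_le (r X t : ℝ) (i : ℕ) : glide r X t i ≤ X := min_le_left _ _

theorem glide_mono {r X t : ℝ} (hr : 0 ≤ r) (ht : 1 ≤ t) : Monotone (glide r X t) :=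
  fun _ _ hij => min_le_min_left _ (mul_le_mul_of_nonneg_left (pow_le_pow_right₀ ht hij) hr)

theorem glide_zero {r X t : ℝ} (h : r ≤ X) : glide r X t 0 = r := by simp [glide, h]

theorem le_glide {r X t : ℝ} (h : r ≤ X) (hr : 0 ≤ r) (ht : 1 ≤ t) (i : ℕ) :
    r ≤ glide r X t i := by
  simpa only [glide_zero h] using glide_mono (X := X) hr ht (Nat.zero_le i)

theorem glide_succ_le {r X t : ℝ} (hX : 0 ≤ X) (ht : 1 ≤ t) (i : ℕ) :
    glide r X t (i + 1) ≤ t * glide r X t i := by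
  rw [glide, glide, mul_min_of_nonneg _ _ (by linarith)]
  exact min_le_min (le_mul_of_one_le_left hX ht) (by rw [pow_succ]; exact le_of_eq (by ring))

theorem glide_eq {r X t : ℝ} {m i : ℕ} (hr : 0 ≤ r) (ht : 1 ≤ t) (h : X ≤ r * t ^ m)
    (hi : m ≤ i) : glide r X t i = X :=
  min_eq_left (h.trans (mul_le_mul_of_nonneg_left (pow_le_pow_right₀ ht hi) hr))

/-- The exponents along one cycle, which leads from `(1, 1, r)` to `(U * V) • (1, 1, r)` in
`2 * m + 5` transitions. -/
noncomputable def cycle (r U V t : ℝ) (m i : ℕ) : ℝ × ℝ × ℝ :=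
  if i = 0 then (1, 1, r)
  else if i = 1 then (r * V, 1, r)
  else if i ≤ m + 2 then (glide r V t (i - 1), glide r V t (i - 2), r * V)
  else if i ≤ 2 * m + 3 then
    V • (glide r U t (i - m - 3), glide r U t (i - m - 4), 1)
  else if i = 2 * m + 4 then V • (r * U, 1, U)
  else (U * V) • (1, 1, r)

section

variable (r U V t : ℝ) (m : ℕ)

theorem cycle_zero : cycle r U V t m 0 = (1, 1, r) := by simp [cycle]

theorem cycle_one : cycle r U V t m 1 = (r * V, 1, r) := by simp [cycle]

theorem cycle_add_two {j : ℕ} (hj : j ≤ m) :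
    cycle r U V t m (j + 2) = (glide r V t (j + 1), glide r V t j, r * V) := by
  simp [cycle, hj]

theorem cycle_glide {j : ℕ} (hj : j ≤ m) :
    cycle r U V t m (m + 3 + j) = V • (glide r U t j, glide r U t (j - 1), 1) := by
  have h1 : ¬ m + 3 + j ≤ m + 2 := by omega
  have h2 : m + 3 + j ≤ 2 * m + 3 := by omega
  have h3 : m + 3 + j - m - 3 = j := by omega
  have h4 : m + 3 + j - m - 4 = j - 1 := by omega
  have h5 : m + 3 + j ≠ 0 := by omega
  have h6 : m + 3 + j ≠ 1 := by omega
  rw [cycle, if_neg h5, if_neg h6, if_neg h1, if_pos h2, h3, h4]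

theorem cycle_penultimate : cycle r U V t m (2 * m + 4) = V • (r * U, 1, U) := by
  have h1 : ¬ 2 * m + 4 ≤ m + 2 := by omega
  have h2 : ¬ 2 * m + 4 ≤ 2 * m + 3 := by omega
  rw [cycle, if_neg (by omega), if_neg (by omega), if_neg h1, if_neg h2, if_pos rfl]

theorem cycle_last : cycle r U V t m (2 * m + 5) = (U * V) • (1, 1, r) := by
  have h1 : ¬ 2 * m + 5 ≤ m + 2 := by omega
  have h2 : ¬ 2 * m + 5 ≤ 2 * m + 3 := by omega
  rw [cycle, if_neg (by omega), if_neg (by omega), if_neg h1, if_neg h2, if_neg (by omega)]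

end

theorem goodStep_cycle {r U V t : ℝ} (h : CycleParams r U V t) {m : ℕ}
    (hU : U ≤ r * t ^ m) (hV : V ≤ r * t ^ m) {i : ℕ} (hi : i < 2 * m + 5) :
    GoodStep r U V t (cycle r U V t m i) (cycle r U V t m (i + 1)) := by
  have hr : 0 ≤ r := zero_le_one.trans h.one_le
  have hV0 : 0 < V := by linarith [h.one_le, h.le_V]
  have hU0 : 0 < U := by linarith [h.one_le, h.le_U]
  have ht := h.one_le_t
  have h0 : glide r V t 0 = r := glide_zero h.le_V
  have h0' : glide r U t 0 = r := glide_zero h.le_U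
  have hmV := glide_mono (X := V) hr ht
  have hmU := glide_mono (X := U) hr ht
  obtain rfl | rfl | ⟨j, hj, rfl⟩ | rfl | ⟨j, hj, rfl⟩ | rfl | rfl :
      i = 0 ∨ i = 1 ∨ (∃ j < m, i = j + 2) ∨ i = m + 2 ∨ (∃ j < m, i = m + 3 + j) ∨
        i = m + 3 + m ∨ i = 2 * m + 4 := by
    by_cases h1 : i < 2
    · omega
    by_cases h2 : i < m + 2
    · exact Or.inr (Or.inr (Or.inl ⟨i - 2, by omega, by omega⟩))
    by_cases h3 : i = m + 2
    · tauto
    by_cases h4 : i < 2 * m + 3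
    · exact Or.inr (Or.inr (Or.inr (Or.inr (Or.inl ⟨i - (m + 3), by omega, by omega⟩))))
    · omega
  · rw [cycle_zero, zero_add, cycle_one]
    exact goodStep_start h
  · rw [cycle_one, cycle_add_two r U V t m (Nat.zero_le m), h0]
    refine goodStep_two h (le_glide h.le_V hr ht _) (glide_le _ _ _ _) ?_
    simpa only [h0] using glide_succ_le (r := r) hV0.le ht 0
  · rw [cycle_add_two r U V t m hj.le, add_right_comm, cycle_add_two r U V t m hj]
    exact goodStep_glide_V h (le_glide h.le_V hr ht _) (hmV (by omega)) (hmV (by omega))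
      (glide_le _ _ _ _) (glide_succ_le hV0.le ht _) (glide_succ_le hV0.le ht _)
  · have h3 : m + 2 + 1 = m + 3 + 0 := rfl
    rw [cycle_add_two r U V t m le_rfl, h3, cycle_glide r U V t m (Nat.zero_le m),
      glide_eq hr ht hV le_rfl, glide_eq hr ht hV (Nat.le_succ m), Nat.zero_sub, h0']
    exact goodStep_turn h
  · rw [cycle_glide r U V t m hj.le, add_assoc _ j, cycle_glide r U V t m hj]
    refine GoodStep.smul hV0 ?_
    have hle : glide r U t j ≤ t * glide r U t (j - 1) := by
      rcases j with _ | j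
      · rw [Nat.zero_sub, h0']
        exact le_mul_of_one_le_left hr ht
      · exact glide_succ_le hU0.le ht _
    exact goodStep_glide_U h (le_glide h.le_U hr ht _) (hmU (by omega)) (hmU (by omega))
      (glide_le _ _ _ _) hle (glide_succ_le hU0.le ht _)
  · have h3 : m + 3 + m + 1 = 2 * m + 4 := by omega
    rw [cycle_glide r U V t m le_rfl, h3, cycle_penultimate, glide_eq hr ht hU le_rfl]
    refine GoodStep.smul hV0 ?_
    have hle : U ≤ t * glide r U t (m - 1) := by
      rcases m with _ | m
      · rw [Nat.zero_sub, h0']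
        simp only [pow_zero, mul_one] at hU
        exact hU.trans (le_mul_of_one_le_left hr ht)
      · conv_lhs => rw [← glide_eq hr ht hU le_rfl]
        exact glide_succ_le hU0.le ht _
    exact goodStep_penultimate h (le_glide h.le_U hr ht _) (glide_le _ _ _ _) hle
  · rw [cycle_penultimate, cycle_last]
    have := (goodStep_last h).smul hV0
    have e : (V • (U, U, r * U) : ℝ × ℝ × ℝ) = (U * V) • (1, 1, r) := by
      ext <;> simp <;> ring
    rwa [e] at this

/-- Successive positions in a concatenation of blocks, the `k`-th of which has length
`2 * k + 7`. -/
def blockPos : ℕ → ℕ × ℕ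
  | 0 => (0, 0)
  | n + 1 =>
    if (blockPos n).2 + 1 < 2 * (blockPos n).1 + 7 then ((blockPos n).1, (blockPos n).2 + 1)
    else ((blockPos n).1 + 1, 0)

theorem blockPos_spec (n : ℕ) :
    (blockPos n).2 < 2 * (blockPos n).1 + 7 ∧
      (blockPos n).1 ^ 2 + 6 * (blockPos n).1 + (blockPos n).2 = n := by
  induction n with
  | zero => simp [blockPos]
  | succ n ih =>
    obtain ⟨h1, h2⟩ := ih
    rw [blockPos]
    split_ifs with h
    · exact ⟨h, by dsimp only; omega⟩
    · refine ⟨by dsimp only; omega, ?_⟩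
      dsimp only
      have h3 : (blockPos n).2 + 1 = 2 * (blockPos n).1 + 7 := by omega
      nlinarith

theorem exists_blockPos_eq {k i : ℕ} (hi : i < 2 * k + 7) : ∃ n, blockPos n = (k, i) := by
  refine ⟨k ^ 2 + 6 * k + i, ?_⟩
  obtain ⟨h1, h2⟩ := blockPos_spec (k ^ 2 + 6 * k + i)
  generalize blockPos (k ^ 2 + 6 * k + i) = p at h1 h2
  obtain ⟨k', i'⟩ := p
  dsimp only at h1 h2
  obtain h | rfl | h := lt_trichotomy k k'
  · nlinarith
  · simp only [Prod.mk.injEq, true_and]; omega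
  · nlinarith

theorem le_blockPos (n : ℕ) : n < ((blockPos n).1 + 4) ^ 2 := by
  obtain ⟨h1, h2⟩ := blockPos_spec n
  nlinarith

theorem tendsto_blockPos_fst : Tendsto (fun n => (blockPos n).1) atTop atTop := by
  refine tendsto_atTop.2 fun K => eventually_atTop.2 ⟨(K + 4) ^ 2, fun n hn => ?_⟩
  have := le_blockPos n
  by_contra! h
  nlinarith

/-- The exponents at the `i`-th place of the `k`-th cycle, when the latter is scaled by `s k`. -/
noncomputable def blockState (r : ℝ) (U V t s : ℕ → ℝ) (k i : ℕ) : ℝ × ℝ × ℝ :=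
  s k • cycle r (U k) (V k) (t k) (k + 1) i

/-- The sum of the three entries of a triple. -/
def tripleSum (x : ℝ × ℝ × ℝ) : ℝ := x.1 + x.2.1 + x.2.2

/-- Parameters for an infinite concatenation of cycles, with scaling factors `s`. -/
structure BlockParams (r : ℝ) (U V t s : ℕ → ℝ) : Prop where
  cycleParams : ∀ k, CycleParams r (U k) (V k) (t k)
  U_le : ∀ k, U k ≤ r * t k ^ (k + 1)
  V_le : ∀ k, V k ≤ r * t k ^ (k + 1)
  s_succ : ∀ k, s (k + 1) = s k * (U k * V k)
  s_ge : ∀ k : ℕ, (k : ℝ) ^ 3 ≤ s k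
  s_pos : ∀ k, 0 < s k

namespace BlockParams

variable {r : ℝ} {U V t s : ℕ → ℝ} (h : BlockParams r U V t s)

/-- The infinite sequence of exponents. -/
noncomputable def seq (_ : BlockParams r U V t s) (n : ℕ) : ℝ × ℝ × ℝ :=
  blockState r U V t s (blockPos n).1 (blockPos n).2

include h

theorem seq_succ (n : ℕ) :
    h.seq (n + 1) = blockState r U V t s (blockPos n).1 ((blockPos n).2 + 1) := by
  have h1 := (blockPos_spec n).1
  rw [seq, blockPos]
  split_ifs with h2
  · rfl
  · have h3 : (blockPos n).2 + 1 = 2 * ((blockPos n).1 + 1) + 5 := by omega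
    rw [h3, blockState, blockState, cycle_last, cycle_zero, h.s_succ, smul_smul]

theorem goodStep {k i : ℕ} (hi : i < 2 * k + 7) :
    GoodStep r (U k) (V k) (t k) (blockState r U V t s k i) (blockState r U V t s k (i + 1)) :=
  GoodStep.smul (h.s_pos k)
    (goodStep_cycle (h.cycleParams k) (h.U_le k) (h.V_le k) (by omega))

theorem isStep_seq (n : ℕ) :
    IsStep (h.seq n).1 (h.seq n).2.1 (h.seq n).2.2 (h.seq (n + 1)).1 (h.seq (n + 1)).2.1
      (h.seq (n + 1)).2.2 := by
  rw [h.seq_succ]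
  exact (h.goodStep (blockPos_spec n).1).1

theorem seq_zero_nonneg : 0 ≤ (h.seq 0).1 ∧ 0 ≤ (h.seq 0).2.1 ∧ 0 ≤ (h.seq 0).2.2 := by
  have hs := (h.s_pos 0).le
  have hr : 0 ≤ r := zero_le_one.trans (h.cycleParams 0).one_le
  simp only [seq, blockState, blockPos, cycle_zero]
  refine ⟨?_, ?_, ?_⟩ <;> dsimp <;> positivity

theorem one_le_tripleSum_cycle (k : ℕ) {i : ℕ} (hi : i ≤ 2 * k + 7) :
    1 ≤ tripleSum (cycle r (U k) (V k) (t k) (k + 1) i) := by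
  induction i with
  | zero =>
    have hr := (h.cycleParams 0).one_le
    rw [cycle_zero, tripleSum]
    dsimp only
    linarith
  | succ i ih =>
    have := (goodStep_cycle (h.cycleParams k) (h.U_le k) (h.V_le k)
      (by omega : i < 2 * (k + 1) + 5)).1.sum_le
    exact (ih (by omega)).trans this

theorem growth (ε : ℝ) (hε : 0 < ε) :
    ∃ C, ∀ n : ℕ, (n : ℝ) ≤ ε * ((h.seq n).1 + (h.seq n).2.1 + (h.seq n).2.2) + C := by
  refine ⟨32 + 8 / ε ^ 2, fun n => ?_⟩
  obtain ⟨h1, -⟩ := blockPos_spec n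
  have h2 := le_blockPos n
  set k := (blockPos n).1 with hk
  have h3 : s k ≤ (h.seq n).1 + (h.seq n).2.1 + (h.seq n).2.2 := by
    have h4 := le_mul_of_one_le_right (h.s_pos k).le (h.one_le_tripleSum_cycle k h1.le)
    simp only [tripleSum] at h4
    simp only [seq, blockState, Prod.smul_fst, Prod.smul_snd, smul_eq_mul]
    linarith
  have h4 : (n : ℝ) ≤ ((k : ℝ) + 4) ^ 2 := by exact_mod_cast h2.le
  have h5 := h.s_ge k
  have h6 : 2 * (k : ℝ) ^ 2 ≤ ε * (k : ℝ) ^ 3 + 8 / ε ^ 2 := by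
    obtain h7 | h7 := le_total (2 / ε) k
    · have h8 : 2 ≤ ε * k := by rwa [div_le_iff₀' hε] at h7
      have h9 : 0 ≤ 8 / ε ^ 2 := by positivity
      nlinarith [mul_le_mul_of_nonneg_right h8 (sq_nonneg (k : ℝ))]
    · have h8 : (k : ℝ) ^ 2 ≤ (2 / ε) ^ 2 := pow_le_pow_left₀ (by positivity) h7 2
      have h9 : (2 / ε) ^ 2 * 2 = 8 / ε ^ 2 := by ring
      have h10 : 0 ≤ ε * (k : ℝ) ^ 3 := by positivity
      linarith
  have h7 : ε * (k : ℝ) ^ 3 ≤ ε * ((h.seq n).1 + (h.seq n).2.1 + (h.seq n).2.2) :=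
    mul_le_mul_of_nonneg_left (h5.trans h3) hε.le
  nlinarith [sq_nonneg ((k : ℝ) - 4)]

theorem balanced : ∃ κ > 0, ∃ᶠ n in atTop, ∀ j : Fin 3,
    κ * ((h.seq n).1 + (h.seq n).2.1 + (h.seq n).2.2) ≤
      ![(h.seq n).1, (h.seq n).2.1, (h.seq n).2.2] j := by
  have hr := (h.cycleParams 0).one_le
  refine ⟨1 / (2 + r), by positivity, frequently_atTop.2 fun N => ?_⟩
  obtain ⟨n, hn⟩ := exists_blockPos_eq (k := N) (i := 0) (by omega)
  refine ⟨n, ?_, ?_⟩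
  · have := (blockPos_spec n).2
    rw [hn] at this
    dsimp only at this
    nlinarith
  · have hs := h.s_pos N
    have e : h.seq n = (s N, s N, s N * r) := by
      rw [seq, hn, blockState, cycle_zero]
      simp
    have e2 : 1 / (2 + r) * (s N + s N + s N * r) = s N := by field_simp; ring
    rw [e]
    dsimp only
    rw [e2]
    intro j
    fin_cases j
    · simp
    · simp
    · simpa using le_mul_of_one_le_right hs.le hr

/-- The successive minima for a suitable point, in terms of the exponents. -/
theorem exists_approx : ∃ ξ₁ ξ₂ : ℝ, LinearIndependent ℚ ![(1 : ℝ), ξ₁, ξ₂] ∧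
    ∀ ε > 0, ∃ C, ∀ k i, i < 2 * k + 7 → ∀ q,
      ∀ x, x = blockState r U V t s k i → tripleSum x ≤ 3 * q →
      3 * q ≤ tripleSum (blockState r U V t s k (i + 1)) →
      |Lmin ξ₁ ξ₂ 1 q - min (x.1 + x.2.2 - 2 * q) (q - max x.1 x.2.2)| ≤ ε * q + C ∧
      |Lmin ξ₁ ξ₂ 2 q - (-min (x.1 + x.2.2 - 2 * q) (q - max x.1 x.2.2) -
        max (x.1 + x.2.2 - 2 * q) (q - min x.1 x.2.2))| ≤ ε * q + C ∧
      |Lmin ξ₁ ξ₂ 3 q - max (x.1 + x.2.2 - 2 * q) (q - min x.1 x.2.2)| ≤ ε * q + C := by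
  obtain ⟨ξ₁, ξ₂, hli, H⟩ := exists_Lmin_approx (a := fun n => (h.seq n).1)
    (b := fun n => (h.seq n).2.1) (c := fun n => (h.seq n).2.2) h.seq_zero_nonneg h.isStep_seq
    h.growth h.balanced
  refine ⟨ξ₁, ξ₂, hli, fun ε hε => ?_⟩
  obtain ⟨C, hC⟩ := H ε hε
  refine ⟨C, fun k i hi q x hx h1 h2 => ?_⟩
  obtain ⟨n, hn⟩ := exists_blockPos_eq hi
  have e1 : h.seq n = x := by rw [seq, hn, hx]
  have e2 := h.seq_succ n
  rw [hn] at e2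
  rw [← e2] at h2
  have := hC n q (by rw [e1]; exact h1) h2
  rwa [e1] at this

theorem exists_interval (K : ℕ) : ∃ Q, ∀ q ≥ Q, ∃ k ≥ K, ∃ i < 2 * k + 7,
    tripleSum (blockState r U V t s k i) ≤ 3 * q ∧
      3 * q ≤ tripleSum (blockState r U V t s k (i + 1)) := by
  have hS := tendsto_sum_atTop h.growth
  obtain ⟨N, hN⟩ := eventually_atTop.1 (tendsto_atTop.1 tendsto_blockPos_fst K)
  refine ⟨tripleSum (h.seq N) / 3, fun q hq => ?_⟩
  obtain ⟨n, hn, h1, h2⟩ : ∃ n ≥ N, tripleSum (h.seq n) ≤ 3 * q ∧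
      3 * q ≤ tripleSum (h.seq (n + 1)) := by
    by_contra! hcon
    have key : ∀ n ≥ N, tripleSum (h.seq n) ≤ 3 * q := by
      intro n hn
      induction n, hn using Nat.le_induction with
      | base => linarith
      | succ n hn ih => exact (hcon n hn ih).le
    obtain ⟨n, hn, hn'⟩ := ((tendsto_atTop.1 hS (3 * q + 1)).and (eventually_ge_atTop N)).exists
    have := key n hn'
    simp only [tripleSum] at this
    linarith
  rw [h.seq_succ] at h2
  exact ⟨_, hN n hn, _, (blockPos_spec n).1, h1, h2⟩

end BlockParams

theorem liminf_eq_of_eventually_of_frequently {f : ℝ → ℝ} {x : ℝ}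
    (h1 : ∀ ε > 0, ∀ᶠ q in atTop, x - ε ≤ f q) (h2 : ∀ ε > 0, ∃ᶠ q in atTop, f q ≤ x + ε) :
    liminf f atTop = x := by
  refine le_antisymm ?_ ?_
  · exact le_of_forall_pos_le_add fun ε hε => liminf_le_of_frequently_le (h2 ε hε) ⟨_, h1 1 one_pos⟩
  · refine le_of_forall_pos_le_add fun ε hε => ?_
    have := le_liminf_of_le (IsCoboundedUnder.of_frequently_le (h2 1 one_pos)) (h1 ε hε)
    linarith

theorem limsup_eq_of_eventually_of_frequently {f : ℝ → ℝ} {x : ℝ}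
    (h1 : ∀ ε > 0, ∀ᶠ q in atTop, f q ≤ x + ε) (h2 : ∀ ε > 0, ∃ᶠ q in atTop, x - ε ≤ f q) :
    limsup f atTop = x := by
  refine le_antisymm ?_ ?_
  · exact le_of_forall_pos_le_add fun ε hε =>
      limsup_le_of_le (IsCoboundedUnder.of_frequently_ge (h2 1 one_pos)) (h1 ε hε)
  · refine le_of_forall_pos_le_add fun ε hε => ?_
    have := le_limsup_of_frequently_le (h2 ε hε) ⟨_, h1 1 one_pos⟩
    linarith

section

open Topology

variable {L : ℝ → ℝ} {P : ℕ → ℝ → Prop} {α β : ℕ → ℝ} {p : ℕ → ℝ} {x : ℝ}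

theorem eventually_le_div (hP : ∀ K, ∃ Q, ∀ q ≥ Q, ∃ k ≥ K, P k q)
    (hα : Tendsto α atTop (𝓝 x))
    (hL : ∀ ε > 0, ∃ C, ∀ k q, P k q → α k * q ≤ L q + (ε * q + C)) :
    ∀ ε > 0, ∀ᶠ q in atTop, x - ε ≤ L q / q := by
  intro ε hε
  obtain ⟨C, hC⟩ := hL (ε / 3) (by positivity)
  obtain ⟨K, hK⟩ := eventually_atTop.1
    (hα.eventually (eventually_ge_nhds (by linarith : x - ε / 3 < x)))
  obtain ⟨Q, hQ⟩ := hP K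
  filter_upwards [eventually_ge_atTop Q, eventually_gt_atTop 0,
    eventually_ge_atTop (C / (ε / 3))] with q hq hq0 hqC
  obtain ⟨k, hk, hkq⟩ := hQ q hq
  have h1 := hC k q hkq
  have h2 := mul_le_mul_of_nonneg_right (hK k hk) hq0.le
  rw [div_le_iff₀ (by positivity)] at hqC
  rw [le_div_iff₀ hq0]
  linarith

theorem eventually_div_le (hP : ∀ K, ∃ Q, ∀ q ≥ Q, ∃ k ≥ K, P k q)
    (hα : Tendsto α atTop (𝓝 x))
    (hL : ∀ ε > 0, ∃ C, ∀ k q, P k q → L q ≤ α k * q + (ε * q + C)) :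
    ∀ ε > 0, ∀ᶠ q in atTop, L q / q ≤ x + ε := by
  intro ε hε
  have := eventually_le_div (L := -L) hP hα.neg (fun ε hε => (hL ε hε).imp fun C hC k q hkq => by
    have := hC k q hkq
    simp only [Pi.neg_apply]
    linarith) ε hε
  filter_upwards [this] with q hq
  rw [Pi.neg_apply, neg_div] at hq
  linarith

theorem frequently_div_le (hp : Tendsto p atTop atTop) (hβ : Tendsto β atTop (𝓝 x))
    (hL : ∀ ε > 0, ∃ C, ∀ k, L (p k) ≤ β k * p k + (ε * p k + C)) :
    ∀ ε > 0, ∃ᶠ q in atTop, L q / q ≤ x + ε := by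
  intro ε hε
  obtain ⟨C, hC⟩ := hL (ε / 3) (by positivity)
  refine hp.frequently (Eventually.frequently ?_)
  filter_upwards [hβ.eventually (eventually_le_nhds (by linarith : x < x + ε / 3)),
    hp.eventually (eventually_gt_atTop 0), hp.eventually (eventually_ge_atTop (C / (ε / 3)))]
    with k hk h0 hkC
  have h1 := hC k
  have h2 := mul_le_mul_of_nonneg_right hk h0.le
  rw [div_le_iff₀ (by positivity)] at hkC
  rw [div_le_iff₀ h0]
  linarith

theorem frequently_le_div (hp : Tendsto p atTop atTop) (hβ : Tendsto β atTop (𝓝 x))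
    (hL : ∀ ε > 0, ∃ C, ∀ k, β k * p k ≤ L (p k) + (ε * p k + C)) :
    ∀ ε > 0, ∃ᶠ q in atTop, x - ε ≤ L q / q := by
  intro ε hε
  refine (frequently_div_le (L := -L) hp hβ.neg (fun ε hε => (hL ε hε).imp fun C hC k => by
    have := hC k
    simp only [Pi.neg_apply]
    linarith) ε hε).mono fun q hq => ?_
  rw [Pi.neg_apply, neg_div] at hq
  linarith

theorem liminf_div_eq (hP : ∀ K, ∃ Q, ∀ q ≥ Q, ∃ k ≥ K, P k q) (hp : Tendsto p atTop atTop)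
    (hα : Tendsto α atTop (𝓝 x)) (hβ : Tendsto β atTop (𝓝 x))
    (hL : ∀ ε > 0, ∃ C, (∀ k q, P k q → α k * q ≤ L q + (ε * q + C)) ∧
      ∀ k, L (p k) ≤ β k * p k + (ε * p k + C)) :
    liminf (fun q => L q / q) atTop = x :=
  liminf_eq_of_eventually_of_frequently
    (eventually_le_div hP hα fun ε hε => (hL ε hε).imp fun _ h => h.1)
    (frequently_div_le hp hβ fun ε hε => (hL ε hε).imp fun _ h => h.2)

theorem limsup_div_eq (hP : ∀ K, ∃ Q, ∀ q ≥ Q, ∃ k ≥ K, P k q) (hp : Tendsto p atTop atTop)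
    (hα : Tendsto α atTop (𝓝 x)) (hβ : Tendsto β atTop (𝓝 x))
    (hL : ∀ ε > 0, ∃ C, (∀ k q, P k q → L q ≤ α k * q + (ε * q + C)) ∧
      ∀ k, β k * p k ≤ L (p k) + (ε * p k + C)) :
    limsup (fun q => L q / q) atTop = x :=
  limsup_eq_of_eventually_of_frequently
    (eventually_div_le hP hα fun ε hε => (hL ε hε).imp fun _ h => h.1)
    (frequently_le_div hp hβ fun ε hε => (hL ε hε).imp fun _ h => h.2)

end

namespace BlockParams

open Topology

variable {r : ℝ} {U V t s : ℕ → ℝ} (h : BlockParams r U V t s)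

/-- `q` is in the range of the `i`-th transition of the `k`-th cycle. -/
def InRange (r : ℝ) (U V t s : ℕ → ℝ) (k i : ℕ) (q : ℝ) : Prop :=
  i < 2 * k + 7 ∧ tripleSum (blockState r U V t s k i) ≤ 3 * q ∧
    3 * q ≤ tripleSum (blockState r U V t s k (i + 1))

include h

theorem bounds {k i : ℕ} {q : ℝ} (hq : InRange r U V t s k i q) {x : ℝ × ℝ × ℝ}
    (hx : x = blockState r U V t s k i) :
    ((-2 + 3 / (t k * (1 + r * V k / (1 + r)))) * q ≤
        min (x.1 + x.2.2 - 2 * q) (q - max x.1 x.2.2) ∧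
      min (x.1 + x.2.2 - 2 * q) (q - max x.1 x.2.2) ≤ (1 - r) / (1 + 2 * r) * q) ∧
    ((-2 + 3 / (t k * ((1 + 2 * U k) / (1 + U k)))) * q ≤
        -min (x.1 + x.2.2 - 2 * q) (q - max x.1 x.2.2) -
          max (x.1 + x.2.2 - 2 * q) (q - min x.1 x.2.2) ∧
      -min (x.1 + x.2.2 - 2 * q) (q - max x.1 x.2.2) -
          max (x.1 + x.2.2 - 2 * q) (q - min x.1 x.2.2) ≤ (1 - 3 / (t k * (V k + 2))) * q) ∧
    ((r - 1) / (r + 2) * q ≤ max (x.1 + x.2.2 - 2 * q) (q - min x.1 x.2.2) ∧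
      max (x.1 + x.2.2 - 2 * q) (q - min x.1 x.2.2) ≤
        (1 - 3 / (t k * (1 + U k * (1 + r)))) * q) := by
  obtain ⟨hi, h1, h2⟩ := hq
  obtain ⟨hstep, hb⟩ := h.goodStep hi
  have hadd := hstep.add_eq
  rw [← hx] at hb h1 hadd
  have hsum := max_add_min x.1 x.2.2
  obtain ⟨hr, hU, hV, -, -, ht⟩ := h.cycleParams k
  have h1' : max x.1 x.2.2 + min x.1 x.2.2 + x.2.1 ≤ 3 * q := by
    rw [hsum]; unfold tripleSum at h1; linarith
  have h2' : 3 * q ≤ max x.1 x.2.2 + min x.1 x.2.2 + (blockState r U V t s k (i + 1)).1 := by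
    rw [hsum]; unfold tripleSum at h2; linarith
  have b1 := hb.bounds_one hr (hr.trans hV) ht h1' h2'
  have b2 := hb.bounds_two (hr.trans hU) (hr.trans hV) ht h1' h2'
  have b3 := hb.bounds_three hr (hr.trans hU) ht h1' h2'
  rw [hsum] at b1 b2 b3
  exact ⟨b1, b2, b3⟩

theorem tendsto_of_le {p : ℕ → ℝ} (hp : ∀ k, s k / 3 ≤ p k) : Tendsto p atTop atTop := by
  have h1 : Tendsto (fun k : ℕ => (k : ℝ) ^ 3 / 3) atTop atTop :=
    ((tendsto_pow_atTop (by norm_num)).comp tendsto_natCast_atTop_atTop).atTop_div_const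
      (by norm_num)
  refine tendsto_atTop_mono (fun k => ?_) h1
  linarith [h.s_ge k, hp k]

theorem one_le (k : ℕ) : 1 ≤ r ∧ 1 ≤ U k ∧ 1 ≤ V k := by
  obtain ⟨hr, hU, hV, -⟩ := h.cycleParams k
  exact ⟨hr, hr.trans hU, hr.trans hV⟩

theorem exists_state_up_one (k : ℕ) : ∃ i x, x = blockState r U V t s k i ∧
    InRange r U V t s k i (s k * (1 + 2 * r) / 3) ∧
    (1 - r) / (1 + 2 * r) * (s k * (1 + 2 * r) / 3) ≤
      min (x.1 + x.2.2 - 2 * (s k * (1 + 2 * r) / 3))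
        (s k * (1 + 2 * r) / 3 - max x.1 x.2.2) := by
  obtain ⟨hr, hU, hV⟩ := h.one_le k
  have hs := h.s_pos k
  have hrs := mul_le_mul_of_nonneg_left hr hs.le
  refine ⟨0, _, rfl, ⟨by omega, ?_, ?_⟩, ?_⟩
  · simp only [blockState, tripleSum, cycle_zero, Prod.smul_mk, smul_eq_mul]
    linarith
  · simp only [blockState, tripleSum, zero_add, cycle_one, Prod.smul_mk, smul_eq_mul]
    have : r ≤ r * V k := le_mul_of_one_le_right (by linarith) hV
    nlinarith [mul_le_mul_of_nonneg_left this hs.le]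
  · simp only [blockState, cycle_zero, Prod.smul_mk, smul_eq_mul]
    have e : (1 - r) / (1 + 2 * r) * (s k * (1 + 2 * r) / 3) = s k * (1 - r) / 3 := by
      field_simp
    rw [e, max_eq_right hrs]
    exact le_min (by linarith) (by linarith)

theorem exists_state_low_three (k : ℕ) : ∃ i x, x = blockState r U V t s k i ∧
    InRange r U V t s k i (s k * (r + 2) / 3) ∧
    max (x.1 + x.2.2 - 2 * (s k * (r + 2) / 3)) (s k * (r + 2) / 3 - min x.1 x.2.2) ≤
      (r - 1) / (r + 2) * (s k * (r + 2) / 3) := by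
  obtain ⟨hr, hU, hV⟩ := h.one_le k
  have hs := h.s_pos k
  have hrs := mul_le_mul_of_nonneg_left hr hs.le
  refine ⟨0, _, rfl, ⟨by omega, ?_, ?_⟩, ?_⟩
  · simp only [blockState, tripleSum, cycle_zero, Prod.smul_mk, smul_eq_mul]
    linarith
  · simp only [blockState, tripleSum, zero_add, cycle_one, Prod.smul_mk, smul_eq_mul]
    have : 1 ≤ r * V k := one_le_mul_of_one_le_of_one_le hr hV
    nlinarith [mul_le_mul_of_nonneg_left this hs.le]
  · simp only [blockState, cycle_zero, Prod.smul_mk, smul_eq_mul]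
    have e : (r - 1) / (r + 2) * (s k * (r + 2) / 3) = s k * (r - 1) / 3 := by
      field_simp
    rw [e, min_eq_left hrs]
    exact max_le (by linarith) (by linarith)

theorem exists_state_low_one (k : ℕ) : ∃ i x, x = blockState r U V t s k i ∧
    InRange r U V t s k i (s k * (r * V k + 1 + r) / 3) ∧
    min (x.1 + x.2.2 - 2 * (s k * (r * V k + 1 + r) / 3))
        (s k * (r * V k + 1 + r) / 3 - max x.1 x.2.2) ≤
      (-2 + 3 / (1 + r * V k / (1 + r))) * (s k * (r * V k + 1 + r) / 3) := by
  obtain ⟨hr, hU, hV⟩ := h.one_le k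
  have hs := h.s_pos k
  refine ⟨1, _, rfl, ⟨by omega, ?_, ?_⟩, ?_⟩
  · simp only [blockState, tripleSum, cycle_one, Prod.smul_mk, smul_eq_mul]
    linarith
  · have := (h.goodStep (by omega : 1 < 2 * k + 7)).1.sum_le
    refine le_trans ?_ this
    simp only [blockState, cycle_one, Prod.smul_mk, smul_eq_mul]
    linarith
  · simp only [blockState, cycle_one, Prod.smul_mk, smul_eq_mul]
    have e : (-2 + 3 / (1 + r * V k / (1 + r))) * (s k * (r * V k + 1 + r) / 3) =
        s k * (1 + r - 2 * (r * V k)) / 3 := by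
      have : 1 + r * V k / (1 + r) = (r * V k + 1 + r) / (1 + r) := by field_simp; ring
      rw [this]
      field_simp
      ring
    rw [e]
    refine (min_le_right _ _).trans ?_
    linarith [le_max_left (s k * (r * V k)) (s k * r)]

theorem exists_state_up_two (k : ℕ) : ∃ i x, x = blockState r U V t s k i ∧
    InRange r U V t s k i (s k * (r * (V k + 2)) / 3) ∧
    (1 - 3 / (V k + 2)) * (s k * (r * (V k + 2)) / 3) ≤
      -min (x.1 + x.2.2 - 2 * (s k * (r * (V k + 2)) / 3))
        (s k * (r * (V k + 2)) / 3 - max x.1 x.2.2) -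
      max (x.1 + x.2.2 - 2 * (s k * (r * (V k + 2)) / 3))
        (s k * (r * (V k + 2)) / 3 - min x.1 x.2.2) := by
  obtain ⟨hr, hU, hV⟩ := h.one_le k
  have hs := h.s_pos k
  have hsr : s k ≤ s k * r := le_mul_of_one_le_right hs.le hr
  have hsrV : s k * r ≤ s k * (r * V k) :=
    mul_le_mul_of_nonneg_left (le_mul_of_one_le_right (by linarith) hV) hs.le
  refine ⟨1, _, rfl, ⟨by omega, ?_, ?_⟩, ?_⟩
  · simp only [blockState, tripleSum, cycle_one, Prod.smul_mk, smul_eq_mul]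
    linarith
  · simp only [blockState, tripleSum]
    rw [show 1 + 1 = 0 + 2 from rfl, cycle_add_two _ _ _ _ _ (Nat.zero_le _),
      glide_zero (h.cycleParams k).le_V]
    have := mul_le_mul_of_nonneg_left (le_glide (h.cycleParams k).le_V (by linarith)
      (h.cycleParams k).one_le_t (0 + 1)) hs.le
    simp only [Prod.smul_mk, smul_eq_mul]
    linarith
  · simp only [blockState, cycle_one, Prod.smul_mk, smul_eq_mul]
    have e : (1 - 3 / (V k + 2)) * (s k * (r * (V k + 2)) / 3) =
        s k * (r * V k) / 3 - s k * r / 3 := by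
      field_simp
      ring
    rw [e, max_eq_left hsrV, min_eq_right hsrV]
    have h1 := min_le_right (s k * (r * V k) + s k * r - 2 * (s k * (r * (V k + 2)) / 3))
      (s k * (r * (V k + 2)) / 3 - s k * (r * V k))
    have h2 : max (s k * (r * V k) + s k * r - 2 * (s k * (r * (V k + 2)) / 3))
        (s k * (r * (V k + 2)) / 3 - s k * r) ≤ s k * (r * V k) / 3 - s k * r / 3 :=
      max_le (by linarith) (by linarith)
    linarith

theorem exists_state_low_two (k : ℕ) : ∃ i x, x = blockState r U V t s k i ∧
    InRange r U V t s k i (s k * (V k * (1 + 2 * U k)) / 3) ∧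
    -min (x.1 + x.2.2 - 2 * (s k * (V k * (1 + 2 * U k)) / 3))
        (s k * (V k * (1 + 2 * U k)) / 3 - max x.1 x.2.2) -
      max (x.1 + x.2.2 - 2 * (s k * (V k * (1 + 2 * U k)) / 3))
        (s k * (V k * (1 + 2 * U k)) / 3 - min x.1 x.2.2) ≤
      (-2 + 3 / ((1 + 2 * U k) / (1 + U k))) * (s k * (V k * (1 + 2 * U k)) / 3) := by
  obtain ⟨hr, hU, hV⟩ := h.one_le k
  have hs := h.s_pos k
  have ht := (h.cycleParams k).one_le_t
  have hsV : 0 < s k * V k := mul_pos hs (by linarith)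
  have hsU : s k * V k ≤ s k * V k * U k := le_mul_of_one_le_right hsV.le hU
  have e1 : blockState r U V t s k (2 * k + 5) =
      (s k * V k * U k, s k * V k * glide r (U k) (t k) k, s k * V k) := by
    rw [blockState, show 2 * k + 5 = (k + 1) + 3 + (k + 1) by omega,
      cycle_glide _ _ _ _ _ le_rfl, glide_eq (by linarith) ht (h.U_le k) le_rfl]
    simp [mul_assoc]
  have e2 : blockState r U V t s k (2 * k + 5 + 1) =
      (s k * V k * (r * U k), s k * V k, s k * V k * U k) := by
    rw [blockState, show 2 * k + 5 + 1 = 2 * (k + 1) + 4 by omega, cycle_penultimate]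
    simp [mul_assoc]
  refine ⟨2 * k + 5, _, rfl, ⟨by omega, ?_, ?_⟩, ?_⟩
  · rw [e1]
    simp only [tripleSum]
    linarith [mul_le_mul_of_nonneg_left (glide_le r (U k) (t k) k) hsV.le]
  · rw [e2]
    simp only [tripleSum]
    linarith [mul_le_mul_of_nonneg_left
      (le_mul_of_one_le_left (by linarith) hr : U k ≤ r * U k) hsV.le]
  · rw [e1]
    dsimp only
    have e : (-2 + 3 / ((1 + 2 * U k) / (1 + U k))) * (s k * (V k * (1 + 2 * U k)) / 3) =
        s k * V k / 3 - s k * V k * U k / 3 := by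
      field_simp
      ring
    rw [e, max_eq_left hsU, min_eq_right hsU]
    have h1 := le_max_right (s k * V k * U k + s k * V k - 2 * (s k * (V k * (1 + 2 * U k)) / 3))
      (s k * (V k * (1 + 2 * U k)) / 3 - s k * V k)
    have h2 : s k * V k / 3 - s k * V k * U k / 3 ≤
        min (s k * V k * U k + s k * V k - 2 * (s k * (V k * (1 + 2 * U k)) / 3))
          (s k * (V k * (1 + 2 * U k)) / 3 - s k * V k * U k) :=
      le_min (by linarith) (by linarith)
    linarith

theorem exists_state_up_three (k : ℕ) : ∃ i x, x = blockState r U V t s k i ∧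
    InRange r U V t s k i (s k * (V k * (1 + U k * (1 + r))) / 3) ∧
    (1 - 3 / (1 + U k * (1 + r))) * (s k * (V k * (1 + U k * (1 + r))) / 3) ≤
      max (x.1 + x.2.2 - 2 * (s k * (V k * (1 + U k * (1 + r))) / 3))
        (s k * (V k * (1 + U k * (1 + r))) / 3 - min x.1 x.2.2) := by
  obtain ⟨hr, hU, hV⟩ := h.one_le k
  have e1 : blockState r U V t s k (2 * k + 6) =
      (s k * V k * (r * U k), s k * V k, s k * V k * U k) := by
    rw [blockState, show 2 * k + 6 = 2 * (k + 1) + 4 by omega, cycle_penultimate]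
    simp [mul_assoc]
  have e2 : 3 * (s k * (V k * (1 + U k * (1 + r))) / 3) =
      tripleSum (blockState r U V t s k (2 * k + 6)) := by
    rw [e1]
    simp only [tripleSum]
    ring
  refine ⟨2 * k + 6, _, rfl, ⟨by omega, e2.ge, ?_⟩, ?_⟩
  · rw [e2]
    exact (h.goodStep (by omega : 2 * k + 6 < 2 * k + 7)).1.sum_le
  · rw [e1]
    dsimp only
    refine le_trans (le_of_eq ?_) (le_max_left _ _)
    field_simp
    ring

/-- The spectrum of the point attached to an infinite concatenation of cycles. -/
theorem exists_spectrum (ht : Tendsto t atTop (𝓝 1)) {x₁ x₂ y₂ y₃ : ℝ}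
    (h1 : Tendsto (fun k => 3 / (1 + r * V k / (1 + r))) atTop (𝓝 (x₁ + 2)))
    (h2 : Tendsto (fun k => 3 / ((1 + 2 * U k) / (1 + U k))) atTop (𝓝 (x₂ + 2)))
    (h2' : Tendsto (fun k => 3 / (V k + 2)) atTop (𝓝 (1 - y₂)))
    (h3 : Tendsto (fun k => 3 / (1 + U k * (1 + r))) atTop (𝓝 (1 - y₃))) :
    ∃ ξ₁ ξ₂ : ℝ, LinearIndependent ℚ ![(1 : ℝ), ξ₁, ξ₂] ∧
      phiLow ξ₁ ξ₂ 1 = x₁ ∧ phiUp ξ₁ ξ₂ 1 = (1 - r) / (1 + 2 * r) ∧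
      phiLow ξ₁ ξ₂ 3 = (r - 1) / (r + 2) ∧ phiUp ξ₁ ξ₂ 3 = y₃ ∧
      phiLow ξ₁ ξ₂ 2 = x₂ ∧ phiUp ξ₁ ξ₂ 2 = y₂ := by
  obtain ⟨ξ₁, ξ₂, hli, H⟩ := h.exists_approx
  have hdiv : ∀ {f : ℕ → ℝ} {x : ℝ}, Tendsto (fun k => 3 / f k) atTop (𝓝 x) →
      Tendsto (fun k => 3 / (t k * f k)) atTop (𝓝 x) := fun {f x} hf => by
    have := (ht.inv₀ one_ne_zero).mul hf
    rw [inv_one, one_mul] at this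
    refine this.congr fun k => ?_
    rw [← div_div, inv_mul_eq_div, div_right_comm]
  have hadd : ∀ {f : ℕ → ℝ} {x : ℝ}, Tendsto f atTop (𝓝 (x + 2)) →
      Tendsto (fun k => -2 + f k) atTop (𝓝 x) := fun {f x} hf => by
    simpa using hf.const_add (-2)
  have hsub : ∀ {f : ℕ → ℝ} {x : ℝ}, Tendsto f atTop (𝓝 (1 - x)) →
      Tendsto (fun k => 1 - f k) atTop (𝓝 x) := fun {f x} hf => by
    simpa using hf.const_sub 1
  have hP : ∀ K, ∃ Q, ∀ q ≥ Q, ∃ k ≥ K, ∃ i, InRange r U V t s k i q := fun K =>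
    (h.exists_interval K).imp fun Q hQ q hq => by
      obtain ⟨k, hk, i, hi, hi'⟩ := hQ q hq
      exact ⟨k, hk, i, hi, hi'⟩
  have hr := (h.one_le 0).1
  have hp : ∀ {f : ℕ → ℝ}, (∀ k, 1 ≤ f k) → Tendsto (fun k => s k * f k / 3) atTop atTop :=
    fun {f} hf => h.tendsto_of_le fun k => by
      linarith [le_mul_of_one_le_right (h.s_pos k).le (hf k)]
  refine ⟨ξ₁, ξ₂, hli, ?_, ?_, ?_, ?_, ?_, ?_⟩
  · refine liminf_div_eq hP (hp (f := fun k => r * V k + 1 + r) fun k => ?_) (hadd (hdiv h1))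
      (hadd h1) fun ε hε => ?_
    · nlinarith [h.one_le k]
    obtain ⟨C, hC⟩ := H ε hε
    refine ⟨C, fun k q ⟨i, hi⟩ => ?_, fun k => ?_⟩
    · have b := (h.bounds hi rfl).1.1
      have a := abs_sub_le_iff.1 (hC k i hi.1 q _ rfl hi.2.1 hi.2.2).1
      linarith [a.2]
    · obtain ⟨i, x, hx, hi, b⟩ := h.exists_state_low_one k
      have a := abs_sub_le_iff.1 (hC k i hi.1 _ x hx (hx ▸ hi.2.1) hi.2.2).1
      linarith [a.1]
  · refine limsup_div_eq hP (hp (f := fun k => 1 + 2 * r) fun k => by linarith)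
      tendsto_const_nhds tendsto_const_nhds fun ε hε => ?_
    obtain ⟨C, hC⟩ := H ε hε
    refine ⟨C, fun k q ⟨i, hi⟩ => ?_, fun k => ?_⟩
    · have b := (h.bounds hi rfl).1.2
      have a := abs_sub_le_iff.1 (hC k i hi.1 q _ rfl hi.2.1 hi.2.2).1
      linarith [a.1]
    · obtain ⟨i, x, hx, hi, b⟩ := h.exists_state_up_one k
      have a := abs_sub_le_iff.1 (hC k i hi.1 _ x hx (hx ▸ hi.2.1) hi.2.2).1
      linarith [a.2]
  · refine liminf_div_eq hP (hp (f := fun k => r + 2) fun k => by linarith)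
      tendsto_const_nhds tendsto_const_nhds fun ε hε => ?_
    obtain ⟨C, hC⟩ := H ε hε
    refine ⟨C, fun k q ⟨i, hi⟩ => ?_, fun k => ?_⟩
    · have b := (h.bounds hi rfl).2.2.1
      have a := abs_sub_le_iff.1 (hC k i hi.1 q _ rfl hi.2.1 hi.2.2).2.2
      linarith [a.2]
    · obtain ⟨i, x, hx, hi, b⟩ := h.exists_state_low_three k
      have a := abs_sub_le_iff.1 (hC k i hi.1 _ x hx (hx ▸ hi.2.1) hi.2.2).2.2
      linarith [a.1]
  · refine limsup_div_eq hP (hp (f := fun k => V k * (1 + U k * (1 + r))) fun k => ?_)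
      (hsub (hdiv h3)) (hsub h3) fun ε hε => ?_
    · obtain ⟨-, hU, hV⟩ := h.one_le k
      exact one_le_mul_of_one_le_of_one_le hV (le_add_of_nonneg_right (by positivity))
    obtain ⟨C, hC⟩ := H ε hε
    refine ⟨C, fun k q ⟨i, hi⟩ => ?_, fun k => ?_⟩
    · have b := (h.bounds hi rfl).2.2.2
      have a := abs_sub_le_iff.1 (hC k i hi.1 q _ rfl hi.2.1 hi.2.2).2.2
      linarith [a.1]
    · obtain ⟨i, x, hx, hi, b⟩ := h.exists_state_up_three k
      have a := abs_sub_le_iff.1 (hC k i hi.1 _ x hx (hx ▸ hi.2.1) hi.2.2).2.2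
      linarith [a.2]
  · refine liminf_div_eq hP (hp (f := fun k => V k * (1 + 2 * U k)) fun k => ?_)
      (hadd (hdiv h2)) (hadd h2) fun ε hε => ?_
    · obtain ⟨-, hU, hV⟩ := h.one_le k
      exact one_le_mul_of_one_le_of_one_le hV (le_add_of_nonneg_right (by positivity))
    obtain ⟨C, hC⟩ := H ε hε
    refine ⟨C, fun k q ⟨i, hi⟩ => ?_, fun k => ?_⟩
    · have b := (h.bounds hi rfl).2.1.1
      have a := abs_sub_le_iff.1 (hC k i hi.1 q _ rfl hi.2.1 hi.2.2).2.1
      linarith [a.2]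
    · obtain ⟨i, x, hx, hi, b⟩ := h.exists_state_low_two k
      have a := abs_sub_le_iff.1 (hC k i hi.1 _ x hx (hx ▸ hi.2.1) hi.2.2).2.1
      linarith [a.1]
  · refine limsup_div_eq hP (hp (f := fun k => r * (V k + 2)) fun k => ?_)
      (hsub (hdiv h2')) (hsub h2') fun ε hε => ?_
    · obtain ⟨-, hU, hV⟩ := h.one_le k
      exact one_le_mul_of_one_le_of_one_le hr (by linarith)
    obtain ⟨C, hC⟩ := H ε hε
    refine ⟨C, fun k q ⟨i, hi⟩ => ?_, fun k => ?_⟩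
    · have b := (h.bounds hi rfl).2.1.2
      have a := abs_sub_le_iff.1 (hC k i hi.1 q _ rfl hi.2.1 hi.2.2).2.1
      linarith [a.1]
    · obtain ⟨i, x, hx, hi, b⟩ := h.exists_state_up_two k
      have a := abs_sub_le_iff.1 (hC k i hi.1 _ x hx (hx ▸ hi.2.1) hi.2.2).2.1
      linarith [a.2]

end BlockParams

theorem le_of_mul_add_le {r U V : ℝ} (hr : 1 ≤ r) (hU : 0 ≤ U) (h2 : r * V + r ≤ U * (1 + r))
    (h1 : U * (1 + r) ≤ V * (1 + U)) : r ≤ U ∧ r ≤ V := by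
  have hrU : r ≤ U := by
    have h3 : 0 ≤ (U - r) * ((1 + r) * U + 1) := by
      nlinarith [mul_le_mul_of_nonneg_left h1 (by linarith : 0 ≤ r),
        mul_le_mul_of_nonneg_right h2 (by linarith : 0 ≤ 1 + U)]
    have := nonneg_of_mul_nonneg_left h3 (by positivity)
    linarith
  refine ⟨hrU, le_of_mul_le_mul_right (a := 1 + U) ?_ (by linarith)⟩
  linarith

/-- The ratio between the lowest slopes of the third minimum. -/
noncomputable def ratioOf (a : ℝ) : ℝ := (1 + 2 * a) / (1 - a)

/-- The growth factor determining the upper slope `A` of the third minimum. -/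
noncomputable def factorThree (a A : ℝ) : ℝ := (2 + A) * (1 - a) / ((1 - A) * (2 + a))

/-- The growth factor determining the lower slope `b` of the first minimum. -/
noncomputable def factorOne (a b : ℝ) : ℝ := (1 - b) * (2 + a) / ((2 + b) * (1 + 2 * a))

/-- The constraints on the slopes `b`, `A`, with respect to a fixed slope `a`. -/
structure AdmissibleSlopes (a b A : ℝ) : Prop where
  le : a ≤ A
  lt_one : A < 1
  neg_two_lt : -2 < b
  ineq_one : b * (2 + a) ≤ -(A * (1 + 2 * a) + 3 * a)
  ineq_three : 3 * a ≤ A * (2 + a) + b * (1 - a)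

theorem one_le_ratioOf {a : ℝ} (ha : 0 ≤ a) (ha' : a < 1) : 1 ≤ ratioOf a := by
  rw [ratioOf, le_div_iff₀ (by linarith)]; linarith

theorem AdmissibleSlopes.cycleParams {a b A t : ℝ} (h : AdmissibleSlopes a b A) (ha : 0 ≤ a)
    (ha' : a < 1) (ht : 1 ≤ t) :
    CycleParams (ratioOf a) (factorThree a A) (factorOne a b) t := by
  obtain ⟨h1, h2, h3, h4, h5⟩ := h
  have p1 : 0 < 1 - a := by linarith
  have p2 : 0 < 1 - A := by linarith
  have p3 : 0 < 2 + b := by linarith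
  have p4 : 0 < 2 + a := by linarith
  have p5 : 0 < 1 + 2 * a := by linarith
  have p6 : 0 < 2 + A := by linarith
  have hr := one_le_ratioOf ha ha'
  have hU : 0 ≤ factorThree a A := by unfold factorThree; positivity
  have e1 : 1 + ratioOf a = (2 + a) / (1 - a) := by
    rw [ratioOf]; field_simp; ring
  have e2 : factorThree a A * (1 + ratioOf a) = (2 + A) / (1 - A) := by
    rw [e1, factorThree]; field_simp
  have e3 : ratioOf a * factorOne a b + ratioOf a =
      (3 * (2 + a) - (1 - a) * (2 + b)) / ((1 - a) * (2 + b)) := by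
    rw [ratioOf, factorOne]; field_simp; ring
  have e4 : factorOne a b * (1 + factorThree a A) =
      (1 - b) * (4 - a - A - 2 * (a * A)) / ((2 + b) * (1 + 2 * a) * (1 - A)) := by
    rw [factorOne, factorThree]; field_simp; ring
  have k2 : ratioOf a * factorOne a b + ratioOf a ≤ factorThree a A * (1 + ratioOf a) := by
    rw [e2, e3, div_le_div_iff₀ (by positivity) p2]
    nlinarith
  have k1 : factorThree a A * (1 + ratioOf a) ≤ factorOne a b * (1 + factorThree a A) := by
    rw [e2, e4, div_le_div_iff₀ p2 (by positivity)]
    have h6 : (2 + A) * ((2 + b) * (1 + 2 * a)) ≤ (1 - b) * (4 - a - A - 2 * (a * A)) := by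
      nlinarith
    nlinarith [mul_le_mul_of_nonneg_right h6 p2.le]
  obtain ⟨k3, k4⟩ := le_of_mul_add_le hr hU k2 k1
  exact ⟨hr, k3, k4, k2, k1, ht⟩

theorem AdmissibleSlopes.le_factorThree {a b A : ℝ} (h : AdmissibleSlopes a b A) (ha : 0 ≤ a) :
    1 + (A - a) ≤ factorThree a A := by
  obtain ⟨h1, h2, -⟩ := h
  rw [factorThree, le_div_iff₀ (mul_pos (by linarith) (by linarith))]
  have h3 : (1 - A) * (2 + a) ≤ 2 := by nlinarith
  nlinarith [mul_le_mul_of_nonneg_left h3 (by linarith : 0 ≤ A - a)]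

theorem AdmissibleSlopes.factorThree_le {a b A : ℝ} (h : AdmissibleSlopes a b A) (ha : 0 ≤ a) :
    factorThree a A ≤ 3 / (1 - A) := by
  obtain ⟨h1, h2, -⟩ := h
  rw [factorThree, div_le_div_iff₀ (mul_pos (by linarith) (by linarith)) (by linarith)]
  have : (2 + A) * (1 - a) ≤ 3 * (2 + a) := by nlinarith
  nlinarith

theorem AdmissibleSlopes.factorOne_le {a b A : ℝ} (h : AdmissibleSlopes a b A) (ha : 0 ≤ a) :
    factorOne a b ≤ 6 / (2 + b) := by
  obtain ⟨h1, h2, h3, -⟩ := h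
  rw [factorOne, div_le_div_iff₀ (mul_pos (by linarith) (by linarith)) (by linarith)]
  have : (1 - b) * (2 + a) ≤ 6 * (1 + 2 * a) := by nlinarith
  nlinarith

theorem AdmissibleSlopes.three_div_one {a b A : ℝ} (h : AdmissibleSlopes a b A) (ha : 0 ≤ a)
    (ha' : a < 1) : 3 / (1 + ratioOf a * factorOne a b / (1 + ratioOf a)) = b + 2 := by
  have p1 : 0 < 1 - a := by linarith
  have p3 : 0 < 2 + b := by linarith [h.neg_two_lt]
  have e1 : 1 + ratioOf a = (2 + a) / (1 - a) := by
    rw [ratioOf]; field_simp; ring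
  have e2 : 1 + ratioOf a * factorOne a b / (1 + ratioOf a) = 3 / (2 + b) := by
    rw [e1, ratioOf, factorOne]; field_simp; ring
  rw [e2]; field_simp; ring

theorem AdmissibleSlopes.three_div_three {a b A : ℝ} (h : AdmissibleSlopes a b A) (ha : 0 ≤ a)
    (ha' : a < 1) : 3 / (1 + factorThree a A * (1 + ratioOf a)) = 1 - A := by
  have p1 : 0 < 1 - a := by linarith
  have p2 : 0 < 1 - A := by linarith [h.lt_one]
  have e1 : 1 + ratioOf a = (2 + a) / (1 - a) := by
    rw [ratioOf]; field_simp; ring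
  have e2 : 1 + factorThree a A * (1 + ratioOf a) = 3 / (1 - A) := by
    rw [e1, factorThree]; field_simp; ring
  rw [e2]; field_simp

theorem AdmissibleSlopes.three_div_two {a b A : ℝ} (h : AdmissibleSlopes a b A) (ha : 0 ≤ a) :
    3 / ((1 + 2 * factorThree a A) / (1 + factorThree a A)) =
      (4 - a - A - 2 * (a * A)) / (2 - a - A * a) := by
  have p2 : 0 < 1 - A := by linarith [h.lt_one]
  have hA := h.le
  have p7 : 0 < 2 - a - A * a := by nlinarith
  have p8 : 0 < 4 - a - A - 2 * (a * A) := by nlinarith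
  have e1 : 1 + 2 * factorThree a A = 3 * (2 - a - A * a) / ((1 - A) * (2 + a)) := by
    rw [factorThree]; field_simp; ring
  have e2 : 1 + factorThree a A = (4 - a - A - 2 * (a * A)) / ((1 - A) * (2 + a)) := by
    rw [factorThree]; field_simp; ring
  rw [e1, e2]; field_simp

theorem AdmissibleSlopes.three_div_two' {a b A : ℝ} (h : AdmissibleSlopes a b A) (ha : 0 ≤ a) :
    3 / (factorOne a b + 2) = (2 + b) * (1 + 2 * a) / (2 + 3 * a + a * b) := by
  have p3 : 0 < 2 + b := by linarith [h.neg_two_lt]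
  have p7 : 0 < 2 + 3 * a + a * b := by nlinarith
  have e1 : factorOne a b + 2 = 3 * (2 + 3 * a + a * b) / ((2 + b) * (1 + 2 * a)) := by
    rw [factorOne]; field_simp; ring
  rw [e1]; field_simp

/-- An upper slope used to perturb the boundary cases. -/
noncomputable def baseThree (a : ℝ) : ℝ := 1 - (1 - a) ^ 2 / 3

/-- The corresponding lower slope. -/
noncomputable def baseOne (a : ℝ) : ℝ := -(baseThree a * (1 + 2 * a) + 3 * a) / (2 + a)

theorem admissibleSlopes_base {a : ℝ} (ha : 0 ≤ a) (ha' : a < 1) :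
    AdmissibleSlopes a (baseOne a) (baseThree a) := by
  have hsq : 0 < (1 - a) ^ 2 := pow_pos (by linarith) 2
  have e : baseOne a * (2 + a) = -(baseThree a * (1 + 2 * a) + 3 * a) := by
    rw [baseOne]; field_simp
  have hb : baseThree a < 1 := by unfold baseThree; linarith
  refine ⟨by unfold baseThree; nlinarith, hb, ?_, e.le, ?_⟩
  · have : -2 * (2 + a) < baseOne a * (2 + a) := by rw [e]; nlinarith
    exact lt_of_mul_lt_mul_right this (by linarith)
  · refine le_of_mul_le_mul_right (a := 2 + a) ?_ (by linarith)
    have h1 : 3 * a ≤ baseThree a * (1 + a + a ^ 2) := by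
      unfold baseThree
      have : (1 - a) ^ 2 * (1 + a + a ^ 2) ≤ (1 - a) ^ 2 * 3 :=
        mul_le_mul_of_nonneg_left (by nlinarith) hsq.le
      nlinarith
    calc 3 * a * (2 + a) ≤ baseThree a * (2 + a) * (2 + a) +
        -(baseThree a * (1 + 2 * a) + 3 * a) * (1 - a) := by nlinarith
      _ = _ := by rw [← e]; ring

theorem AdmissibleSlopes.mix {a b A b' A' w : ℝ} (h' : AdmissibleSlopes a b' A')
    (h1 : a ≤ A) (h2 : A ≤ 1) (h3 : -2 ≤ b) (h4 : b * (2 + a) ≤ -(A * (1 + 2 * a) + 3 * a))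
    (h5 : 3 * a ≤ A * (2 + a) + b * (1 - a)) (hw : 0 < w) (hw' : w ≤ 1) :
    AdmissibleSlopes a ((1 - w) * b + w * b') ((1 - w) * A + w * A') := by
  obtain ⟨k1, k2, k3, k4, k5⟩ := h'
  have hw1 : 0 ≤ 1 - w := by linarith
  refine ⟨?_, ?_, ?_, ?_, ?_⟩
  · linarith [mul_le_mul_of_nonneg_left h1 hw1, mul_le_mul_of_nonneg_left k1 hw.le]
  · linarith [mul_le_mul_of_nonneg_left h2 hw1, mul_lt_mul_of_pos_left k2 hw]
  · linarith [mul_le_mul_of_nonneg_left h3 hw1, mul_lt_mul_of_pos_left k3 hw]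
  · linarith [mul_le_mul_of_nonneg_left h4 hw1, mul_le_mul_of_nonneg_left k4 hw.le]
  · linarith [mul_le_mul_of_nonneg_left h5 hw1, mul_le_mul_of_nonneg_left k5 hw.le]

section

open Topology

/-- The weight of the perturbation in the `k`-th cycle. -/
noncomputable def weight (W : ℝ) (k : ℕ) : ℝ := W / (k + W)

theorem weight_pos {W : ℝ} (hW : 1 ≤ W) (k : ℕ) : 0 < weight W k :=
  div_pos (by linarith) (by positivity)

theorem weight_le_one {W : ℝ} (hW : 1 ≤ W) (k : ℕ) : weight W k ≤ 1 := by
  rw [weight, div_le_one (by positivity)]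
  linarith [(Nat.cast_nonneg k : (0 : ℝ) ≤ k)]

theorem one_div_le_weight {W : ℝ} (hW : 1 ≤ W) (k : ℕ) : 1 / ((k : ℝ) + 1) ≤ weight W k := by
  rw [weight, div_le_div_iff₀ (by positivity) (by positivity)]
  nlinarith [(Nat.cast_nonneg k : (0 : ℝ) ≤ k)]

theorem tendsto_weight (W : ℝ) : Tendsto (weight W) atTop (𝓝 0) :=
  tendsto_const_nhds.div_atTop
    (tendsto_atTop_add_const_right _ W tendsto_natCast_atTop_atTop)

theorem tendsto_mix (W x y : ℝ) :
    Tendsto (fun k => (1 - weight W k) * x + weight W k * y) atTop (𝓝 x) := by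
  have h := tendsto_weight W
  simpa using ((h.const_sub 1).mul_const x).add (h.mul_const y)

theorem tendsto_exp_log_div {B : ℝ} {u : ℕ → ℝ} (hu : ∀ k, 1 ≤ u k)
    (hB : ∀ k : ℕ, u k ≤ B * ((k : ℝ) + 1) ^ 2) :
    Tendsto (fun k : ℕ => Real.exp (Real.log (u k) / ((k : ℝ) + 1))) atTop (𝓝 1) := by
  have hB0 : 0 < B := by
    have := (hu 0).trans (hB 0)
    norm_num at this
    linarith
  suffices H : Tendsto (fun k : ℕ => Real.log (u k) / ((k : ℝ) + 1)) atTop (𝓝 0) by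
    have := (Real.continuous_exp.tendsto 0).comp H
    rwa [Real.exp_zero] at this
  have hk : Tendsto (fun k : ℕ => (k : ℝ) + 1) atTop atTop :=
    tendsto_atTop_add_const_right _ 1 tendsto_natCast_atTop_atTop
  have h1 : Tendsto (fun k : ℕ => Real.log B / ((k : ℝ) + 1)) atTop (𝓝 0) :=
    tendsto_const_nhds.div_atTop hk
  have h2 : Tendsto (fun k : ℕ => 2 * (Real.log ((k : ℝ) + 1) / ((k : ℝ) + 1))) atTop (𝓝 0) := by
    have := (Real.tendsto_pow_log_div_mul_add_atTop 1 0 1 one_ne_zero).comp hk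
    simpa using this.const_mul 2
  have h3 := h1.add h2
  rw [add_zero] at h3
  refine squeeze_zero (fun k => ?_) (fun k => ?_) h3
  · exact div_nonneg (Real.log_nonneg (hu k)) (by positivity)
  · have h4 : Real.log (u k) ≤ Real.log B + 2 * Real.log ((k : ℝ) + 1) := by
      have := Real.log_le_log (by linarith [hu k]) (hB k)
      rwa [Real.log_mul hB0.ne' (by positivity), Real.log_pow, Nat.cast_ofNat] at this
    calc Real.log (u k) / ((k : ℝ) + 1)
        ≤ (Real.log B + 2 * Real.log ((k : ℝ) + 1)) / ((k : ℝ) + 1) := by gcongr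
      _ = _ := by ring

theorem exp_log_div_pow {u : ℝ} (hu : 0 < u) (k : ℕ) :
    Real.exp (Real.log u / ((k : ℝ) + 1)) ^ (k + 1) = u := by
  rw [← Real.exp_nat_mul, Nat.cast_add_one, mul_div_cancel₀ _ (by positivity), Real.exp_log hu]

/-- The scaling factors of consecutive cycles. -/
noncomputable def scaling (s₀ : ℝ) (u : ℕ → ℝ) : ℕ → ℝ
  | 0 => s₀
  | k + 1 => scaling s₀ u k * u k

theorem add_pow_three_le_scaling {W : ℝ} (hW : 1 ≤ W) {u : ℕ → ℝ}
    (hu : ∀ k : ℕ, 1 + 7 / ((k : ℝ) + W) ≤ u k) (k : ℕ) :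
    ((k : ℝ) + W) ^ 3 ≤ scaling (W ^ 3) u k := by
  induction k with
  | zero => simp [scaling]
  | succ k ih =>
    have hx : 1 ≤ (k : ℝ) + W := by linarith [(Nat.cast_nonneg k : (0 : ℝ) ≤ k)]
    have h7 : 0 ≤ 7 / ((k : ℝ) + W) := by positivity
    calc ((k + 1 : ℕ) + W) ^ 3 = ((k : ℝ) + W + 1) ^ 3 := by push_cast; ring
      _ ≤ ((k : ℝ) + W) ^ 3 * (1 + 7 / ((k : ℝ) + W)) := by
        have : ((k : ℝ) + W) ^ 3 * (1 + 7 / ((k : ℝ) + W)) =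
            ((k : ℝ) + W) ^ 3 + 7 * ((k : ℝ) + W) ^ 2 := by field_simp
        rw [this]
        nlinarith
      _ ≤ scaling (W ^ 3) u k * u k :=
        mul_le_mul ih (hu k) (by linarith) ((by positivity : 0 ≤ ((k : ℝ) + W) ^ 3).trans ih)

theorem exists_spectrum_of_slopes {a b A : ℝ} (ha : 0 ≤ a) (ha' : a < 1) (h1 : a ≤ A)
    (h2 : A ≤ 1) (h3 : -2 ≤ b) (h4 : b * (2 + a) ≤ -(A * (1 + 2 * a) + 3 * a))
    (h5 : 3 * a ≤ A * (2 + a) + b * (1 - a)) :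
    ∃ ξ₁ ξ₂ : ℝ, LinearIndependent ℚ ![(1 : ℝ), ξ₁, ξ₂] ∧
      phiLow ξ₁ ξ₂ 1 = b ∧ phiUp ξ₁ ξ₂ 1 = (1 - ratioOf a) / (1 + 2 * ratioOf a) ∧
      phiLow ξ₁ ξ₂ 3 = (ratioOf a - 1) / (ratioOf a + 2) ∧ phiUp ξ₁ ξ₂ 3 = A ∧
      phiLow ξ₁ ξ₂ 2 = (4 - a - A - 2 * (a * A)) / (2 - a - A * a) - 2 ∧
      phiUp ξ₁ ξ₂ 2 = 1 - (2 + b) * (1 + 2 * a) / (2 + 3 * a + a * b) := by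
  have h0 := admissibleSlopes_base ha ha'
  set δ := baseThree a - a with hδ
  have hδ0 : 0 < δ := by
    have : δ = (1 - a) * (2 + a) / 3 := by rw [hδ, baseThree]; ring
    rw [this]
    exact div_pos (mul_pos (by linarith) (by linarith)) (by norm_num)
  set W := 7 / δ + 1 with hWdef
  have hW : 1 ≤ W := le_add_of_nonneg_left (by positivity)
  have hWδ : 7 ≤ W * δ := by
    have : W * δ = 7 + δ := by rw [hWdef]; field_simp
    linarith
  set bk := fun k => (1 - weight W k) * b + weight W k * baseOne a with hbk
  set Ak := fun k => (1 - weight W k) * A + weight W k * baseThree a with hAk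
  have hk : ∀ k, AdmissibleSlopes a (bk k) (Ak k) := fun k =>
    h0.mix h1 h2 h3 h4 h5 (weight_pos hW k) (weight_le_one hW k)
  have hb : Tendsto bk atTop (𝓝 b) := tendsto_mix W b _
  have hA : Tendsto Ak atTop (𝓝 A) := tendsto_mix W A _
  set U := fun k => factorThree a (Ak k) with hU
  set V := fun k => factorOne a (bk k) with hV
  have hr := one_le_ratioOf ha ha'
  have hone : ∀ k, 1 ≤ U k ∧ 1 ≤ V k := fun k => by
    have := (hk k).cycleParams ha ha' le_rfl
    exact ⟨hr.trans this.le_U, hr.trans this.le_V⟩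
  have hUV : ∀ k, 1 ≤ U k * V k := fun k =>
    one_le_mul_of_one_le_of_one_le (hone k).1 (hone k).2
  have hgrow : ∀ k : ℕ, 1 + 7 / ((k : ℝ) + W) ≤ U k * V k := fun k => by
    have hw : 7 / ((k : ℝ) + W) ≤ weight W k * δ := by
      rw [weight, div_mul_eq_mul_div]
      gcongr
    have hd : weight W k * δ ≤ Ak k - a := by
      simp only [hAk, hδ]
      nlinarith [mul_nonneg (sub_nonneg.2 (weight_le_one hW k)) (sub_nonneg.2 h1)]
    have := (hk k).le_factorThree ha
    have := le_mul_of_one_le_right (by linarith [(hone k).1] : 0 ≤ U k) (hone k).2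
    linarith
  have hUle : ∀ k : ℕ, U k ≤ 3 / (1 - baseThree a) * ((k : ℝ) + 1) := fun k => by
    have p : 0 < 1 - baseThree a := by linarith [h0.lt_one]
    have hw : 1 / ((k : ℝ) + 1) * (1 - baseThree a) ≤ 1 - Ak k := by
      have q1 := mul_le_mul_of_nonneg_right (one_div_le_weight hW k) p.le
      have q2 := mul_nonneg (sub_nonneg.2 (weight_le_one hW k)) (sub_nonneg.2 h2)
      simp only [hAk]
      linarith
    calc U k ≤ 3 / (1 - Ak k) := (hk k).factorThree_le ha
      _ ≤ 3 / (1 / ((k : ℝ) + 1) * (1 - baseThree a)) := by gcongr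
      _ = _ := by field_simp
  have hVle : ∀ k : ℕ, V k ≤ 6 / (2 + baseOne a) * ((k : ℝ) + 1) := fun k => by
    have p : 0 < 2 + baseOne a := by linarith [h0.neg_two_lt]
    have hw : 1 / ((k : ℝ) + 1) * (2 + baseOne a) ≤ 2 + bk k := by
      have q1 := mul_le_mul_of_nonneg_right (one_div_le_weight hW k) p.le
      have q2 := mul_nonneg (sub_nonneg.2 (weight_le_one hW k)) (by linarith : 0 ≤ 2 + b)
      simp only [hbk]
      linarith
    calc V k ≤ 6 / (2 + bk k) := (hk k).factorOne_le ha
      _ ≤ 6 / (1 / ((k : ℝ) + 1) * (2 + baseOne a)) := by gcongr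
      _ = _ := by field_simp
  have hB : ∀ k : ℕ, U k * V k ≤
      3 / (1 - baseThree a) * (6 / (2 + baseOne a)) * ((k : ℝ) + 1) ^ 2 := fun k => by
    have := mul_le_mul (hUle k) (hVle k) (by linarith [(hone k).2])
      ((by linarith [(hone k).1] : 0 ≤ U k).trans (hUle k))
    linarith
  set t := fun k : ℕ => Real.exp (Real.log (U k * V k) / ((k : ℝ) + 1)) with ht
  have htk : ∀ k, t k ^ (k + 1) = U k * V k := fun k => exp_log_div_pow (by linarith [hUV k]) k
  have ht1 : ∀ k, 1 ≤ t k := fun k =>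
    Real.one_le_exp (div_nonneg (Real.log_nonneg (hUV k)) (by positivity))
  have hs := add_pow_three_le_scaling hW hgrow
  have hP : BlockParams (ratioOf a) U V t (scaling (W ^ 3) fun k => U k * V k) := by
    refine ⟨fun k => (hk k).cycleParams ha ha' (ht1 k), fun k => ?_, fun k => ?_, fun k => rfl,
      fun k => le_trans ?_ (hs k), fun k => lt_of_lt_of_le (by positivity) (hs k)⟩
    · rw [htk]
      exact (le_mul_of_one_le_right (by linarith [(hone k).1]) (hone k).2).trans
        (le_mul_of_one_le_left (by linarith [hUV k]) hr)
    · rw [htk]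
      exact (le_mul_of_one_le_left (by linarith [(hone k).2]) (hone k).1).trans
        (le_mul_of_one_le_left (by linarith [hUV k]) hr)
    · exact pow_le_pow_left₀ (Nat.cast_nonneg k) (by linarith) 3
  refine hP.exists_spectrum (tendsto_exp_log_div hUV hB) ?_ ?_ ?_ ?_
  · exact (hb.add_const 2).congr fun k => ((hk k).three_div_one ha ha').symm
  · rw [sub_add_cancel]
    have hne : 2 - a - A * a ≠ 0 := by nlinarith
    exact (((tendsto_const_nhds.sub hA).sub ((hA.const_mul a).const_mul 2)).div
      (tendsto_const_nhds.sub (hA.mul_const a)) hne).congr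
      fun k => ((hk k).three_div_two ha).symm
  · rw [sub_sub_cancel]
    have hne : 2 + 3 * a + a * b ≠ 0 := by nlinarith
    exact (((hb.const_add 2).mul_const (1 + 2 * a)).div ((hb.const_mul a).const_add (2 + 3 * a))
      hne).congr fun k => ((hk k).three_div_two' ha).symm
  · exact (hA.const_sub 1).congr fun k => ((hk k).three_div_three ha ha').symm

end

/-- Schmidt–Summerer (optimality): given `a̲₁, ā₁, a̲₃, ā₃` with `0 ≤ a̲₃ < 1`,
`0 ≤ a̲₃ ≤ ā₃ ≤ 1`, `a̲₃ + a̲₃·ā₁ + ā₁ = 0`, `2a̲₁ + ā₃ ≤ -a̲₃(3 + a̲₁ + 2ā₃)` and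
`2ā₃ + a̲₁ ≥ -ā₁(3 + ā₃ + 2a̲₁)`, there exist `ξ₁, ξ₂` with `{1, ξ₁, ξ₂}` linearly
independent over `ℚ` realizing these four constants, together with
`φ̲₂ = (a̲₃ - ā₃)/(2 - a̲₃ - ā₃·a̲₃)` and `φ̄₂ = (ā₁ - a̲₁)/(2 - ā₁ - ā₁·a̲₁)`. -/
theorem schmidt_summerer_spectrum_optimal
    (a₁ A₁ a₃ A₃ : ℝ)
    (ha₃0 : 0 ≤ a₃) (ha₃1 : a₃ < 1) (h33 : a₃ ≤ A₃) (hA₃ : A₃ ≤ 1)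
    (heq : a₃ + a₃ * A₁ + A₁ = 0)
    (hineq1 : 2 * a₁ + A₃ ≤ -a₃ * (3 + a₁ + 2 * A₃))
    (hineq2 : 2 * A₃ + a₁ ≥ -A₁ * (3 + A₃ + 2 * a₁)) :
    ∃ ξ₁ ξ₂ : ℝ, LinearIndependent ℚ ![(1 : ℝ), ξ₁, ξ₂] ∧
      phiLow ξ₁ ξ₂ 1 = a₁ ∧ phiUp ξ₁ ξ₂ 1 = A₁ ∧
      phiLow ξ₁ ξ₂ 3 = a₃ ∧ phiUp ξ₁ ξ₂ 3 = A₃ ∧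
      phiLow ξ₁ ξ₂ 2 = (a₃ - A₃) / (2 - a₃ - A₃ * a₃) ∧
      phiUp ξ₁ ξ₂ 2 = (A₁ - a₁) / (2 - A₁ - A₁ * a₁) := by
  have p : 0 < 1 + a₃ := by linarith
  have p' : 0 < 1 - a₃ := by linarith
  have hA₁ : A₁ = -a₃ / (1 + a₃) := by
    rw [eq_div_iff p.ne']; linarith
  have e2 : A₃ * (2 + a₃) + a₁ * (1 - a₃) - 3 * a₃ =
      (1 + a₃) * (2 * A₃ + a₁ - -A₁ * (3 + A₃ + 2 * a₁)) := by
    rw [hA₁]; field_simp; ring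
  have h3 : 3 * a₃ ≤ A₃ * (2 + a₃) + a₁ * (1 - a₃) := by
    have := mul_nonneg p.le (sub_nonneg.2 hineq2)
    linarith
  have h2 : -2 ≤ a₁ := by
    refine le_of_mul_le_mul_right (a := 1 - a₃) ?_ p'
    nlinarith
  have h1 : a₁ * (2 + a₃) ≤ -(A₃ * (1 + 2 * a₃) + 3 * a₃) := by linarith
  obtain ⟨ξ₁, ξ₂, hli, k1, k2, k3, k4, k5, k6⟩ :=
    exists_spectrum_of_slopes ha₃0 ha₃1 h33 hA₃ h2 h1 h3
  refine ⟨ξ₁, ξ₂, hli, k1, k2.trans ?_, k3.trans ?_, k4, k5.trans ?_, k6.trans ?_⟩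
  · have e : 1 + 2 * ratioOf a₃ = 3 * (1 + a₃) / (1 - a₃) := by
      rw [ratioOf]; field_simp; ring
    rw [e, hA₁, ratioOf]
    field_simp
    ring
  · have e : ratioOf a₃ + 2 = 3 / (1 - a₃) := by
      rw [ratioOf]; field_simp; ring
    rw [e, ratioOf]
    field_simp
    ring
  · have hne : 2 - a₃ - A₃ * a₃ ≠ 0 := by nlinarith
    rw [eq_div_iff hne, sub_mul, div_mul_cancel₀ _ hne]
    ring
  · have hne : 2 + 3 * a₃ + a₃ * a₁ ≠ 0 := by nlinarith
    have e : 2 - A₁ - A₁ * a₁ = (2 + 3 * a₃ + a₃ * a₁) / (1 + a₃) := by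
      rw [hA₁]; field_simp; ring
    rw [e, div_div_eq_mul_div, eq_div_iff hne, sub_mul, div_mul_cancel₀ _ hne]
    linear_combination -heq
end

section
/- Let ξ₁, ξ₂ be real numbers such that {1, ξ₁, ξ₂} is linearly independent over ℚ and suppose φ̲₃ = 1. Then φ̄₂ = 1 and φ̄₁ = φ̲₂ = −1/2. -/
open Filter Pointwise

/-- The gauge of the box `Box q`, that is, the least `l ≥ 0` with `z ∈ l • Box q`. -/
noncomputable def boxGauge (q : ℝ) (z : Fin 3 → ℝ) : ℝ :=
  max (|z 0| * Real.exp (-(2 * q))) (max (|z 1| * Real.exp q) (|z 2| * Real.exp q))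

theorem boxGauge_le_iff {q l : ℝ} {z : Fin 3 → ℝ} :
    boxGauge q z ≤ l ↔ |z 0| ≤ l * Real.exp (2 * q) ∧ |z 1| ≤ l * Real.exp (-q) ∧
      |z 2| ≤ l * Real.exp (-q) := by
  simp only [boxGauge, max_le_iff, Real.exp_neg, ← div_eq_mul_inv,
    div_le_iff₀ (Real.exp_pos _), le_div_iff₀ (Real.exp_pos _)]

theorem boxGauge_nonneg (q : ℝ) (z : Fin 3 → ℝ) : 0 ≤ boxGauge q z :=
  le_max_of_le_left (by positivity)

theorem boxGauge_smul (q t : ℝ) (z : Fin 3 → ℝ) : boxGauge q (t • z) = |t| * boxGauge q z := by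
  simp only [boxGauge, Pi.smul_apply, smul_eq_mul, abs_mul, mul_assoc,
    mul_max_of_nonneg _ _ (abs_nonneg t)]

theorem mem_smul_Box {q l : ℝ} (hl : 0 < l) {z : Fin 3 → ℝ} :
    z ∈ l • Box q ↔ boxGauge q z ≤ l := by
  rw [Set.mem_smul_set_iff_inv_smul_mem₀ hl.ne', boxGauge_le_iff]
  simp only [Box, Set.mem_ofPred_eq, Pi.smul_apply, smul_eq_mul, abs_mul, abs_inv, abs_of_pos hl,
    inv_mul_le_iff₀ hl]

theorem boxGauge_add_one_le (q : ℝ) (z : Fin 3 → ℝ) :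
    boxGauge (q + 1) z ≤ Real.exp 1 * boxGauge q z := by
  obtain ⟨h0, h1, h2⟩ := boxGauge_le_iff.1 (le_refl (boxGauge q z))
  have hN := boxGauge_nonneg q z
  have e1 : Real.exp 1 * Real.exp (-(q + 1)) = Real.exp (-q) := by
    rw [← Real.exp_add]; ring_nf
  have e0 : Real.exp (2 * q) ≤ Real.exp 1 * Real.exp (2 * (q + 1)) := by
    rw [← Real.exp_add]; exact Real.exp_le_exp.2 (by linarith)
  refine boxGauge_le_iff.2 ⟨?_, ?_, ?_⟩
  · nlinarith
  · rw [mul_right_comm, e1, mul_comm]; exact h1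
  · rw [mul_right_comm, e1, mul_comm]; exact h2

theorem boxGauge_le_add_one (q : ℝ) (z : Fin 3 → ℝ) :
    boxGauge q z ≤ Real.exp 2 * boxGauge (q + 1) z := by
  obtain ⟨h0, h1, h2⟩ := boxGauge_le_iff.1 (le_refl (boxGauge (q + 1) z))
  have hN := boxGauge_nonneg (q + 1) z
  have e0 : Real.exp 2 * Real.exp (2 * q) = Real.exp (2 * (q + 1)) := by
    rw [← Real.exp_add]; ring_nf
  have e1 : Real.exp (-(q + 1)) ≤ Real.exp 2 * Real.exp (-q) := by
    rw [← Real.exp_add]; exact Real.exp_le_exp.2 (by linarith)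
  refine boxGauge_le_iff.2 ⟨?_, ?_, ?_⟩
  · rw [mul_right_comm, e0, mul_comm]; exact h0
  · nlinarith
  · nlinarith

section Lattice

variable {ξ₁ ξ₂ : ℝ}

theorem exp_neg_two_mul_le_boxGauge {q : ℝ} (hq : 0 ≤ q) {z : Fin 3 → ℝ}
    (hz : z ∈ LatticeSet ξ₁ ξ₂) (hz0 : z ≠ 0) : Real.exp (-(2 * q)) ≤ boxGauge q z := by
  obtain ⟨x, y₁, y₂, h0, h1, h2⟩ := hz
  have one_le (n : ℤ) (hn : n ≠ 0) : (1 : ℝ) ≤ |(n : ℝ)| := by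
    exact_mod_cast Int.one_le_abs hn
  have he : Real.exp (-(2 * q)) ≤ Real.exp q := Real.exp_le_exp.2 (by linarith)
  have hp := Real.exp_pos (-(2 * q))
  have hp' := Real.exp_pos q
  by_cases hx : x = 0
  · subst hx
    by_cases hy₁ : y₁ = 0
    · have hy₂ : y₂ ≠ 0 := by
        rintro rfl
        subst hy₁
        refine hz0 (funext fun i => ?_)
        fin_cases i <;> simp_all
      refine le_max_of_le_right (le_max_of_le_right ?_)
      have : 1 ≤ |z 2| := by simpa [h2] using one_le y₂ hy₂
      nlinarith
    · refine le_max_of_le_right (le_max_of_le_left ?_)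
      have : 1 ≤ |z 1| := by simpa [h1] using one_le y₁ hy₁
      nlinarith
  · refine le_max_of_le_left ?_
    have : 1 ≤ |z 0| := by simpa [h0] using one_le x hx
    nlinarith

theorem exists_linearIndependent_boxGauge_le (ξ₁ ξ₂ : ℝ) {q : ℝ} (hq : 0 ≤ q) :
    ∃ v : Fin 3 → (Fin 3 → ℝ), LinearIndependent ℝ v ∧
      ∀ i, v i ∈ LatticeSet ξ₁ ξ₂ ∧ boxGauge q (v i) ≤ Real.exp q := by
  have e0 : 1 ≤ Real.exp q * Real.exp (2 * q) := by
    rw [← Real.exp_add]; exact Real.one_le_exp (by linarith)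
  have e1 : Real.exp q * Real.exp (-q) = 1 := by rw [← Real.exp_add]; simp
  refine ⟨!![1, ξ₁ - round ξ₁, ξ₂ - round ξ₂; 0, -1, 0; 0, 0, -1], ?_, ?_⟩
  · apply Matrix.linearIndependent_rows_of_det_ne_zero
    simp [Matrix.det_fin_three]
  · intro i
    rw [boxGauge_le_iff, e1]
    have b1 := abs_sub_round ξ₁
    have b2 := abs_sub_round ξ₂
    fin_cases i
    · refine ⟨⟨1, round ξ₁, round ξ₂, by simp, by simp, by simp⟩, ?_, ?_, ?_⟩
      · simpa using e0
      · simpa using b1.trans (by norm_num)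
      · simpa using b2.trans (by norm_num)
    · refine ⟨⟨0, 1, 0, by simp, by simp, by simp⟩, ?_, ?_, ?_⟩
      · simp; positivity
      · simp
      · simp
    · refine ⟨⟨0, 0, 1, by simp, by simp, by simp⟩, ?_, ?_, ?_⟩
      · simp; positivity
      · simp
      · simp

theorem lambdaMin_le {j : ℕ} {q l : ℝ} (hl : 0 < l) {v : Fin j → (Fin 3 → ℝ)}
    (hv : LinearIndependent ℝ v) (h : ∀ i, v i ∈ LatticeSet ξ₁ ξ₂ ∧ boxGauge q (v i) ≤ l) :
    lambdaMin ξ₁ ξ₂ j q ≤ l :=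
  csInf_le ⟨0, fun _ h => h.1.le⟩ ⟨hl, v, hv, fun i => ⟨(h i).1, (mem_smul_Box hl).2 (h i).2⟩⟩

theorem exists_of_lambdaMin_lt {j : ℕ} (hj : j ≤ 3) {q l : ℝ} (hq : 0 ≤ q)
    (h : lambdaMin ξ₁ ξ₂ j q < l) :
    ∃ v : Fin j → (Fin 3 → ℝ), LinearIndependent ℝ v ∧
      ∀ i, v i ∈ LatticeSet ξ₁ ξ₂ ∧ boxGauge q (v i) < l := by
  obtain ⟨w, hw, hw'⟩ := exists_linearIndependent_boxGauge_le ξ₁ ξ₂ hq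
  obtain ⟨m, ⟨hm, v, hv, hv'⟩, hml⟩ := exists_lt_of_csInf_lt
    (by exact ⟨Real.exp q, Real.exp_pos q, w ∘ Fin.castLE hj, hw.comp _ (Fin.castLE_injective hj),
      fun i => ⟨(hw' _).1, (mem_smul_Box (Real.exp_pos q)).2 (hw' _).2⟩⟩) h
  exact ⟨v, hv, fun i => ⟨(hv' i).1, ((mem_smul_Box hm).1 (hv' i).2).trans_lt hml⟩⟩

theorem lambdaMin_nonneg (ξ₁ ξ₂ : ℝ) (j : ℕ) (q : ℝ) : 0 ≤ lambdaMin ξ₁ ξ₂ j q :=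
  Real.sInf_nonneg fun _ h => h.1.le

theorem lambdaMin_mono {j k : ℕ} (hjk : j ≤ k) (hk : k ≤ 3) {q : ℝ} (hq : 0 ≤ q) :
    lambdaMin ξ₁ ξ₂ j q ≤ lambdaMin ξ₁ ξ₂ k q := by
  refine le_of_forall_pos_le_add fun ε hε => ?_
  obtain ⟨v, hv, hv'⟩ := exists_of_lambdaMin_lt (ξ₁ := ξ₁) (ξ₂ := ξ₂) hk hq (lt_add_of_pos_right _ hε)
  exact lambdaMin_le (add_pos_of_nonneg_of_pos (lambdaMin_nonneg ..) hε)
    (hv.comp _ (Fin.castLE_injective hjk)) fun i => ⟨(hv' _).1, (hv' _).2.le⟩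

theorem lambdaMin_three_le {q : ℝ} (hq : 0 ≤ q) : lambdaMin ξ₁ ξ₂ 3 q ≤ Real.exp q := by
  obtain ⟨w, hw, hw'⟩ := exists_linearIndependent_boxGauge_le ξ₁ ξ₂ hq
  exact lambdaMin_le (Real.exp_pos q) hw hw'

theorem exp_le_lambdaMin_one {q : ℝ} (hq : 0 ≤ q) :
    Real.exp (-(2 * q)) ≤ lambdaMin ξ₁ ξ₂ 1 q := by
  by_contra! h
  obtain ⟨v, hv, hv'⟩ := exists_of_lambdaMin_lt (by norm_num) hq h
  exact (hv' 0).2.not_ge (exp_neg_two_mul_le_boxGauge hq (hv' 0).1 (hv.ne_zero 0))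

theorem lambdaMin_one_le_boxGauge {q : ℝ} (hq : 0 ≤ q) {z : Fin 3 → ℝ}
    (hz : z ∈ LatticeSet ξ₁ ξ₂) (hz0 : z ≠ 0) : lambdaMin ξ₁ ξ₂ 1 q ≤ boxGauge q z :=
  lambdaMin_le ((Real.exp_pos _).trans_le (exp_neg_two_mul_le_boxGauge hq hz hz0))
    (v := fun _ => z) (LinearIndependent.of_subsingleton 0 hz0) fun _ => ⟨hz, le_rfl⟩

/-- Minkowski's theorem on linear forms for the lattice `LatticeSet ξ₁ ξ₂`. -/
theorem exists_ne_zero_mem_LatticeSet (ξ₁ ξ₂ : ℝ) (c : Fin 3 → ℝ) (hc : ∀ i, 0 < c i)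
    (h : 1 ≤ c 0 * c 1 * c 2) :
    ∃ z ∈ LatticeSet ξ₁ ξ₂, z ≠ 0 ∧ ∀ i, |z i| ≤ c i := by
  set M : Matrix (Fin 3) (Fin 3) ℝ := !![1, ξ₁, ξ₂; 0, -1, 0; 0, 0, -1] with hM
  have hdet : M.det = 1 := by simp [hM, Matrix.det_fin_three]
  have hli : LinearIndependent ℝ (fun i => M i) :=
    Matrix.linearIndependent_rows_of_det_ne_zero (by simp [hdet])
  let b : Module.Basis (Fin 3) ℝ (Fin 3 → ℝ) :=
    basisOfLinearIndependentOfCardEqFinrank hli (by simp)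
  have hb : (b : Fin 3 → (Fin 3 → ℝ)) = fun i => M i := by simp [b]
  have hvol : MeasureTheory.volume (ZSpan.fundamentalDomain b) = 1 := by
    rw [ZSpan.volume_fundamentalDomain, hb]
    have : Matrix.of (fun i => M i) = M := rfl
    simp [this, hdet]
  have : Countable (Submodule.span ℤ (Set.range b)).toAddSubgroup :=
    inferInstanceAs (Countable (Submodule.span ℤ (Set.range b)))
  have : DiscreteTopology (Submodule.span ℤ (Set.range b)).toAddSubgroup :=
    inferInstanceAs (DiscreteTopology (Submodule.span ℤ (Set.range b)))
  obtain ⟨x, hx0, hx⟩ :=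
    MeasureTheory.exists_ne_zero_mem_lattice_of_measure_mul_two_pow_le_measure
      (L := (Submodule.span ℤ (Set.range b)).toAddSubgroup) (s := Set.Icc (-c) c)
      (ZSpan.isAddFundamentalDomain' b MeasureTheory.volume)
      (fun x hx => ⟨neg_le_neg hx.2, neg_le.1 hx.1⟩) (convex_Icc _ _) isCompact_Icc (by
        rw [hvol, Real.volume_Icc_pi, Fin.prod_univ_three]
        have h2 (i : Fin 3) : c i - (-c) i = 2 * c i := by simp; ring
        simp only [h2]
        rw [← ENNReal.ofReal_mul (by have := hc 0; positivity),
          ← ENNReal.ofReal_mul (by have := hc 0; have := hc 1; positivity)]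
        simp only [Module.finrank_fin_fun, one_mul]
        rw [show (2 : ENNReal) ^ 3 = ENNReal.ofReal 8 by norm_num]
        exact ENNReal.ofReal_le_ofReal (by linarith))
  refine ⟨x, ?_, by simpa using hx0, fun i => abs_le.2 ⟨hx.1 i, hx.2 i⟩⟩
  obtain ⟨n, hn⟩ := (Submodule.mem_span_range_iff_exists_fun ℤ).1 x.2
  rw [Fin.sum_univ_three] at hn
  simp only [congrFun hb] at hn
  refine ⟨n 0, n 1, n 2, ?_, ?_, ?_⟩
  · rw [← hn]; simp [hM]
  · rw [← hn]; simp [hM]; ring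
  · rw [← hn]; simp [hM]; ring

theorem boxGauge_pos {q : ℝ} (hq : 0 ≤ q) {z : Fin 3 → ℝ}
    (hz : z ∈ LatticeSet ξ₁ ξ₂) (hz0 : z ≠ 0) : 0 < boxGauge q z :=
  (Real.exp_pos _).trans_le (exp_neg_two_mul_le_boxGauge hq hz hz0)

/-- A consequence of Minkowski's second theorem, up to constants: `λ₁² λ₃ ≤ 4`. -/
theorem lambdaMin_one_sq_mul_le {q : ℝ} (hq : 0 ≤ q) {r : ℝ} (hr : 0 < r)
    (hr1 : r ≤ 1) (h : (r ^ 2)⁻¹ < lambdaMin ξ₁ ξ₂ 3 q) : lambdaMin ξ₁ ξ₂ 1 q ≤ 2 * r := by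
  set R := (r ^ 2)⁻¹ with hR
  have hR0 : 0 < R := by positivity
  have hrR : r ^ 2 * R = 1 := mul_inv_cancel₀ (by positivity)
  have hR1 : r ≤ R := by
    have : 1 ≤ R := (one_le_inv₀ (by positivity)).2 (by nlinarith)
    linarith
  let s : Fin 3 → ℝ := ![Real.exp (2 * q), Real.exp (-q), Real.exp (-q)]
  have hs (i : Fin 3) : 0 < s i := by fin_cases i <;> simp [s, Real.exp_pos]
  have hs1 : s 0 * s 1 * s 2 = 1 := by
    simp only [s, Matrix.cons_val]
    rw [← Real.exp_add, ← Real.exp_add, Real.exp_eq_one_iff]; ring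
  have gauge_le {l : ℝ} {z : Fin 3 → ℝ} : boxGauge q z ≤ l ↔ ∀ i, |z i| ≤ l * s i := by
    simp [boxGauge_le_iff, Fin.forall_fin_succ, s]
  have hw (i : Fin 3) : ∃ z ∈ LatticeSet ξ₁ ξ₂, z ≠ 0 ∧
      ∀ j, |z j| ≤ (if j = i then R else r) * s j := by
    refine exists_ne_zero_mem_LatticeSet ξ₁ ξ₂ _ (fun j => ?_) (le_of_eq ?_)
    · have := hs j
      split_ifs <;> positivity
    · have : ∀ x y z : ℝ, x * s 0 * (y * s 1) * (z * s 2) = x * y * z * (s 0 * s 1 * s 2) := by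
        intros; ring
      rw [this, hs1]
      fin_cases i <;> simp <;> linarith
  choose w hwΛ hw0 hwle using hw
  have hdep : ¬ LinearIndependent ℝ w := fun hli =>
    h.not_ge <| lambdaMin_le hR0 hli fun i => ⟨hwΛ i, gauge_le.2 fun j => (hwle i j).trans <| by
      have := hs j
      split_ifs <;> nlinarith⟩
  have hdet : (Matrix.of w).det = 0 := by
    by_contra hne
    exact hdep (Matrix.linearIndependent_rows_of_det_ne_zero hne)
  obtain ⟨m, hm0, hm⟩ := Matrix.exists_mulVec_eq_zero_iff.2 hdet
  obtain ⟨i, -, hi⟩ := Finset.exists_max_image Finset.univ (fun j => |m j| * s j) ⟨0, by simp⟩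
  have hmi : 0 < |m i| := by
    by_contra! hle
    refine hm0 (funext fun j => ?_)
    have h1 := hi j (Finset.mem_univ j)
    have : |m i| = 0 := le_antisymm hle (abs_nonneg _)
    rw [this, zero_mul] at h1
    exact abs_eq_zero.1 (le_antisymm (nonpos_of_mul_nonpos_left h1 (hs j)) (abs_nonneg _))
  have hrow : ∑ j, w i j * m j = 0 := congrFun hm i
  have hdiag : |w i i| ≤ 2 * r * s i := by
    have hsum : w i i * m i = -∑ j ∈ Finset.univ.erase i, w i j * m j := by
      rw [← Finset.add_sum_erase _ _ (Finset.mem_univ i)] at hrow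
      linarith
    have hle : |w i i| * |m i| ≤ ∑ j ∈ Finset.univ.erase i, r * (|m i| * s i) := by
      rw [← abs_mul, hsum, abs_neg]
      refine (Finset.abs_sum_le_sum_abs _ _).trans (Finset.sum_le_sum fun j hj => ?_)
      have h1 := hwle i j
      rw [if_neg (Finset.ne_of_mem_erase hj)] at h1
      have h2 := hi j (Finset.mem_univ j)
      rw [abs_mul]
      calc |w i j| * |m j| ≤ r * s j * |m j| := by gcongr
        _ = r * (|m j| * s j) := by ring
        _ ≤ _ := by gcongr
    simp only [Finset.sum_const, Finset.card_erase_of_mem (Finset.mem_univ i), Finset.card_univ,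
      Fintype.card_fin, nsmul_eq_mul] at hle
    refine le_of_mul_le_mul_right (hle.trans_eq ?_) hmi
    push_cast
    ring
  refine (lambdaMin_one_le_boxGauge hq (hwΛ i) (hw0 i)).trans (gauge_le.2 fun j => ?_)
  rcases eq_or_ne j i with rfl | hj
  · exact hdiag
  · have h1 := hwle i j
    rw [if_neg hj] at h1
    have := hs j
    nlinarith

theorem linearIndependent_triple {V : Type*} [AddCommGroup V] [Module ℝ V] {v : Fin 2 → V}
    (hv : LinearIndependent ℝ v) {u : V} (hu : u ∉ Submodule.span ℝ (Set.range v)) :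
    LinearIndependent ℝ ![u, v 0, v 1] := by
  have : ![u, v 0, v 1] = Fin.cons u v := by
    funext i; fin_cases i <;> rfl
  rw [this]
  exact linearIndependent_finCons.2 ⟨hv, hu⟩

theorem one_le_abs_det {w : Fin 3 → (Fin 3 → ℝ)} (hw : LinearIndependent ℝ w)
    (hΛ : ∀ i, w i ∈ LatticeSet ξ₁ ξ₂) : 1 ≤ |(Matrix.of w).det| := by
  have hne : (Matrix.of w).det ≠ 0 := by
    have : IsUnit (Matrix.of w) := Matrix.linearIndependent_rows_iff_isUnit.1 hw
    exact ((Matrix.isUnit_iff_isUnit_det _).1 this).ne_zero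
  choose x y₁ y₂ h0 h1 h2 using hΛ
  obtain ⟨n, hn⟩ : ∃ n : ℤ, (Matrix.of w).det = n := by
    refine ⟨(!![x 0, y₁ 0, y₂ 0; x 1, y₁ 1, y₂ 1; x 2, y₁ 2, y₂ 2] :
      Matrix (Fin 3) (Fin 3) ℤ).det, ?_⟩
    simp only [Matrix.det_fin_three, Matrix.of_apply, h0, h1, h2]
    simp
    ring
  rw [hn] at hne ⊢
  exact_mod_cast Int.one_le_abs (by exact_mod_cast hne)

theorem abs_det_le {q a b : ℝ} {w : Fin 3 → (Fin 3 → ℝ)} (h0 : boxGauge q (w 0) ≤ a)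
    (h1 : boxGauge q (w 1) ≤ b) (h2 : boxGauge q (w 2) ≤ b) :
    |(Matrix.of w).det| ≤ 6 * (b ^ 2 * a) := by
  obtain ⟨a0, a1, a2⟩ := boxGauge_le_iff.1 h0
  obtain ⟨b0, b1, b2⟩ := boxGauge_le_iff.1 h1
  obtain ⟨c0, c1, c2⟩ := boxGauge_le_iff.1 h2
  have ha : 0 ≤ a := (boxGauge_nonneg _ _).trans h0
  have hb : 0 ≤ b := (boxGauge_nonneg _ _).trans h1
  have he : Real.exp (2 * q) * Real.exp (-q) * Real.exp (-q) = 1 := by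
    rw [← Real.exp_add, ← Real.exp_add, Real.exp_eq_one_iff]; ring
  have key {x y z X Y Z : ℝ} (hx : |x| ≤ X) (hy : |y| ≤ Y) (hz : |z| ≤ Z) :
      |x * y * z| ≤ X * Y * Z := by
    rw [abs_mul, abs_mul]
    have := (abs_nonneg x).trans hx
    have := (abs_nonneg y).trans hy
    gcongr
  have t1 := abs_le.1 (key a0 b1 c2)
  have t2 := abs_le.1 (key a0 b2 c1)
  have t3 := abs_le.1 (key a1 b0 c2)
  have t4 := abs_le.1 (key a1 b2 c0)
  have t5 := abs_le.1 (key a2 b0 c1)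
  have t6 := abs_le.1 (key a2 b1 c0)
  generalize Real.exp (2 * q) = E at *
  generalize Real.exp (-q) = F at *
  have e1 : a * E * (b * F) * (b * F) = b ^ 2 * a := by
    linear_combination (b ^ 2 * a) * he
  have e2 : a * F * (b * E) * (b * F) = b ^ 2 * a := by
    linear_combination (b ^ 2 * a) * he
  have e3 : a * F * (b * F) * (b * E) = b ^ 2 * a := by
    linear_combination (b ^ 2 * a) * he
  simp only [e1, e2, e3] at t1 t2 t3 t4 t5 t6
  rw [Matrix.det_fin_three, abs_le]
  simp only [Matrix.of_apply]
  constructor <;> linarith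

theorem not_mem_span_pair_of_linearIndependent {w : Fin 3 → (Fin 3 → ℝ)}
    (hw : LinearIndependent ℝ w) (v : Fin 2 → (Fin 3 → ℝ)) :
    ∃ i, w i ∉ Submodule.span ℝ (Set.range v) := by
  by_contra! h
  have h1 := hw.span_eq_top_of_card_eq_finrank' (by simp)
  have h2 : Submodule.span ℝ (Set.range v) = ⊤ :=
    top_le_iff.1 (h1 ▸ Submodule.span_le.2 (Set.range_subset_iff.2 h))
  have h3 := finrank_range_le_card (R := ℝ) v
  rw [Set.finrank, h2, finrank_top] at h3
  simp at h3

theorem one_le_lambdaMin_two_sq_mul {q : ℝ} (hq : 0 ≤ q) :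
    1 ≤ 6 * (lambdaMin ξ₁ ξ₂ 2 q ^ 2 * lambdaMin ξ₁ ξ₂ 3 q) := by
  have hlim : Filter.Tendsto (fun ε : ℝ => 6 * ((lambdaMin ξ₁ ξ₂ 2 q + ε) ^ 2 *
      (lambdaMin ξ₁ ξ₂ 3 q + ε))) (nhdsWithin 0 (Set.Ioi 0))
      (nhds (6 * ((lambdaMin ξ₁ ξ₂ 2 q + 0) ^ 2 * (lambdaMin ξ₁ ξ₂ 3 q + 0)))) :=
    (Continuous.tendsto (by fun_prop) 0).mono_left nhdsWithin_le_nhds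
  rw [add_zero, add_zero] at hlim
  refine ge_of_tendsto hlim (eventually_nhdsWithin_of_forall fun ε (hε : 0 < ε) => ?_)
  obtain ⟨v, hv, hv'⟩ := exists_of_lambdaMin_lt (ξ₁ := ξ₁) (ξ₂ := ξ₂) (j := 2) (by norm_num) hq
    (lt_add_of_pos_right _ hε)
  obtain ⟨w, hw, hw'⟩ := exists_of_lambdaMin_lt (ξ₁ := ξ₁) (ξ₂ := ξ₂) (j := 3) (by norm_num) hq
    (lt_add_of_pos_right _ hε)
  obtain ⟨i, hi⟩ := not_mem_span_pair_of_linearIndependent hw v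
  refine (one_le_abs_det (ξ₁ := ξ₁) (ξ₂ := ξ₂) (linearIndependent_triple hv hi) ?_).trans
    (abs_det_le (q := q) (hw' i).2.le (hv' 0).2.le (hv' 1).2.le)
  intro j
  fin_cases j
  exacts [(hw' i).1, (hv' 0).1, (hv' 1).1]

theorem lambdaMin_one_sq_mul_lambdaMin_three_le {q : ℝ} (hq : 0 ≤ q)
    (h : 3 ≤ lambdaMin ξ₁ ξ₂ 3 q) :
    lambdaMin ξ₁ ξ₂ 1 q ^ 2 * lambdaMin ξ₁ ξ₂ 3 q ≤ 8 := by
  have h3 : 0 < lambdaMin ξ₁ ξ₂ 3 q := by linarith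
  have hsq : Real.sqrt (2 / lambdaMin ξ₁ ξ₂ 3 q) ^ 2 = 2 / lambdaMin ξ₁ ξ₂ 3 q :=
    Real.sq_sqrt (by positivity)
  have h1 := lambdaMin_one_sq_mul_le (ξ₁ := ξ₁) (ξ₂ := ξ₂) hq (r := Real.sqrt (2 / lambdaMin ξ₁ ξ₂ 3 q))
    (by positivity) (Real.sqrt_le_one.2 ((div_le_one h3).2 (by linarith)))
    (by rw [hsq, inv_div]; linarith)
  have h2 := pow_le_pow_left₀ (lambdaMin_nonneg ξ₁ ξ₂ 1 q) h1 2
  rw [mul_pow, hsq] at h2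
  calc _ ≤ 2 ^ 2 * (2 / lambdaMin ξ₁ ξ₂ 3 q) * lambdaMin ξ₁ ξ₂ 3 q := by gcongr
    _ = 8 := by field_simp; norm_num

theorem exists_boxGauge_le_one (ξ₁ ξ₂ q : ℝ) :
    ∃ z ∈ LatticeSet ξ₁ ξ₂, z ≠ 0 ∧ boxGauge q z ≤ 1 := by
  obtain ⟨z, hz, hz0, hle⟩ := exists_ne_zero_mem_LatticeSet ξ₁ ξ₂
    ![Real.exp (2 * q), Real.exp (-q), Real.exp (-q)]
    (fun i => by fin_cases i <;> simp [Real.exp_pos]) (by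
      simp only [Matrix.cons_val]
      rw [← Real.exp_add, ← Real.exp_add]
      exact Real.one_le_exp (by linarith))
  refine ⟨z, hz, hz0, boxGauge_le_iff.2 ?_⟩
  simpa [Fin.forall_fin_succ] using hle

theorem lambdaMin_pos {j : ℕ} (hj : 1 ≤ j) (hj3 : j ≤ 3) {q : ℝ} (hq : 0 ≤ q) :
    0 < lambdaMin ξ₁ ξ₂ j q :=
  (Real.exp_pos _).trans_le ((exp_le_lambdaMin_one hq).trans (lambdaMin_mono hj hj3 hq))

theorem lambdaMin_add_one_le {j : ℕ} (hj : j ≤ 3) {q : ℝ} (hq : 0 ≤ q) :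
    lambdaMin ξ₁ ξ₂ j (q + 1) ≤ Real.exp 1 * lambdaMin ξ₁ ξ₂ j q := by
  have he := Real.exp_pos 1
  rw [mul_comm, ← div_le_iff₀ he]
  refine le_of_forall_pos_le_add fun ε hε => ?_
  obtain ⟨v, hv, hv'⟩ := exists_of_lambdaMin_lt (ξ₁ := ξ₁) (ξ₂ := ξ₂) hj hq
    (lt_add_of_pos_right _ hε)
  have hpos := add_pos_of_nonneg_of_pos (lambdaMin_nonneg ξ₁ ξ₂ j q) hε
  rw [div_le_iff₀ he, mul_comm]
  exact lambdaMin_le (by positivity) hv fun i => ⟨(hv' i).1, (boxGauge_add_one_le q _).trans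
    (mul_le_mul_of_nonneg_left (hv' i).2.le he.le)⟩

theorem intCast_eq_zero_of_linearIndependent (hind : LinearIndependent ℚ ![(1 : ℝ), ξ₁, ξ₂])
    {a b c : ℤ} (h : (a : ℝ) + b * ξ₁ + c * ξ₂ = 0) : a = 0 ∧ b = 0 ∧ c = 0 := by
  have := Fintype.linearIndependent_iff.1 hind ![(a : ℚ), b, c] (by
    simp [Fin.sum_univ_three, Rat.smul_def, h])
  exact ⟨by simpa using this 0, by simpa using this 1, by simpa using this 2⟩

theorem eq_zero_of_mem_LatticeSet (hind : LinearIndependent ℚ ![(1 : ℝ), ξ₁, ξ₂])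
    {z : Fin 3 → ℝ} (hz : z ∈ LatticeSet ξ₁ ξ₂) (h1 : z 1 = 0) (h2 : z 2 = 0) : z = 0 := by
  obtain ⟨x, y₁, y₂, e0, e1, e2⟩ := hz
  obtain ⟨-, hx, -⟩ := intCast_eq_zero_of_linearIndependent hind (a := -y₁) (b := x) (c := 0)
    (by push_cast; linarith)
  funext i
  fin_cases i <;> simp_all

theorem exists_lt_mul_exp_add {m : ℝ} (hm : 0 < m) (q C : ℝ) :
    ∃ n : ℕ, C < m * Real.exp (q + n) := by
  obtain ⟨n, hn⟩ := exists_nat_gt (C / m - q)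
  refine ⟨n, ?_⟩
  rw [mul_comm, ← div_lt_iff₀ hm]
  linarith [Real.add_one_le_exp (q + n)]

theorem exists_lambdaMin_two_le (hind : LinearIndependent ℚ ![(1 : ℝ), ξ₁, ξ₂]) {q₀ : ℝ}
    (hq₀ : 0 ≤ q₀) :
    ∃ q ≥ q₀, lambdaMin ξ₁ ξ₂ 2 q ≤ 2 * Real.exp 3 * lambdaMin ξ₁ ξ₂ 1 q := by
  have hpos := lambdaMin_pos (ξ₁ := ξ₁) (ξ₂ := ξ₂) le_rfl (by norm_num) hq₀
  obtain ⟨v, hv, hv'⟩ := exists_of_lambdaMin_lt (ξ₁ := ξ₁) (ξ₂ := ξ₂) (j := 1)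
    (l := 2 * lambdaMin ξ₁ ξ₂ 1 q₀) (by norm_num) hq₀ (by linarith)
  obtain ⟨hzΛ, hzlt⟩ := hv' 0
  have hz0 := hv.ne_zero 0
  generalize v 0 = z at hzΛ hzlt hz0
  clear hv' hv v
  classical
  have hex : ∃ n : ℕ, ¬ ∀ w ∈ LatticeSet ξ₁ ξ₂, w ≠ 0 →
      boxGauge (q₀ + n) z ≤ 2 * boxGauge (q₀ + n) w := by
    by_contra! hall
    have hm : 0 < max |z 1| |z 2| := by
      by_contra! hle
      refine hz0 (eq_zero_of_mem_LatticeSet hind hzΛ ?_ ?_)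
      · exact abs_nonpos_iff.1 ((le_max_left _ _).trans hle)
      · exact abs_nonpos_iff.1 ((le_max_right _ _).trans hle)
    obtain ⟨n, hn⟩ := exists_lt_mul_exp_add hm q₀ 2
    obtain ⟨w, hw, hw0, hw1⟩ := exists_boxGauge_le_one ξ₁ ξ₂ (q₀ + n)
    have h1 := hall n w hw hw0
    have h2 : max |z 1| |z 2| * Real.exp (q₀ + n) ≤ boxGauge (q₀ + n) z := by
      rw [max_mul_of_nonneg _ _ (Real.exp_pos _).le]
      exact le_max_right _ _
    linarith
  obtain ⟨k, hk⟩ : ∃ k, Nat.find hex = k + 1 := by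
    refine Nat.exists_eq_succ_of_ne_zero fun h0 => ?_
    refine (Nat.find_eq_zero hex).1 h0 fun w hw hw0 => ?_
    have := lambdaMin_one_le_boxGauge hq₀ hw hw0
    simp only [Nat.cast_zero, add_zero]
    linarith
  have hmin : ∀ w ∈ LatticeSet ξ₁ ξ₂, w ≠ 0 → boxGauge (q₀ + k) z ≤ 2 * boxGauge (q₀ + k) w :=
    not_not.1 (Nat.find_min hex (m := k) (by omega))
  have hfail := Nat.find_spec hex
  rw [hk] at hfail
  push Not at hfail
  obtain ⟨w, hwΛ, hw0, hwz⟩ := hfail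
  have hcast : q₀ + ((k + 1 : ℕ) : ℝ) = q₀ + k + 1 := by push_cast; ring
  rw [hcast] at hwz
  have hk0 : 0 ≤ q₀ + k := by positivity
  have hle : q₀ ≤ q₀ + k + 1 := by linarith [Nat.cast_nonneg (α := ℝ) k]
  generalize q₀ + (k : ℝ) = p at *
  have hzpos := boxGauge_pos (q := p + 1) (by linarith) hzΛ hz0
  refine ⟨p + 1, hle, ?_⟩
  have hli : LinearIndependent ℝ ![z, w] := by
    refine (LinearIndependent.pair_iff' hz0).2 fun t ht => ?_
    have h1 := hmin w hwΛ hw0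
    have h2 := boxGauge_pos hk0 hzΛ hz0
    rw [← ht, boxGauge_smul] at h1 hwz
    nlinarith
  have h2 : lambdaMin ξ₁ ξ₂ 2 (p + 1) ≤ boxGauge (p + 1) z := by
    refine lambdaMin_le hzpos hli fun i => ?_
    have := boxGauge_nonneg (p + 1) w
    fin_cases i
    · exact ⟨hzΛ, le_rfl⟩
    · exact ⟨hwΛ, by simp; linarith⟩
  by_contra! hlt
  rw [← lt_div_iff₀' (by positivity)] at hlt
  obtain ⟨u, hu, hu'⟩ := exists_of_lambdaMin_lt (by norm_num) (by linarith) hlt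
  obtain ⟨huΛ, hult⟩ := hu' 0
  rw [lt_div_iff₀' (by positivity)] at hult
  have c1 := boxGauge_add_one_le p z
  have c2 := hmin _ huΛ (hu.ne_zero 0)
  have c3 := boxGauge_le_add_one p (u 0)
  have he : Real.exp 3 = Real.exp 1 * Real.exp 2 := by rw [← Real.exp_add]; norm_num
  have : boxGauge (p + 1) z ≤ 2 * Real.exp 3 * boxGauge (p + 1) (u 0) :=
    calc _ ≤ Real.exp 1 * (2 * (Real.exp 2 * boxGauge (p + 1) (u 0))) := by
          refine c1.trans (mul_le_mul_of_nonneg_left ?_ (Real.exp_pos 1).le)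
          linarith
      _ = _ := by rw [he]; ring
  linarith

theorem det_ne_zero_of_linearIndependent (hind : LinearIndependent ℚ ![(1 : ℝ), ξ₁, ξ₂])
    {a b : Fin 3 → ℝ} (ha : a ∈ LatticeSet ξ₁ ξ₂) (hb : b ∈ LatticeSet ξ₁ ξ₂)
    (hab : LinearIndependent ℝ ![a, b]) : a 1 * b 2 - a 2 * b 1 ≠ 0 := by
  intro hD
  have ha0 : a ≠ 0 := hab.ne_zero 0
  obtain ⟨x, y₁, y₂, a0, a1, a2⟩ := ha
  obtain ⟨x', y₁', y₂', b0, b1, b2⟩ := hb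
  obtain ⟨c0, c1, c2⟩ := intCast_eq_zero_of_linearIndependent hind
    (a := y₁ * y₂' - y₂ * y₁') (b := y₂ * x' - x * y₂') (c := x * y₁' - y₁ * x') (by
      rw [a1, a2, b1, b2] at hD
      push_cast
      linarith)
  have c0' : (y₁ * y₂' - y₂ * y₁' : ℝ) = 0 := by exact_mod_cast c0
  have c1' : (y₂ * x' - x * y₂' : ℝ) = 0 := by exact_mod_cast c1
  have c2' : (x * y₁' - y₁ * x' : ℝ) = 0 := by exact_mod_cast c2
  have hpair := LinearIndependent.pair_iff.1 hab
  have hcomb (s t : ℝ) (h0 : s * x + t * x' = 0) (h1 : s * y₁ + t * y₁' = 0)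
      (h2 : s * y₂ + t * y₂' = 0) : s = 0 ∧ t = 0 := by
    refine hpair s t (funext fun i => ?_)
    fin_cases i
    · simpa [a0, b0] using h0
    · simp [a1, b1]; linear_combination ξ₁ * h0 - h1
    · simp [a2, b2]; linear_combination ξ₂ * h0 - h2
  have hx := hcomb x' (-x) (by ring) (by linarith) (by linarith)
  have hy₁ := hcomb y₁' (-y₁) (by linarith) (by ring) (by linarith)
  have hy₂ := hcomb y₂' (-y₂) (by linarith) (by linarith) (by ring)
  refine ha0 (funext fun i => ?_)
  have e0 : (x : ℝ) = 0 := by linarith [hx.2]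
  have e1 : (y₁ : ℝ) = 0 := by linarith [hy₁.2]
  have e2 : (y₂ : ℝ) = 0 := by linarith [hy₂.2]
  fin_cases i <;> simp [a0, a1, a2, e0, e1, e2]

theorem eq_zero_of_abs_lt_one {z : Fin 3 → ℝ} (hz : z ∈ LatticeSet ξ₁ ξ₂)
    (h : ∀ i, |z i| < 1) : z = 0 := by
  obtain ⟨x, y₁, y₂, e0, e1, e2⟩ := hz
  have h0 := h 0
  have h1 := h 1
  have h2 := h 2
  rw [e0] at h0
  have hx : x = 0 := Int.abs_lt_one_iff.1 (by exact_mod_cast h0)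
  subst hx
  rw [e1] at h1
  rw [e2] at h2
  simp only [Int.cast_zero, mul_zero, zero_sub, abs_neg] at h1 h2
  have hy₁ : y₁ = 0 := Int.abs_lt_one_iff.1 (by exact_mod_cast h1)
  have hy₂ : y₂ = 0 := Int.abs_lt_one_iff.1 (by exact_mod_cast h2)
  funext i
  fin_cases i <;> simp_all

/-- A plane spanned by two lattice points contains no nonzero lattice point in `Box q`
once `q` is large. -/
theorem exists_forall_mem_span_one_lt_boxGauge (hind : LinearIndependent ℚ ![(1 : ℝ), ξ₁, ξ₂])
    {v : Fin 2 → (Fin 3 → ℝ)} (hv : LinearIndependent ℝ v) (hvΛ : ∀ i, v i ∈ LatticeSet ξ₁ ξ₂)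
    (q₀ : ℝ) :
    ∃ n : ℕ, ∀ u ∈ LatticeSet ξ₁ ξ₂, u ∈ Submodule.span ℝ (Set.range v) → u ≠ 0 →
      1 < boxGauge (q₀ + n) u := by
  have hv2 : v = ![v 0, v 1] := by funext i; fin_cases i <;> rfl
  have hD := det_ne_zero_of_linearIndependent hind (hvΛ 0) (hvΛ 1) (hv2 ▸ hv)
  have hrange : Set.range v = {v 0, v 1} := by
    rw [hv2]; simp [Set.pair_comm]
  rw [hrange]
  generalize v 0 = a at *
  generalize v 1 = b at *
  set D := a 1 * b 2 - a 2 * b 1 with hDdef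
  have hDpos : 0 < |D| := abs_pos.2 hD
  set K := (|b 2| + |b 1|) * |a 0| + (|a 1| + |a 2|) * |b 0| with hK
  obtain ⟨n, hn⟩ := exists_lt_mul_exp_add (m := min 1 |D|) (by positivity) q₀ (max 1 K)
  refine ⟨n, fun u hu hspan hu0 => ?_⟩
  by_contra! hle
  obtain ⟨-, h1, h2⟩ := boxGauge_le_iff.1 hle
  rw [one_mul] at h1 h2
  have hE : 0 < Real.exp (q₀ + n) := Real.exp_pos _
  set F := Real.exp (-(q₀ + n)) with hF
  have hFE : F * Real.exp (q₀ + n) = 1 := by rw [hF, ← Real.exp_add]; simp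
  have hF0 : 0 < F := Real.exp_pos _
  have hF1 : F < 1 := by
    have : 1 < Real.exp (q₀ + n) := by
      have := min_le_left 1 |D|
      have := le_max_left 1 K
      nlinarith
    nlinarith
  have hFK : F * K < |D| := by
    have h3 : K < |D| * Real.exp (q₀ + n) := by
      have := min_le_right 1 |D|
      have := le_max_right 1 K
      nlinarith
    calc F * K < F * (|D| * Real.exp (q₀ + n)) := by gcongr
      _ = |D| * (F * Real.exp (q₀ + n)) := by ring
      _ = |D| := by rw [hFE, mul_one]
  refine hu0 (eq_zero_of_abs_lt_one hu fun i => ?_)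
  fin_cases i
  · obtain ⟨s, t, rfl⟩ := Submodule.mem_span_pair.1 hspan
    set u := s • a + t • b with hu
    have e : u 0 * D = (u 1 * b 2 - u 2 * b 1) * a 0 + (a 1 * u 2 - a 2 * u 1) * b 0 := by
      simp [hu, hDdef]; ring
    have hb : |u 0| * |D| ≤ F * K := by
      rw [← abs_mul, e]
      have mul_le {x y : ℝ} (h : |x| ≤ F) : |x * y| ≤ F * |y| := by
        rw [abs_mul]; gcongr
      have k1 : |u 1 * b 2 - u 2 * b 1| ≤ F * (|b 2| + |b 1|) := by
        refine (abs_sub _ _).trans ?_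
        linarith [mul_le (y := b 2) h1, mul_le (y := b 1) h2]
      have k2 : |a 1 * u 2 - a 2 * u 1| ≤ F * (|a 1| + |a 2|) := by
        refine (abs_sub _ _).trans ?_
        rw [mul_comm (a 1), mul_comm (a 2)]
        linarith [mul_le (y := a 1) h2, mul_le (y := a 2) h1]
      refine (abs_add_le _ _).trans ?_
      rw [abs_mul, abs_mul]
      calc _ ≤ F * (|b 2| + |b 1|) * |a 0| + F * (|a 1| + |a 2|) * |b 0| := by gcongr
        _ = F * K := by rw [hK]; ring
    simp only [Fin.zero_eta]
    by_contra! hge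
    nlinarith
  · exact h1.trans_lt hF1
  · exact h2.trans_lt hF1

theorem exists_lambdaMin_three_le (hind : LinearIndependent ℚ ![(1 : ℝ), ξ₁, ξ₂]) {q₀ : ℝ}
    (hq₀ : 0 ≤ q₀) (h3 : ∀ q ≥ q₀, 1 < lambdaMin ξ₁ ξ₂ 3 q) :
    ∃ q ≥ q₀, lambdaMin ξ₁ ξ₂ 3 q ≤ 2 * Real.exp 3 * lambdaMin ξ₁ ξ₂ 2 q := by
  by_contra! hlt
  have hp0 (n : ℕ) : 0 ≤ q₀ + n := by positivity
  have hp (n : ℕ) : q₀ ≤ q₀ + n := by simp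
  have hpos (n : ℕ) : 0 < lambdaMin ξ₁ ξ₂ 2 (q₀ + n) :=
    lambdaMin_pos (by norm_num) (by norm_num) (hp0 n)
  have hex (n : ℕ) : ∃ v : Fin 2 → (Fin 3 → ℝ), LinearIndependent ℝ v ∧
      ∀ i, v i ∈ LatticeSet ξ₁ ξ₂ ∧ boxGauge (q₀ + n) (v i) < 2 * lambdaMin ξ₁ ξ₂ 2 (q₀ + n) :=
    exists_of_lambdaMin_lt (by norm_num) (hp0 n) (by linarith [hpos n])
  choose v hv hv' using hex
  have hspan (n : ℕ) (u : Fin 3 → ℝ) (hu : u ∈ LatticeSet ξ₁ ξ₂)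
      (hult : boxGauge (q₀ + n) u < lambdaMin ξ₁ ξ₂ 3 (q₀ + n)) :
      u ∈ Submodule.span ℝ (Set.range (v n)) := by
    by_contra hmem
    have hli := linearIndependent_triple (hv n) hmem
    have h1 : 2 * lambdaMin ξ₁ ξ₂ 2 (q₀ + n) < lambdaMin ξ₁ ξ₂ 3 (q₀ + n) := by
      have := hlt _ (hp n)
      have := Real.one_le_exp (x := 3) (by norm_num)
      nlinarith [hpos n]
    have h2 := hpos n
    refine (max_lt hult h1).not_ge (lambdaMin_le (lt_max_of_lt_right (by linarith)) hli fun i => ?_)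
    fin_cases i
    · exact ⟨hu, le_max_left _ _⟩
    · exact ⟨(hv' n 0).1, (hv' n 0).2.le.trans (le_max_right _ _)⟩
    · exact ⟨(hv' n 1).1, (hv' n 1).2.le.trans (le_max_right _ _)⟩
  have hsub (n : ℕ) :
      Submodule.span ℝ (Set.range (v n)) ≤ Submodule.span ℝ (Set.range (v 0)) := by
    induction n with
    | zero => exact le_rfl
    | succ n ih =>
      refine le_trans (Submodule.span_le.2 (Set.range_subset_iff.2 fun i => ?_)) ih
      obtain ⟨hΛ, hi⟩ := hv' (n + 1) i
      refine hspan n _ hΛ ?_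
      have hcast : q₀ + ((n + 1 : ℕ) : ℝ) = q₀ + n + 1 := by push_cast; ring
      rw [hcast] at hi
      have c1 := boxGauge_le_add_one (q₀ + n) (v (n + 1) i)
      have c2 := lambdaMin_add_one_le (ξ₁ := ξ₁) (ξ₂ := ξ₂) (j := 2) (by norm_num) (hp0 n)
      have he : Real.exp 3 = Real.exp 2 * Real.exp 1 := by rw [← Real.exp_add]; norm_num
      calc boxGauge (q₀ + n) (v (n + 1) i)
          ≤ Real.exp 2 * (2 * (Real.exp 1 * lambdaMin ξ₁ ξ₂ 2 (q₀ + n))) := by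
            refine c1.trans (mul_le_mul_of_nonneg_left ?_ (Real.exp_pos 2).le)
            linarith
        _ = 2 * Real.exp 3 * lambdaMin ξ₁ ξ₂ 2 (q₀ + n) := by rw [he]; ring
        _ < _ := hlt _ (hp n)
  obtain ⟨n, hn⟩ := exists_forall_mem_span_one_lt_boxGauge hind (hv 0) (fun i => (hv' 0 i).1) q₀
  obtain ⟨u, hu, hu0, hu1⟩ := exists_boxGauge_le_one ξ₁ ξ₂ (q₀ + n)
  exact (hn u hu (hsub n (hspan n u hu (hu1.trans_lt (h3 _ (hp n))))) hu0).not_ge hu1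

theorem Lmin_le {j : ℕ} (hj : 1 ≤ j) (hj3 : j ≤ 3) {q : ℝ} (hq : 0 ≤ q) :
    Lmin ξ₁ ξ₂ j q ≤ q := by
  rw [Lmin, Real.log_le_iff_le_exp (lambdaMin_pos hj hj3 hq)]
  exact (lambdaMin_mono hj3 le_rfl hq).trans (lambdaMin_three_le hq)

theorem neg_two_mul_le_Lmin {j : ℕ} (hj : 1 ≤ j) (hj3 : j ≤ 3) {q : ℝ} (hq : 0 ≤ q) :
    -(2 * q) ≤ Lmin ξ₁ ξ₂ j q := by
  rw [Lmin, Real.le_log_iff_exp_le (lambdaMin_pos hj hj3 hq)]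
  exact (exp_le_lambdaMin_one hq).trans (lambdaMin_mono hj hj3 hq)

end Lattice

/-- If `{1, ξ₁, ξ₂}` is linearly independent over `ℚ` and `φ̲₃ = 1`, then
`φ̄₂ = 1` and `φ̄₁ = φ̲₂ = -1/2`. -/
theorem phi_of_phiLow_three_eq_one
    (ξ₁ ξ₂ : ℝ) (hind : LinearIndependent ℚ ![(1 : ℝ), ξ₁, ξ₂])
    (h : phiLow ξ₁ ξ₂ 3 = 1) :
    phiUp ξ₁ ξ₂ 2 = 1 ∧ phiUp ξ₁ ξ₂ 1 = -(1 / 2) ∧ phiLow ξ₁ ξ₂ 2 = -(1 / 2) := by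
  have hL3le {q : ℝ} (hq : 0 ≤ q) : Lmin ξ₁ ξ₂ 3 q ≤ q := Lmin_le (by norm_num) le_rfl hq
  have hbelow {j : ℕ} (hj : 1 ≤ j) (hj3 : j ≤ 3) :
      IsBoundedUnder (· ≥ ·) atTop fun q : ℝ => Lmin ξ₁ ξ₂ j q / q := by
    refine isBoundedUnder_of_eventually_ge (a := -2) ?_
    filter_upwards [eventually_gt_atTop 0] with q hq
    rw [le_div_iff₀ hq]
    linarith [neg_two_mul_le_Lmin (ξ₁ := ξ₁) (ξ₂ := ξ₂) hj hj3 hq.le]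
  have hle_one {j : ℕ} (hj : 1 ≤ j) (hj3 : j ≤ 3) : ∀ᶠ q : ℝ in atTop, Lmin ξ₁ ξ₂ j q / q ≤ 1 := by
    filter_upwards [eventually_gt_atTop 0] with q hq
    rw [div_le_one hq]
    exact Lmin_le hj hj3 hq.le
  have habove {j : ℕ} (hj : 1 ≤ j) (hj3 : j ≤ 3) :
      IsBoundedUnder (· ≤ ·) atTop fun q : ℝ => Lmin ξ₁ ξ₂ j q / q :=
    isBoundedUnder_of_eventually_le (hle_one hj hj3)
  have hlt_L3 {ε : ℝ} (hε : 0 < ε) : ∀ᶠ q : ℝ in atTop, (1 - ε) * q < Lmin ξ₁ ξ₂ 3 q := by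
    have h1 : 1 - ε < liminf (fun q : ℝ => Lmin ξ₁ ξ₂ 3 q / q) atTop := by
      rw [phiLow] at h; linarith
    filter_upwards [eventually_lt_of_lt_liminf h1 (hbelow (by norm_num) le_rfl),
      eventually_gt_atTop 0] with q hq hq0
    rwa [lt_div_iff₀ hq0] at hq
  have hthree : ∀ᶠ q : ℝ in atTop, 3 ≤ lambdaMin ξ₁ ξ₂ 3 q := by
    filter_upwards [hlt_L3 (ε := 1 / 2) (by norm_num), eventually_ge_atTop 4] with q hq hq4
    have hpos := lambdaMin_pos (ξ₁ := ξ₁) (ξ₂ := ξ₂) (j := 3) (by norm_num) le_rfl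
      (show 0 ≤ q by linarith)
    have h2 : (2 : ℝ) ≤ Real.log (lambdaMin ξ₁ ξ₂ 3 q) := by
      rw [Lmin] at hq; linarith
    have := (Real.le_log_iff_exp_le hpos).1 h2
    linarith [Real.add_one_le_exp 2]
  have hL1L3 : ∀ᶠ q : ℝ in atTop, 2 * Lmin ξ₁ ξ₂ 1 q + Lmin ξ₁ ξ₂ 3 q ≤ Real.log 8 := by
    filter_upwards [hthree, eventually_ge_atTop 0] with q hq hq0
    have h1 := lambdaMin_pos (ξ₁ := ξ₁) (ξ₂ := ξ₂) (j := 1) le_rfl (by norm_num) hq0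
    have h3 : 0 < lambdaMin ξ₁ ξ₂ 3 q := by linarith
    have := Real.log_le_log (by positivity) (lambdaMin_one_sq_mul_lambdaMin_three_le hq0 hq)
    rwa [Real.log_mul (by positivity) h3.ne', Real.log_pow] at this
  have hL2L3 {q : ℝ} (hq : 0 ≤ q) : 0 ≤ Real.log 6 + (2 * Lmin ξ₁ ξ₂ 2 q + Lmin ξ₁ ξ₂ 3 q) := by
    have h2 := lambdaMin_pos (ξ₁ := ξ₁) (ξ₂ := ξ₂) (j := 2) (by norm_num) (by norm_num) hq
    have h3 := lambdaMin_pos (ξ₁ := ξ₁) (ξ₂ := ξ₂) (j := 3) (by norm_num) le_rfl hq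
    have := Real.log_nonneg (one_le_lambdaMin_two_sq_mul (ξ₁ := ξ₁) (ξ₂ := ξ₂) hq)
    rwa [Real.log_mul (by norm_num) (by positivity), Real.log_mul (by positivity) h3.ne',
      Real.log_pow] at this
  set C := Real.log (2 * Real.exp 3) with hC
  have hlog {j k : ℕ} (hj : 1 ≤ j) (hj3 : j ≤ 3) (hk : 1 ≤ k) (hk3 : k ≤ 3) {q : ℝ} (hq : 0 ≤ q)
      (hle : lambdaMin ξ₁ ξ₂ k q ≤ 2 * Real.exp 3 * lambdaMin ξ₁ ξ₂ j q) :
      Lmin ξ₁ ξ₂ k q ≤ C + Lmin ξ₁ ξ₂ j q := by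
    have h1 := lambdaMin_pos (ξ₁ := ξ₁) (ξ₂ := ξ₂) hj hj3 hq
    have := Real.log_le_log (lambdaMin_pos hk hk3 hq) hle
    rwa [Real.log_mul (by positivity) h1.ne'] at this
  have hfreq12 : ∃ᶠ q : ℝ in atTop, Lmin ξ₁ ξ₂ 2 q ≤ C + Lmin ξ₁ ξ₂ 1 q := by
    refine frequently_atTop.2 fun a => ?_
    obtain ⟨q, hq, hle⟩ := exists_lambdaMin_two_le hind (le_max_right a 0)
    exact ⟨q, (le_max_left _ _).trans hq, hlog le_rfl (by norm_num) (by norm_num) (by norm_num)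
      ((le_max_right _ _).trans hq) hle⟩
  have hfreq23 : ∃ᶠ q : ℝ in atTop, Lmin ξ₁ ξ₂ 3 q ≤ C + Lmin ξ₁ ξ₂ 2 q := by
    obtain ⟨b, hb⟩ := eventually_atTop.1 hthree
    refine frequently_atTop.2 fun a => ?_
    obtain ⟨q, hq, hle⟩ := exists_lambdaMin_three_le hind
      (le_max_right (max a b) 0) fun q hq => by
        linarith [hb q ((le_max_right a b).trans ((le_max_left _ _).trans hq))]
    exact ⟨q, (le_max_left a b).trans ((le_max_left _ _).trans hq),
      hlog (by norm_num) (by norm_num) (by norm_num) le_rfl ((le_max_right _ _).trans hq) hle⟩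
  have hlarge (B : ℝ) {ε : ℝ} (hε : 0 < ε) : ∀ᶠ q : ℝ in atTop, B < ε * q := by
    filter_upwards [eventually_gt_atTop (B / ε)] with q hq
    rwa [div_lt_iff₀' hε] at hq
  refine ⟨le_antisymm ?_ ?_, le_antisymm ?_ ?_, le_antisymm ?_ ?_⟩
  · exact limsup_le_of_le (hbelow (by norm_num) (by norm_num)).isCoboundedUnder_flip
      (hle_one (by norm_num) (by norm_num))
  · refine le_of_forall_pos_le_add fun ε hε => ?_
    rw [← sub_le_iff_le_add]
    refine le_limsup_of_frequently_le ((hfreq23.and_eventually ((hlarge C (half_pos hε)).and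
      ((hlt_L3 (half_pos hε)).and (eventually_gt_atTop 0)))).mono ?_)
      (habove (by norm_num) (by norm_num))
    rintro q ⟨h1, h2, h3, hq⟩
    rw [le_div_iff₀ hq]
    linarith
  · refine le_of_forall_pos_le_add fun ε hε => ?_
    refine limsup_le_of_le (hbelow (by norm_num) (by norm_num)).isCoboundedUnder_flip ?_
    filter_upwards [hL1L3, hlarge (Real.log 8) hε, hlt_L3 hε, eventually_gt_atTop 0]
      with q h1 h2 h3 hq
    rw [div_le_iff₀ hq]
    linarith
  · refine le_of_forall_pos_le_add fun ε hε => ?_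
    rw [← sub_le_iff_le_add]
    refine le_limsup_of_frequently_le ((hfreq12.and_eventually
      ((hlarge (Real.log 6 + 2 * C) hε).and (eventually_gt_atTop 0))).mono ?_)
      (habove (by norm_num) (by norm_num))
    rintro q ⟨h1, h2, hq⟩
    rw [le_div_iff₀ hq]
    have h3 := hL2L3 hq.le
    have h4 := hL3le hq.le
    have h5 : 0 < ε * q := by positivity
    linarith
  · refine le_of_forall_pos_le_add fun ε hε => ?_
    refine liminf_le_of_frequently_le ((hfreq12.and_eventually
      ((hlarge (Real.log 8 + 2 * C) hε).and (hL1L3.and ((hlt_L3 hε).and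
        (eventually_gt_atTop 0))))).mono ?_) (hbelow (by norm_num) (by norm_num))
    rintro q ⟨h1, h2, h3, h4, hq⟩
    rw [div_le_iff₀ hq]
    linarith
  · refine le_of_forall_pos_le_add fun ε hε => ?_
    rw [← sub_le_iff_le_add]
    refine le_liminf_of_le (habove (by norm_num) (by norm_num)).isCoboundedUnder_flip ?_
    filter_upwards [hlarge (Real.log 6) hε, eventually_gt_atTop 0] with q h1 hq
    rw [le_div_iff₀ hq]
    have h3 := hL2L3 hq.le
    have h4 := hL3le hq.le
    have h5 : 0 < ε * q := by positivity
    linarith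
end
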